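/- Let f be a rational map of degree at least 2 with Julia set J. Assume f is non-exceptional, or f is exceptional but Σ ∩ J = ∅, and assume α⁻ < α⁺. Then for α⁻ ≤ α ≤ β ≤ α⁺ we have dim_H 𝓛(α,β) ≥ min{F(α), F(β)}. -/

import Mathlib

open Filter Set Metric MeasureTheory Topology
open scoped ENNReal NNReal

noncomputable section

/-! ### The Riemann sphere with the chordal (spherical) metric -/

/-- The Riemann sphere `ℂ ∪ {∞}`. -/
structure RSphere : Type where
  val : Option ℂ

namespace RSphere

/-- The inclusion of `ℂ` into the Riemann sphere. -/
def ofC (z : ℂ) : RSphere := ⟨some z⟩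

/-- The point at infinity. -/
def infty : RSphere := ⟨none⟩

/-- Case elimination on a point of the Riemann sphere. -/
def elim {α : Sort*} (x : RSphere) (i : α) (h : ℂ → α) : α := Option.elim x.val i h

/-- Stereographic embedding of the Riemann sphere onto the round unit sphere in
`ℝ³ = ℂ ×₂ ℝ`.  It induces the chordal (spherical) metric on `RSphere`. -/
def embed (x : RSphere) : WithLp 2 (ℂ × ℝ) :=
  elim x ((WithLp.equiv 2 (ℂ × ℝ)).symm (0, 1))
    fun z => (WithLp.equiv 2 (ℂ × ℝ)).symm
      (((2 / (‖z‖ ^ 2 + 1)) : ℝ) • z, (‖z‖ ^ 2 - 1) / (‖z‖ ^ 2 + 1))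

/-- Inverse of the stereographic embedding. -/
def unembed (v : WithLp 2 (ℂ × ℝ)) : RSphere :=
  if (WithLp.equiv 2 (ℂ × ℝ) v).2 = 1 then infty
  else ofC ((1 - (WithLp.equiv 2 (ℂ × ℝ) v).2)⁻¹ • (WithLp.equiv 2 (ℂ × ℝ) v).1)

lemma leftInverse_unembed : Function.LeftInverse unembed embed := by
  rintro ⟨x⟩
  cases x with
  | none =>
      simp [embed, unembed, elim, infty]
  | some z =>
      have h1 : (0 : ℝ) < ‖z‖ ^ 2 + 1 := by positivity
      have ht : (‖z‖ ^ 2 - 1) / (‖z‖ ^ 2 + 1) ≠ 1 := by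
        intro h
        rw [div_eq_one_iff_eq h1.ne'] at h
        linarith
      simp only [embed, unembed, elim, Option.elim, Equiv.apply_symm_apply, ht, if_false, ofC]
      congr 2
      rw [smul_smul]
      have h2 : 1 - (‖z‖ ^ 2 - 1) / (‖z‖ ^ 2 + 1) = 2 / (‖z‖ ^ 2 + 1) := by
        field_simp
        ring
      rw [h2]
      rw [inv_mul_cancel₀ (by positivity), one_smul]

lemma embed_injective : Function.Injective embed := leftInverse_unembed.injective

/-- The chordal metric on the Riemann sphere, induced by the stereographic embedding
onto the round unit sphere in Euclidean 3-space. -/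
instance : MetricSpace RSphere := MetricSpace.induced embed embed_injective inferInstance

instance : MeasurableSpace RSphere := borel RSphere

instance : BorelSpace RSphere := ⟨rfl⟩

/-- Reading off a finite point (junk value `0` at `∞`). -/
def toC (x : RSphere) : ℂ := elim x 0 id

/-- The involution `z ↦ 1/z` of the Riemann sphere. -/
def inv (x : RSphere) : RSphere :=
  elim x (ofC 0) fun z => if z = 0 then infty else ofC z⁻¹

end RSphere

/-! ### Basic dynamical notions -/

/-- The norm of the derivative of `g` at `x`, measured in the spherical metric
(for a rational map this is the usual norm of the spherical derivative). -/
def sphDeriv (g : RSphere → RSphere) (x : RSphere) : ℝ :=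
  limsup (fun y => dist (g y) (g x) / dist y x) (𝓝[≠] x)

/-- The set of critical points. -/
def critSet (g : RSphere → RSphere) : Set RSphere := {x | sphDeriv g x = 0}

/-- The Fatou set: points having a neighbourhood on which the family of iterates is
equicontinuous (i.e. normal). -/
def fatouSet (f : RSphere → RSphere) : Set RSphere :=
  {x | ∃ U : Set RSphere, IsOpen U ∧ x ∈ U ∧ EquicontinuousOn (fun n : ℕ => f^[n]) U}

/-- The Julia set. -/
def juliaSet (f : RSphere → RSphere) : Set RSphere := (fatouSet f)ᶜ

/-- `f` is the rational map on the Riemann sphere given by the coprime pair of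
polynomials `p`, `q`. -/
structure IsRationalMap (f : RSphere → RSphere) (p q : Polynomial ℂ) : Prop where
  coprime : IsCoprime p q
  continuous : Continuous f
  eval : ∀ z : ℂ, q.eval z ≠ 0 → f (RSphere.ofC z) = RSphere.ofC (p.eval z / q.eval z)

/-- The degree of the rational map `p/q`. -/
def ratDeg (p q : Polynomial ℂ) : ℕ := max p.natDegree q.natDegree

/-- The lower Lyapunov exponent `χ̲(x) = liminf (1/n) log |(fⁿ)'(x)|`, as an extended real. -/
def lyapLower (f : RSphere → RSphere) (x : RSphere) : EReal :=
  liminf (fun n : ℕ => ((Real.log (sphDeriv (f^[n]) x) / n : ℝ) : EReal)) atTop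

/-- The upper Lyapunov exponent `χ̄(x) = limsup (1/n) log |(fⁿ)'(x)|`, as an extended real. -/
def lyapUpper (f : RSphere → RSphere) (x : RSphere) : EReal :=
  limsup (fun n : ℕ => ((Real.log (sphDeriv (f^[n]) x) / n : ℝ) : EReal)) atTop

/-- The level set `𝓛(a,b)` of points of the Julia set with lower exponent `a` and
upper exponent `b`. -/
def levelSet (f : RSphere → RSphere) (a b : EReal) : Set RSphere :=
  {x | x ∈ juliaSet f ∧ lyapLower f x = a ∧ lyapUpper f x = b}

/-- The set `𝓛̂(α,β)` of points of the Julia set with `χ̲ ≤ β`, `χ̄ ≥ α` and `χ̄ > 0`. -/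
def levelHat (f : RSphere → RSphere) (α β : ℝ) : Set RSphere :=
  {x | x ∈ juliaSet f ∧ lyapLower f x ≤ (β : EReal) ∧ (α : EReal) ≤ lyapUpper f x ∧
    0 < lyapUpper f x}

/-- Birkhoff sum `S_m φ = φ + φ∘g + ⋯ + φ∘g^{m-1}`. -/
def birkhoff (g : RSphere → RSphere) (φ : RSphere → ℝ) (m : ℕ) (x : RSphere) : ℝ :=
  ∑ k ∈ Finset.range m, φ (g^[k] x)

/-- An `(m,ε)`-separated finite subset of `Λ` for the map `g`. -/
def IsSepSet (g : RSphere → RSphere) (Λ : Set RSphere) (m : ℕ) (ε : ℝ)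
    (E : Finset RSphere) : Prop :=
  ↑E ⊆ Λ ∧ ∀ x ∈ E, ∀ y ∈ E, x ≠ y → ∃ k < m, ε ≤ dist (g^[k] x) (g^[k] y)

/-- Topological pressure of the potential `φ` for `g` restricted to `Λ`,
defined à la Bowen via `(m,ε)`-separated sets. -/
def pressureOn (g : RSphere → RSphere) (Λ : Set RSphere) (φ : RSphere → ℝ) : ℝ :=
  ⨆ ε : {ε : ℝ // 0 < ε}, limsup (fun m : ℕ =>
    Real.log (⨆ E : {E : Finset RSphere // IsSepSet g Λ m ε.1 E},
      ∑ x ∈ E.1, Real.exp (birkhoff g φ m x)) / m) atTop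

/-- `g` is uniformly expanding on `Λ`: `|(gᵐ)'(x)| ≥ c λᵐ` for some `c > 0`, `λ > 1`. -/
def ExpandingOn (g : RSphere → RSphere) (Λ : Set RSphere) : Prop :=
  ∃ c > (0 : ℝ), ∃ l : ℝ, 1 < l ∧ ∀ x ∈ Λ, ∀ m : ℕ, 1 ≤ m → c * l ^ m ≤ sphDeriv (g^[m]) x

/-- `Λ` is a repeller for `g`: a compact invariant isolated set. -/
def IsRepeller (g : RSphere → RSphere) (Λ : Set RSphere) : Prop :=
  IsCompact Λ ∧ g '' Λ = Λ ∧
    ∃ U : Set RSphere, IsOpen U ∧ Λ ⊆ U ∧ ∀ x, (∀ m : ℕ, g^[m] x ∈ U) → x ∈ Λ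

/-- Topological transitivity of `g` on `Λ`. -/
def TopTransOn (g : RSphere → RSphere) (Λ : Set RSphere) : Prop :=
  ∀ U V : Set RSphere, IsOpen U → IsOpen V → (U ∩ Λ).Nonempty → (V ∩ Λ).Nonempty →
    ∃ m : ℕ, (g^[m] '' (U ∩ Λ) ∩ V).Nonempty

/-- The topological pressure of `φ` with respect to `f` on its Julia set, given by
the supremum of the pressures on compact invariant uniformly expanding subsets of `J`. -/
def pressureTop (f : RSphere → RSphere) (φ : RSphere → ℝ) : ℝ :=
  ⨆ L : {L : Set RSphere //
      L.Nonempty ∧ L ⊆ juliaSet f ∧ IsCompact L ∧ f '' L = L ∧ ExpandingOn f L},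
    pressureOn f L.1 φ

/-- The pressure function `d ↦ P(φ_d)` where `φ_d = -d log|f'|`. -/
def pressFamily (f : RSphere → RSphere) (d : ℝ) : ℝ :=
  pressureTop f fun x => -d * Real.log (sphDeriv f x)

/-- `F(α) = α⁻¹ inf_d (Q(d) + dα)` associated with a pressure function `Q` (for `α ≠ 0`). -/
def specF (Q : ℝ → ℝ) (α : ℝ) : EReal :=
  ((α⁻¹ : ℝ) : EReal) * ⨅ d : ℝ, ((Q d + d * α : ℝ) : EReal)

/-- `F(0) = lim_{α → 0⁺} F(α)`. -/
def specF0 (Q : ℝ → ℝ) : EReal := limsup (fun α : ℝ => specF Q α) (𝓝[>] (0 : ℝ))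

/-- The full spectrum function `F` associated with a pressure function `Q`. -/
def specFext (Q : ℝ → ℝ) (α : ℝ) : EReal := if α = 0 then specF0 Q else specF Q α

/-- The Lyapunov spectrum function `F` of `f`. -/
def Ffun (f : RSphere → RSphere) (α : ℝ) : EReal := specFext (pressFamily f) α

/-- `α⁻ = lim_{d → +∞} -Q(d)/d` for a pressure function `Q`. -/
def alphaMinusOf (Q : ℝ → ℝ) : ℝ := limsup (fun d : ℝ => -Q d / d) atTop

/-- `α⁺ = lim_{d → -∞} -Q(d)/d` for a pressure function `Q`. -/
def alphaPlusOf (Q : ℝ → ℝ) : ℝ := limsup (fun d : ℝ => -Q d / d) atBot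

/-- `α⁻` for the map `f`. -/
def alphaMinus (f : RSphere → RSphere) : ℝ := alphaMinusOf (pressFamily f)

/-- `α⁺` for the map `f`. -/
def alphaPlus (f : RSphere → RSphere) : ℝ := alphaPlusOf (pressFamily f)

/-- The Lyapunov exponent `χ(μ) = ∫ log|g'| dμ` of a measure. -/
def lyapMeas (g : RSphere → RSphere) (μ : Measure RSphere) : ℝ :=
  ∫ x, Real.log (sphDeriv g x) ∂μ

/-- `α⁻` as the infimum of Lyapunov exponents of invariant probability measures on `J`. -/
def alphaMinusMeas (f : RSphere → RSphere) : ℝ :=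
  sInf {r : ℝ | ∃ μ : Measure RSphere, IsProbabilityMeasure μ ∧ MeasurePreserving f μ μ ∧
    μ (juliaSet f)ᶜ = 0 ∧ r = lyapMeas f μ}

/-- `α⁺` as the supremum of Lyapunov exponents of invariant probability measures on `J`. -/
def alphaPlusMeas (f : RSphere → RSphere) : ℝ :=
  sSup {r : ℝ | ∃ μ : Measure RSphere, IsProbabilityMeasure μ ∧ MeasurePreserving f μ μ ∧
    μ (juliaSet f)ᶜ = 0 ∧ r = lyapMeas f μ}

/-- The maximal distortion `sup_{x,y ∈ Z} |g'(x)|/|g'(y)|` of `g` on `Z`. -/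
def distortionOn (g : RSphere → RSphere) (Z : Set RSphere) : ℝ :=
  sSup {r : ℝ | ∃ x ∈ Z, ∃ y ∈ Z, r = sphDeriv g x / sphDeriv g y}

/-- Conical points. -/
def IsConical (f : RSphere → RSphere) (x : RSphere) : Prop :=
  ∃ r : ℝ, 0 < r ∧ ∃ K : ℝ, ∃ n : ℕ → ℕ, StrictMono n ∧ ∃ U : ℕ → Set RSphere,
    ∀ i, U i ∈ 𝓝 x ∧ ball (f^[n i] x) r ⊆ f^[n i] '' U i ∧ distortionOn (f^[n i]) (U i) ≤ K

/-- A non-immediately postcritical point: there is a backward orbit through it that is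
dense in the Julia set and avoids the critical points. -/
def NonImmPostCrit (f : RSphere → RSphere) (x : RSphere) : Prop :=
  ∃ b : ℕ → RSphere, b 0 = x ∧ (∀ n, f (b (n + 1)) = b n) ∧
    juliaSet f ⊆ closure (Set.range b) ∧ ∀ n, b n ∉ critSet f

/-- `f` is exceptional: there is a finite nonempty set `Σ_f` with `f⁻¹(Σ_f) \ Crit = Σ_f`. -/
def IsExceptional (f : RSphere → RSphere) : Prop :=
  ∃ S : Set RSphere, S.Finite ∧ S.Nonempty ∧ f ⁻¹' S \ critSet f = S

/-- The largest exceptional set `Σ` of `f`. -/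
def maxExceptional (f : RSphere → RSphere) : Set RSphere :=
  ⋃₀ {S : Set RSphere | S.Finite ∧ S.Nonempty ∧ f ⁻¹' S \ critSet f = S}

/-- `0` not being exceptional, or having exceptional set away from the Julia set. -/
def GoodExc (f : RSphere → RSphere) : Prop :=
  ¬ IsExceptional f ∨ maxExceptional f ∩ juliaSet f = ∅

/-- A parabolic periodic point at a finite point `z`: a periodic point whose multiplier
is a root of unity. -/
def IsParabolicFix (g : RSphere → RSphere) (z : ℂ) : Prop :=
  ∃ m : ℕ, 0 < m ∧ g^[m] (RSphere.ofC z) = RSphere.ofC z ∧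
    ∃ lam : ℂ, (∃ k : ℕ, 0 < k ∧ lam ^ k = 1) ∧
      HasDerivAt (fun w => RSphere.toC (g^[m] (RSphere.ofC w))) lam z

/-- A parabolic periodic point of `f` (at a finite point, or at `∞` read in the chart `1/z`). -/
def IsParabolic (f : RSphere → RSphere) (x : RSphere) : Prop :=
  (∃ z : ℂ, x = RSphere.ofC z ∧ IsParabolicFix f z) ∨
  (x = RSphere.infty ∧ IsParabolicFix (fun y => RSphere.inv (f (RSphere.inv y))) 0)

/-- A recurrent point. -/
def IsRecurrentPt (f : RSphere → RSphere) (x : RSphere) : Prop :=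
  ∃ n : ℕ → ℕ, StrictMono n ∧ Tendsto (fun i => f^[n i] x) atTop (𝓝 x)

/-! ### Graph directed systems and expanding Cantor repellers -/

/-- A graph directed system (GDS) satisfying the strong separation condition with
respect to the map `g`. -/
structure GDS (g : RSphere → RSphere) where
  /-- number of vertices -/
  n : ℕ
  npos : 0 < n
  /-- the open domains -/
  U : Fin n → Set RSphere
  /-- the admissible edges -/
  edge : Fin n → Fin n → Prop
  /-- the inverse branches -/
  br : Fin n → Fin n → RSphere → RSphere
  isOpen : ∀ k, IsOpen (U k)
  isConnected : ∀ k, IsConnected (U k)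
  disjClosure : ∀ k l, k ≠ l → closure (U k) ∩ closure (U l) = ∅
  mapsTo : ∀ k l, edge k l → Set.MapsTo (br k l) (closure (U l)) (U k)
  isBranch : ∀ k l, edge k l → ∀ x ∈ closure (U l), g (br k l x) = x
  bddDistortion : ∃ C : ℝ, ∀ k l, edge k l → distortionOn (br k l) (closure (U l)) ≤ C

/-- The cylinder sets of depth `m` of a GDS. -/
def gdsCyl {g : RSphere → RSphere} (G : GDS g) : ℕ → Set RSphere
  | 0 => ⋃ k, G.U k
  | m + 1 => ⋃ (k : Fin G.n) (l : Fin G.n) (_ : G.edge k l),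
      G.br k l '' (gdsCyl G m ∩ G.U l)

/-- The limit set of a GDS. -/
def gdsLimit {g : RSphere → RSphere} (G : GDS g) : Set RSphere := ⋂ m, gdsCyl G m

/-- An expanding Cantor repeller (ECR) for `g`: a uniformly expanding repeller which is
the limit set of a GDS satisfying the strong separation condition, with `g(Λ) = Λ`. -/
def IsECR (g : RSphere → RSphere) (Λ : Set RSphere) : Prop :=
  ExpandingOn g Λ ∧ IsRepeller g Λ ∧ ∃ G : GDS g, gdsLimit G = Λ

/-- A Cantor set: compact, perfect and totally disconnected. -/
def IsCantorSet (s : Set RSphere) : Prop :=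
  IsCompact s ∧ Perfect s ∧ IsTotallyDisconnected s

/-! ### Entropy, equilibrium states and dimensions -/

/-- The entropy of a countable partition (given by the fibers of `p`). -/
def partEntropy {ι : Type} [Countable ι] (μ : Measure RSphere) (p : RSphere → ι) : ℝ :=
  ∑' i : ι, Real.negMulLog (μ (p ⁻¹' {i})).toReal

/-- Measure-theoretic (Kolmogorov–Sinai) entropy of `T` with respect to `μ`:
supremum over finite measurable partitions of the exponential growth rate of the
entropies of the dynamical refinements. -/
def entropyOf (T : RSphere → RSphere) (μ : Measure RSphere) : ℝ :=
  ⨆ p : {p : RSphere → ℕ // Measurable p ∧ (Set.range p).Finite},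
    ⨅ n : {n : ℕ // 0 < n},
      partEntropy μ (fun x => fun k : Fin n.1 => p.1 (T^[(k : ℕ)] x)) / (n.1 : ℝ)

/-- An equilibrium state for the potential `φ` with respect to `g` restricted to `Λ`. -/
def IsEquilibrium (g : RSphere → RSphere) (Λ : Set RSphere) (φ : RSphere → ℝ)
    (μ : Measure RSphere) : Prop :=
  IsProbabilityMeasure μ ∧ μ Λᶜ = 0 ∧ MeasurePreserving g μ μ ∧
    entropyOf g μ + ∫ x, φ x ∂μ = pressureOn g Λ φ

/-- The Hausdorff dimension of a measure: the infimum of the Hausdorff dimensions of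
sets of full measure. -/
def dimHMeasure (μ : Measure RSphere) : ℝ≥0∞ :=
  ⨅ (s : Set RSphere) (_ : μ sᶜ = 0), dimH s

/-- The minimal number of `ε`-balls needed to cover `s`. -/
def coverNum (s : Set RSphere) (ε : ℝ) : ℕ :=
  sInf {n : ℕ | ∃ t : Finset RSphere, t.card = n ∧ s ⊆ ⋃ x ∈ t, ball x ε}

/-- The upper box-counting dimension. -/
def upperBoxDim (s : Set RSphere) : ℝ :=
  limsup (fun n : ℕ => Real.log (coverNum s (1 / n)) / Real.log n) atTop

/-- The packing dimension, via countable covers and upper box dimensions. -/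
def dimP (s : Set RSphere) : ℝ≥0∞ :=
  ⨅ c : {c : ℕ → Set RSphere // s ⊆ ⋃ n, c n},
    ⨆ n : ℕ, ENNReal.ofReal (upperBoxDim (c.1 n))

/-- The connected component of `y` in `g⁻¹(B)`: the pull-back of `B` along the inverse
branch of `g` sending (the image of) `y` to `y`. -/
def invBranchSet (g : RSphere → RSphere) (B : Set RSphere) (y : RSphere) : Set RSphere :=
  connectedComponentIn (g ⁻¹' B) y

end

open Filter Set Metric MeasureTheory Topology
open scoped ENNReal NNReal Real

/-- A holomorphic function whose derivative on a disc is at most twice its (nonzero) value at the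
centre covers a disc of definite size. -/
lemma ball_subset_image_of_norm_deriv_le {g : ℂ → ℂ} {a : ℂ} {t : ℝ} (ht : 0 < t)
    (hg : DifferentiableOn ℂ g (ball a t)) (ha : deriv g a ≠ 0)
    (hb : ∀ z ∈ ball a t, ‖deriv g z‖ ≤ 2 * ‖deriv g a‖) :
    ball (g a) (‖deriv g a‖ * t / 24) ⊆ g '' ball a t := by
  set m := ‖deriv g a‖ with hm
  have hm0 : 0 < m := norm_pos_iff.mpr ha
  have hat : a ∈ ball a t := mem_ball_self ht
  have hga : HasDerivAt g (deriv g a) a :=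
    (hg.differentiableAt (isOpen_ball.mem_nhds hat)).hasDerivAt
  set k : ℂ → ℂ := fun z => g z - g a - deriv g a * (z - a) with hk
  have hka : k a = 0 := by simp [hk]
  have hkd : ∀ z ∈ ball a t, HasDerivAt k (deriv g z - deriv g a) z := by
    intro z hz
    have h1 := (hg.differentiableAt (isOpen_ball.mem_nhds hz)).hasDerivAt
    have h2 := ((hasDerivAt_id z).sub_const a).const_mul (deriv g a)
    exact ((h1.sub_const (g a)).sub h2).congr_deriv (by simp)
  have hkD : DifferentiableOn ℂ k (ball a t) := fun z hz =>
    (hkd z hz).differentiableAt.differentiableWithinAt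
  have hkbd : MapsTo k (ball a t) (closedBall (k a) (3 * m * t)) := by
    intro z hz
    rw [hka, mem_closedBall_zero_iff]
    have := (convex_ball a t).norm_image_sub_le_of_norm_hasDerivWithin_le (C := 3 * m)
      (fun x hx => (hkd x hx).hasDerivWithinAt) (fun x hx => by
        refine (norm_sub_le _ _).trans ?_
        have := hb x hx
        linarith) hat hz
    rw [hka, sub_zero] at this
    refine this.trans ?_
    have hz' : ‖z - a‖ ≤ t := by simpa [dist_eq_norm] using (mem_ball.mp hz).le
    gcongr
  have hko : (k · - k a) =o[𝓝 a] (fun w => ‖w - a‖ ^ 1) := by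
    have h := (hasDerivAt_iff_isLittleO.mp hga)
    have h' : (k · - k a) = fun x => g x - g a - (x - a) • deriv g a := by
      funext x; simp [hk, mul_comm]
    rw [h']
    simpa using h.norm_right
  have hkest : ∀ z ∈ ball a t, ‖k z‖ ≤ 3 * m * t * (‖z - a‖ / t) ^ 2 := by
    intro z hz
    have := Complex.dist_le_mul_div_pow_of_mapsTo_ball_of_isLittleO hkD hkbd hko hz
    simpa [hka, dist_eq_norm] using this
  have hsub : closedBall a (t / 6) ⊆ ball a t := closedBall_subset_ball (by linarith)
  have hsph : ∀ z ∈ sphere a (t / 6), m * t / 12 ≤ ‖g z - g a‖ := by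
    intro z hz
    have hz1 : ‖z - a‖ = t / 6 := by simpa [dist_eq_norm] using hz
    have h1 := hkest z (hsub (sphere_subset_closedBall hz))
    rw [hz1] at h1
    have h2 : 3 * m * t * (t / 6 / t) ^ 2 = m * t / 12 := by field_simp; ring
    rw [h2] at h1
    have h3 : g z - g a = deriv g a * (z - a) + k z := by simp [hk]
    have h4 : ‖deriv g a * (z - a)‖ = m * (t / 6) := by rw [norm_mul, hz1]
    have h5 : ‖deriv g a * (z - a)‖ - ‖k z‖ ≤ ‖g z - g a‖ := by
      rw [h3]
      have := norm_sub_norm_le (deriv g a * (z - a)) (-(k z))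
      simpa using this
    linarith
  have hne : ∃ᶠ z in 𝓝 a, g z ≠ g a :=
    (hga.eventually_ne ha).frequently.filter_mono nhdsWithin_le_nhds
  have hdc : DiffContOnCl ℂ g (ball a (t / 6)) := by
    apply DifferentiableOn.diffContOnCl
    exact hg.mono (closure_ball_subset_closedBall.trans hsub)
  have := hdc.ball_subset_image_closedBall (by positivity) hsph hne
  have h24 : m * t / 12 / 2 = m * t / 24 := by ring
  rw [h24] at this
  exact this.trans (image_mono hsub)

/-- **Bloch-type estimate**: the derivative of a holomorphic function on a disc of radius `R`
whose image contains no disc of radius `2`. -/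
lemma norm_deriv_mul_le_of_not_ball_subset {g : ℂ → ℂ} {z₀ : ℂ} {R : ℝ} (hR : 0 < R)
    (hg : DifferentiableOn ℂ g (ball z₀ R)) (hno : ∀ c, ¬ ball c 2 ⊆ g '' ball z₀ R) :
    ‖deriv g z₀‖ * R ≤ 96 := by
  have key : ∀ R' ∈ Ioo 0 R, ‖deriv g z₀‖ * R' ≤ 96 := by
    rintro R' ⟨h0, h1⟩
    have hsub : closedBall z₀ R' ⊆ ball z₀ R := closedBall_subset_ball h1
    have hcont : ContinuousOn (fun z => ‖deriv g z‖ * (R' - ‖z - z₀‖)) (closedBall z₀ R') := by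
      have := (hg.deriv isOpen_ball).continuousOn.mono hsub
      fun_prop
    obtain ⟨a, ha, hmax⟩ := (isCompact_closedBall z₀ R').exists_isMaxOn
      ⟨z₀, mem_closedBall_self h0.le⟩ hcont
    have hz := hmax (mem_closedBall_self h0.le)
    simp only [mem_ofPred_eq, sub_self, norm_zero, sub_zero] at hz
    refine hz.trans ?_
    have ha' : ‖a - z₀‖ ≤ R' := by simpa [dist_eq_norm] using ha
    by_contra! hcon
    have hpos : 0 < ‖deriv g a‖ * (R' - ‖a - z₀‖) := by linarith
    have hra : 0 < R' - ‖a - z₀‖ := by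
      rcases (sub_nonneg.mpr ha').eq_or_lt with h | h
      · rw [← h] at hpos; simp at hpos
      · exact h
    have hda : deriv g a ≠ 0 := by
      intro h; rw [h] at hpos; simp at hpos
    set t := (R' - ‖a - z₀‖) / 2 with ht
    have ht0 : 0 < t := by positivity
    have hbsub : ball a t ⊆ closedBall z₀ R' := by
      intro z hz
      rw [mem_ball, dist_eq_norm] at hz
      rw [mem_closedBall, dist_eq_norm]
      have := norm_sub_le_norm_sub_add_norm_sub z a z₀
      linarith
    have hb : ∀ z ∈ ball a t, ‖deriv g z‖ ≤ 2 * ‖deriv g a‖ := by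
      intro z hz
      have h2 := hmax (hbsub hz)
      simp only [mem_ofPred_eq] at h2
      rw [mem_ball, dist_eq_norm] at hz
      have h3 := norm_sub_le_norm_sub_add_norm_sub z a z₀
      have h4 : t ≤ R' - ‖z - z₀‖ := by linarith
      have h5 : ‖deriv g z‖ * t ≤ ‖deriv g a‖ * (2 * t) := by
        calc _ ≤ ‖deriv g z‖ * (R' - ‖z - z₀‖) := by gcongr
          _ ≤ _ := h2
          _ = _ := by rw [ht]; ring
      nlinarith
    have h6 := ball_subset_image_of_norm_deriv_le ht0 (hg.mono (hbsub.trans hsub)) hda hb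
    apply hno (g a)
    refine Subset.trans (ball_subset_ball ?_) (h6.trans (image_mono (hbsub.trans hsub)))
    have : ‖deriv g a‖ * (R' - ‖a - z₀‖) = ‖deriv g a‖ * t * 2 := by rw [ht]; ring
    linarith
  have hlim : Tendsto (fun R' => ‖deriv g z₀‖ * R') (𝓝[<] R) (𝓝 (‖deriv g z₀‖ * R)) :=
    ((continuous_const.mul continuous_id).tendsto R).mono_left nhdsWithin_le_nhds
  refine le_of_tendsto hlim ?_
  filter_upwards [Ioo_mem_nhdsLT hR] with R' h using key R' h

/-- Holomorphic logarithm on a disc with prescribed value at the centre. -/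
lemma exists_log_on_ball {h : ℂ → ℂ} {c : ℂ} {R : ℝ} (hR : 0 < R)
    (hd : DifferentiableOn ℂ h (ball c R)) (h0 : ∀ z ∈ ball c R, h z ≠ 0) {w : ℂ}
    (hw : Complex.exp w = h c) :
    ∃ F : ℂ → ℂ, F c = w ∧ DifferentiableOn ℂ F (ball c R) ∧
      ∀ z ∈ ball c R, Complex.exp (F z) = h z := by
  have hq : DifferentiableOn ℂ (fun z => deriv h z / h z) (ball c R) :=
    (hd.deriv isOpen_ball).div hd h0
  obtain ⟨F, hFc, hF⟩ := hq.isExactOn_ball.with_val_at c w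
  have hcm : c ∈ ball c R := mem_ball_self hR
  refine ⟨F, hFc, fun z hz => (hF z hz).differentiableAt.differentiableWithinAt, ?_⟩
  have hder : ∀ z ∈ ball c R, HasDerivAt (fun z => h z * Complex.exp (-F z)) 0 z := by
    intro z hz
    have h1 := (hd.differentiableAt (isOpen_ball.mem_nhds hz)).hasDerivAt
    have h2 := (hF z hz).neg.cexp
    refine (h1.mul h2).congr_deriv ?_
    field_simp [h0 z hz]
    simp
  intro z hz
  have hconst := (convex_ball c R).norm_image_sub_le_of_norm_hasDerivWithin_le (C := 0)
    (fun x hx => (hder x hx).hasDerivWithinAt) (fun x hx => by simp) hcm hz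
  have h3 : h z * Complex.exp (-F z) = 1 := by
    have h4 : h z * Complex.exp (-F z) = h c * Complex.exp (-F c) := by
      simpa [sub_eq_zero] using hconst
    rw [h4, hFc, ← hw, ← Complex.exp_add]; simp
  rw [Complex.exp_neg] at h3
  field_simp [Complex.exp_ne_zero] at h3
  exact h3.symm

/-- Holomorphic square root on a disc. -/
lemma exists_sqrt_on_ball {h : ℂ → ℂ} {c : ℂ} {R : ℝ} (hR : 0 < R)
    (hd : DifferentiableOn ℂ h (ball c R)) (h0 : ∀ z ∈ ball c R, h z ≠ 0) :
    ∃ u : ℂ → ℂ, DifferentiableOn ℂ u (ball c R) ∧ ∀ z ∈ ball c R, u z ^ 2 = h z := by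
  obtain ⟨F, -, hF, hF2⟩ := exists_log_on_ball hR hd h0
    (Complex.exp_log (h0 c (mem_ball_self hR)))
  refine ⟨fun z => Complex.exp (F z / 2), (hF.div_const 2).cexp, fun z hz => ?_⟩
  rw [← hF2 z hz, ← Complex.exp_nat_mul]
  congr 1
  push_cast
  ring

lemma exists_nat_log_near {x : ℝ} (hx : 0 ≤ x) :
    ∃ n : ℕ, 1 ≤ n ∧ |Real.log (√n + √(n - 1)) - x| ≤ 1 := by
  have hc : 1 ≤ Real.cosh x := Real.one_le_cosh x
  set n := ⌈Real.cosh x ^ 2⌉₊ with hn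
  have h1 : Real.cosh x ^ 2 ≤ n := Nat.le_ceil _
  have h2 : (n : ℝ) < Real.cosh x ^ 2 + 1 := Nat.ceil_lt_add_one (by positivity)
  have hn1 : (1 : ℝ) ≤ n := by nlinarith
  have hs1 : Real.cosh x ≤ √n := Real.le_sqrt_of_sq_le h1
  have hs2 : Real.sinh x ≤ √(n - 1) := by
    apply Real.le_sqrt_of_sq_le
    have := Real.cosh_sq x
    linarith
  have hs3 : √(n : ℝ) ≤ 1.5 * Real.cosh x := by
    rw [Real.sqrt_le_left (by positivity)]
    nlinarith
  have hs4 : √((n : ℝ) - 1) ≤ Real.cosh x := by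
    rw [Real.sqrt_le_left (by positivity)]
    linarith
  have hpos : 0 < √(n : ℝ) + √(n - 1) := by
    have := Real.sqrt_nonneg ((n : ℝ) - 1)
    linarith
  refine ⟨n, by exact_mod_cast hn1, ?_⟩
  have hlow : x ≤ Real.log (√n + √(n - 1)) := by
    rw [Real.le_log_iff_exp_le hpos]
    have := Real.cosh_add_sinh x
    linarith
  have hup : Real.log (√n + √(n - 1)) ≤ x + 1 := by
    rw [Real.log_le_iff_le_exp hpos, Real.exp_add]
    have h5 : Real.cosh x ≤ Real.exp x := by
      rw [Real.cosh_eq]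
      have : Real.exp (-x) ≤ Real.exp x := Real.exp_le_exp.mpr (by linarith)
      linarith
    have h6 := Real.exp_one_gt_d9
    have h7 : (2.5 : ℝ) ≤ Real.exp 1 := by norm_num at h6 ⊢; linarith
    have h8 := Real.exp_pos x
    nlinarith
  rw [abs_le]
  constructor <;> linarith

lemma cosh_two_mul_log_add {n : ℕ} (hn : 1 ≤ n) (k : ℤ) (s : ℝ) (hs : s = 1 ∨ s = -1) :
    Complex.cosh (2 * ((s * Real.log (√n + √(n - 1)) : ℝ) + (k * (π / 2) : ℝ) * Complex.I)) =
      2 * n - 1 ∨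
    Complex.cosh (2 * ((s * Real.log (√n + √(n - 1)) : ℝ) + (k * (π / 2) : ℝ) * Complex.I)) =
      -(2 * n - 1) := by
  have hn' : (1 : ℝ) ≤ n := by exact_mod_cast hn
  set a := √(n : ℝ) + √(n - 1) with ha
  have hsq1 : √(n : ℝ) ^ 2 = n := Real.sq_sqrt (by linarith)
  have hsq2 : √((n : ℝ) - 1) ^ 2 = n - 1 := Real.sq_sqrt (by linarith)
  have hpos : 0 < a := by
    have h1 : 0 < √(n : ℝ) := Real.sqrt_pos.mpr (by linarith)
    have h2 := Real.sqrt_nonneg ((n : ℝ) - 1)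
    linarith
  have hinv : a⁻¹ = √(n : ℝ) - √(n - 1) := by
    apply inv_eq_of_mul_eq_one_right
    rw [ha]
    linear_combination hsq1 - hsq2
  have hcy : Real.cosh (Real.log a) = √n := by
    rw [Real.cosh_log hpos, hinv, ha]; ring
  have hc2 : Real.cosh (2 * Real.log a) = 2 * n - 1 := by
    rw [Real.cosh_two_mul, Real.sinh_sq, hcy, hsq1]; ring
  have hc3 : Real.cosh (2 * (s * Real.log a)) = 2 * n - 1 := by
    rcases hs with rfl | rfl
    · rw [one_mul, hc2]
    · rw [← hc2, ← Real.cosh_neg]; congr 1; ring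
  have harg : (2 * (((s * Real.log a : ℝ) : ℂ) + ((k * (π / 2) : ℝ) : ℂ) * Complex.I)) =
      ((2 * (s * Real.log a) : ℝ) : ℂ) + ((k * π : ℝ) : ℂ) * Complex.I := by
    push_cast; ring
  have hval : Complex.cosh (2 * (((s * Real.log a : ℝ) : ℂ) +
      ((k * (π / 2) : ℝ) : ℂ) * Complex.I)) = ((Real.cos (k * π) * (2 * n - 1) : ℝ) : ℂ) := by
    rw [harg, Complex.cosh_add, Complex.cosh_mul_I, Complex.sinh_mul_I, ← Complex.ofReal_cosh,
      ← Complex.ofReal_sinh, ← Complex.ofReal_cos, ← Complex.ofReal_sin, Real.sin_int_mul_pi, hc3]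
    push_cast; ring
  rw [hval]
  rcases (abs_eq zero_le_one).mp (Real.abs_cos_int_mul_pi k) with h | h <;> rw [h]
  · left; push_cast; ring
  · right; push_cast; ring

/-- If `cosh (G)² ` avoids the integers then the image of `G` contains no disc of radius two. -/
lemma not_ball_subset_of_cosh_ne {G : ℂ → ℂ} {S : Set ℂ}
    (hG : ∀ z ∈ S, ∀ m : ℤ, Complex.cosh (G z) ^ 2 ≠ m) (c : ℂ) : ¬ ball c 2 ⊆ G '' S := by
  intro hsub
  obtain ⟨s, hs, hsx⟩ : ∃ s : ℝ, (s = 1 ∨ s = -1) ∧ |c.re| = s * c.re := by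
    rcases abs_cases c.re with h | h
    · exact ⟨1, Or.inl rfl, by rw [h.1, one_mul]⟩
    · exact ⟨-1, Or.inr rfl, by rw [h.1]; ring⟩
  have hss : s * s = 1 := by rcases hs with rfl | rfl <;> norm_num
  have habs : |s| = 1 := by rcases hs with rfl | rfl <;> norm_num
  obtain ⟨n, hn1, hn⟩ := exists_nat_log_near (abs_nonneg c.re)
  set k : ℤ := round (c.im / (π / 2)) with hk
  set y := Real.log (√(n : ℝ) + √(n - 1)) with hy
  set p : ℂ := ((s * y : ℝ) : ℂ) + ((k * (π / 2) : ℝ) : ℂ) * Complex.I with hp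
  have hmem : p ∈ ball c 2 := by
    rw [mem_ball, dist_eq_norm]
    refine (Complex.norm_le_abs_re_add_abs_im _).trans_lt ?_
    have h1 : |(p - c).re| ≤ 1 := by
      have : (p - c).re = s * (y - |c.re|) := by
        rw [hsx, mul_sub, ← mul_assoc, hss]; simp [hp]
      rw [this, abs_mul, habs, one_mul]; exact hn
    have h2 : |(p - c).im| ≤ π / 4 := by
      have h3 := abs_sub_round (c.im / (π / 2))
      have : (p - c).im = -(c.im / (π / 2) - k) * (π / 2) := by
        simp [hp]; field_simp
      rw [this, abs_mul, abs_neg, abs_of_pos (a := π / 2) (by positivity)]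
      calc _ ≤ 1 / 2 * (π / 2) := by gcongr
        _ = _ := by ring
    have := Real.pi_lt_four
    linarith
  obtain ⟨z, hz, hzp⟩ := hsub hmem
  have hid : Complex.cosh (G z) ^ 2 = (Complex.cosh (2 * p) + 1) / 2 := by
    rw [hzp, Complex.cosh_two_mul, Complex.sinh_sq]; ring
  rcases cosh_two_mul_log_add hn1 k s hs with h | h
  · apply hG z hz n
    rw [hid, hp, h]; push_cast; ring
  · apply hG z hz (1 - n)
    rw [hid, hp, h]; push_cast; ring

lemma norm_log_le {w : ℂ} (h1 : 1 / 2 ≤ ‖w‖) (h2 : ‖w‖ ≤ 2) : ‖Complex.log w‖ ≤ 2 * π := by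
  refine (Complex.norm_le_abs_re_add_abs_im _).trans ?_
  rw [Complex.log_re, Complex.log_im]
  have h3 := Complex.abs_arg_le_pi w
  have hl2 := Real.log_two_lt_d9
  have h4 : |Real.log ‖w‖| ≤ 1 := by
    rw [abs_le]
    constructor
    · have : Real.log (1 / 2) ≤ Real.log ‖w‖ := Real.log_le_log (by norm_num) h1
      rw [Real.log_div one_ne_zero two_ne_zero, Real.log_one] at this
      linarith
    · have : Real.log ‖w‖ ≤ Real.log 2 := Real.log_le_log (by linarith) h2
      linarith
  have := Real.pi_gt_three
  linarith

/-- **Schottky's theorem** in a qualitative form. -/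
lemma exists_schottky_bound : ∃ M : ℝ, 0 < M ∧ ∀ (h : ℂ → ℂ) (c : ℂ) (R : ℝ), 0 < R →
    DifferentiableOn ℂ h (ball c R) → (∀ z ∈ ball c R, h z ≠ 0 ∧ h z ≠ 1) →
    1 / 2 ≤ ‖h c‖ → ‖h c‖ ≤ 2 → ∀ z ∈ ball c (R / 2), ‖h z‖ ≤ M := by
  refine ⟨Real.exp (2 * π * Real.exp 98 ^ 2), by positivity, ?_⟩
  intro h c R hR hd h01 hlo hup
  have hcm : c ∈ ball c R := mem_ball_self hR
  have hI : (2 * π * Complex.I : ℂ) ≠ 0 := Complex.two_pi_I_ne_zero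
  have hnI : ‖(2 * π * Complex.I : ℂ)‖ = 2 * π := by simp [Real.pi_pos.le]
  obtain ⟨F₀, hF₀c, hF₀d, hF₀⟩ := exists_log_on_ball hR hd (fun z hz => (h01 z hz).1)
    (Complex.exp_log (h01 c hcm).1)
  set F : ℂ → ℂ := fun z => F₀ z / (2 * π * Complex.I) with hF
  have hFd : DifferentiableOn ℂ F (ball c R) := hF₀d.div_const _
  have hFF : ∀ z, F₀ z = 2 * π * Complex.I * F z := fun z => by rw [hF]; field_simp
  have hFint : ∀ z ∈ ball c R, ∀ m : ℤ, F z ≠ m := by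
    intro z hz m hm
    apply (h01 z hz).2
    rw [← hF₀ z hz, hFF, hm, Complex.exp_eq_one_iff]
    exact ⟨m, by ring⟩
  have hFc : ‖F c‖ ≤ 1 := by
    rw [hF]
    simp only
    rw [norm_div, hnI, hF₀c, div_le_one (by positivity)]
    exact norm_log_le hlo hup
  obtain ⟨u, hud, hu⟩ := exists_sqrt_on_ball hR hFd (fun z hz => by simpa using hFint z hz 0)
  obtain ⟨v, hvd, hv⟩ := exists_sqrt_on_ball hR (hFd.sub_const 1) (fun z hz => by
    have := hFint z hz 1
    intro h0
    apply this
    push_cast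
    linear_combination h0)
  have huv : ∀ z ∈ ball c R, (u z - v z) * (u z + v z) = 1 := by
    intro z hz
    linear_combination hu z hz - hv z hz
  have hne : ∀ z ∈ ball c R, u z - v z ≠ 0 := fun z hz => left_ne_zero_of_mul_eq_one (huv z hz)
  obtain ⟨G, hGc, hGd, hG⟩ := exists_log_on_ball hR (hud.sub hvd) hne
    (Complex.exp_log (hne c hcm))
  have hcosh : ∀ z ∈ ball c R, Complex.cosh (G z) = u z := by
    intro z hz
    have h1 : Complex.exp (-G z) = u z + v z := by
      rw [Complex.exp_neg, hG z hz]
      exact inv_eq_of_mul_eq_one_right (huv z hz)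
    have h2 : Complex.cosh (G z) = (Complex.exp (G z) + Complex.exp (-G z)) / 2 := rfl
    rw [h2, h1, hG z hz]
    simp only [Pi.sub_apply]
    ring
  have hcosh2 : ∀ z ∈ ball c R, Complex.cosh (G z) ^ 2 = F z := fun z hz => by
    rw [hcosh z hz, hu z hz]
  have hno := fun w => not_ball_subset_of_cosh_ne (S := ball c R) (G := G)
    (fun z hz m => by rw [hcosh2 z hz]; exact hFint z hz m) w
  have hG' : ∀ z ∈ ball c (R / 2), ‖deriv G z‖ ≤ 192 / R := by
    intro z hz
    have hsub : ball z (R / 2) ⊆ ball c R := by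
      apply ball_subset_ball'
      rw [mem_ball] at hz
      linarith
    have := norm_deriv_mul_le_of_not_ball_subset (half_pos hR) (hGd.mono hsub)
      (fun w hw => hno w (hw.trans (image_mono hsub)))
    rw [le_div_iff₀ hR]
    linarith
  have hhalf : ball c (R / 2) ⊆ ball c R := ball_subset_ball (by linarith)
  have huc : ‖u c‖ ≤ 1 := by
    have : ‖u c‖ ^ 2 ≤ 1 := by rw [← norm_pow, hu c hcm]; exact hFc
    nlinarith [norm_nonneg (u c)]
  have hvc : ‖v c‖ ≤ 2 := by
    have : ‖v c‖ ^ 2 ≤ 2 := by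
      rw [← norm_pow, hv c hcm]
      refine (norm_sub_le _ _).trans ?_
      rw [norm_one]; linarith
    nlinarith [norm_nonneg (v c)]
  have hexp3 : (3 : ℝ) ≤ Real.exp 2 := by have := Real.add_one_le_exp (2 : ℝ); linarith
  have hGre : |(G c).re| ≤ 2 := by
    rw [hGc, Complex.log_re]
    have h1 : ‖u c - v c‖ ≤ 3 := (norm_sub_le _ _).trans (by linarith)
    have h2 : ‖u c + v c‖ ≤ 3 := (norm_add_le _ _).trans (by linarith)
    have h3 : ‖u c - v c‖ * ‖u c + v c‖ = 1 := by rw [← norm_mul, huv c hcm, norm_one]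
    have hp : 0 < ‖u c - v c‖ := norm_pos_iff.mpr (hne c hcm)
    rw [abs_le]
    constructor
    · rw [Pi.sub_apply, Real.le_log_iff_exp_le hp, Real.exp_neg]
      have h4 : 1 ≤ ‖u c - v c‖ * Real.exp 2 := by nlinarith
      rw [inv_le_iff_one_le_mul₀ (Real.exp_pos 2)]
      exact h4
    · rw [Pi.sub_apply, Real.log_le_iff_le_exp hp]
      linarith
  intro z hz
  have hGz : |(G z).re| ≤ 98 := by
    have h1 := (convex_ball c (R / 2)).norm_image_sub_le_of_norm_hasDerivWithin_le (C := 192 / R)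
      (fun x hx => ((hGd.differentiableAt
        (isOpen_ball.mem_nhds (hhalf hx))).hasDerivAt).hasDerivWithinAt) hG'
      (mem_ball_self (half_pos hR)) hz
    have h2 : 192 / R * ‖z - c‖ ≤ 96 := by
      have : ‖z - c‖ ≤ R / 2 := by simpa [dist_eq_norm] using (mem_ball.mp hz).le
      calc _ ≤ 192 / R * (R / 2) := by gcongr
        _ = 96 := by field_simp; norm_num
    have h3 := Complex.abs_re_le_norm (G z - G c)
    rw [Complex.sub_re] at h3
    have h4 := abs_sub_abs_le_abs_sub (G z).re (G c).re
    linarith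
  have hzR := hhalf hz
  have hFz : ‖F z‖ ≤ Real.exp 98 ^ 2 := by
    rw [← hcosh2 z hzR, norm_pow]
    gcongr
    have h2 : Complex.cosh (G z) = (Complex.exp (G z) + Complex.exp (-G z)) / 2 := rfl
    rw [h2, norm_div]
    have h3 := norm_add_le (Complex.exp (G z)) (Complex.exp (-G z))
    rw [Complex.norm_exp, Complex.norm_exp, Complex.neg_re] at h3
    have h4 : Real.exp (G z).re ≤ Real.exp 98 := Real.exp_le_exp.mpr (abs_le.mp hGz).2
    have h5 : Real.exp (-(G z).re) ≤ Real.exp 98 :=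
      Real.exp_le_exp.mpr (by linarith [(abs_le.mp hGz).1])
    rw [Complex.norm_two]
    linarith
  rw [← hF₀ z hzR, Complex.norm_exp]
  apply Real.exp_le_exp.mpr
  refine (Complex.re_le_norm _).trans ?_
  rw [hFF, norm_mul, hnI]
  gcongr

/-- Schwarz-type Lipschitz estimate at the centre of a disc. -/
lemma norm_sub_center_le {h : ℂ → ℂ} {c : ℂ} {R M : ℝ} (hR : 0 < R)
    (hd : DifferentiableOn ℂ h (ball c R)) (hM : ∀ z ∈ ball c (R / 2), ‖h z‖ ≤ M) :
    ∀ z ∈ ball c (R / 2), ‖h z - h c‖ ≤ 4 * M * (‖z - c‖ / R) := by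
  intro z hz
  have hmaps : MapsTo h (ball c (R / 2)) (closedBall (h c) (2 * M)) := by
    intro w hw
    rw [mem_closedBall, dist_eq_norm]
    have := hM w hw
    have := hM c (mem_ball_self (half_pos hR))
    exact (norm_sub_le _ _).trans (by linarith)
  have := Complex.dist_le_div_mul_dist_of_mapsTo_ball (hd.mono (ball_subset_ball (by linarith)))
    hmaps hz
  rw [dist_eq_norm, dist_eq_norm] at this
  calc _ ≤ _ := this
    _ = _ := by field_simp; ring

/-- Normality of holomorphic functions omitting `0` and `1`, in the form of a uniform spherical
Lipschitz estimate. -/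
lemma exists_montel_bound : ∃ C : ℝ, 0 < C ∧ ∀ (h : ℂ → ℂ) (c : ℂ) (R : ℝ), 0 < R →
    DifferentiableOn ℂ h (ball c R) → (∀ z ∈ ball c R, h z ≠ 0 ∧ h z ≠ 1) →
    (∀ z ∈ ball c (R / 2), ‖h z - h c‖ ≤ C * (‖z - c‖ / R)) ∨
    (∀ z ∈ ball c (R / 2), ‖(h z)⁻¹ - (h c)⁻¹‖ ≤ C * (‖z - c‖ / R)) := by
  obtain ⟨M, hM0, hM⟩ := exists_schottky_bound
  have key : ∀ (h : ℂ → ℂ) (c : ℂ) (R : ℝ), 0 < R →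
      DifferentiableOn ℂ h (ball c R) → (∀ z ∈ ball c R, h z ≠ 0 ∧ h z ≠ 1) → ‖h c‖ ≤ 1 →
      ∀ z ∈ ball c (R / 2), ‖h z - h c‖ ≤ 4 * M * (‖z - c‖ / R) := by
    intro h c R hR hd h01 h1 z hz
    by_cases h2 : 1 / 2 ≤ ‖h c‖
    · exact norm_sub_center_le hR hd (hM h c R hR hd h01 h2 (by linarith)) z hz
    · push Not at h2
      have hd' : DifferentiableOn ℂ (fun z => 1 - h z) (ball c R) := hd.const_sub 1
      have h01' : ∀ z ∈ ball c R, 1 - h z ≠ 0 ∧ 1 - h z ≠ 1 := fun z hz =>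
        ⟨sub_ne_zero.mpr (h01 z hz).2.symm, by simpa using (h01 z hz).1⟩
      have h3 : 1 / 2 ≤ ‖1 - h c‖ := by
        have := norm_sub_norm_le 1 (h c)
        rw [norm_one] at this; linarith
      have h4 : ‖1 - h c‖ ≤ 2 := by
        have := norm_sub_le 1 (h c)
        rw [norm_one] at this; linarith
      have := norm_sub_center_le hR hd' (hM _ c R hR hd' h01' h3 h4) z hz
      rwa [sub_sub_sub_cancel_left, norm_sub_rev] at this
  refine ⟨4 * M, by positivity, fun h c R hR hd h01 => ?_⟩
  by_cases h1 : ‖h c‖ ≤ 1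
  · exact Or.inl (key h c R hR hd h01 h1)
  · push Not at h1
    refine Or.inr (key (fun z => (h z)⁻¹) c R hR (hd.inv fun z hz => (h01 z hz).1) ?_ ?_)
    · exact fun z hz => ⟨inv_ne_zero (h01 z hz).1, by simpa using (h01 z hz).2⟩
    · rw [norm_inv]; exact inv_le_one_of_one_le₀ h1.le

namespace RSphere

lemma ofC_injective : Function.Injective ofC := by
  intro a b h
  simpa [ofC] using h

lemma exists_ofC {x : RSphere} (hx : x ≠ infty) : ∃ z, x = ofC z := by
  rcases x with ⟨_ | z⟩
  · exact absurd rfl hx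
  · exact ⟨z, rfl⟩

@[simp] lemma ofC_ne_infty (z : ℂ) : ofC z ≠ infty := by simp [ofC, infty]

@[simp] lemma toC_ofC (z : ℂ) : toC (ofC z) = z := rfl

lemma ofC_toC {x : RSphere} (hx : x ≠ infty) : ofC (toC x) = x := by
  obtain ⟨z, rfl⟩ := exists_ofC hx
  rfl

lemma inv_infty : inv infty = ofC 0 := rfl

lemma inv_ofC_zero : inv (ofC 0) = infty := by simp [inv, ofC, elim, infty]

lemma inv_ofC {z : ℂ} (hz : z ≠ 0) : inv (ofC z) = ofC z⁻¹ := by simp [inv, ofC, elim, hz]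

lemma inv_inv (x : RSphere) : inv (inv x) = x := by
  by_cases hx : x = infty
  · rw [hx, inv_infty, inv_ofC_zero]
  · obtain ⟨z, rfl⟩ := exists_ofC hx
    by_cases hz : z = 0
    · rw [hz, inv_ofC_zero, inv_infty]
    · rw [inv_ofC hz, inv_ofC (inv_ne_zero hz), _root_.inv_inv]

lemma dist_eq (x y : RSphere) : dist x y = dist (embed x) (embed y) := rfl

/-- The horizontal part of the stereographic embedding. -/
noncomputable def hor (x : RSphere) : ℂ := (WithLp.equiv 2 (ℂ × ℝ) (embed x)).1

/-- The vertical part of the stereographic embedding. -/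
noncomputable def ver (x : RSphere) : ℝ := (WithLp.equiv 2 (ℂ × ℝ) (embed x)).2

lemma dist_sq (x y : RSphere) :
    dist x y ^ 2 = ‖hor x - hor y‖ ^ 2 + (ver x - ver y) ^ 2 := by
  rw [dist_eq, WithLp.prod_dist_eq_of_L2, Real.sq_sqrt (by positivity), dist_eq_norm,
    Real.dist_eq, sq_abs]
  rfl

lemma hor_ofC (z : ℂ) : hor (ofC z) = (2 / (‖z‖ ^ 2 + 1) : ℝ) • z := rfl

lemma ver_ofC (z : ℂ) : ver (ofC z) = (‖z‖ ^ 2 - 1) / (‖z‖ ^ 2 + 1) := rfl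

lemma hor_infty : hor infty = 0 := rfl

lemma ver_infty : ver infty = 1 := rfl

lemma dist_ofC (z w : ℂ) :
    dist (ofC z) (ofC w) = 2 * ‖z - w‖ / (√(1 + ‖z‖ ^ 2) * √(1 + ‖w‖ ^ 2)) := by
  have h1 : (0 : ℝ) < 1 + ‖z‖ ^ 2 := by positivity
  have h2 : (0 : ℝ) < 1 + ‖w‖ ^ 2 := by positivity
  rw [← Real.sqrt_mul h1.le]
  have h3 : 0 < √((1 + ‖z‖ ^ 2) * (1 + ‖w‖ ^ 2)) := Real.sqrt_pos.mpr (by positivity)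
  rw [← sq_eq_sq₀ dist_nonneg (by positivity), div_pow, Real.sq_sqrt (by positivity), dist_sq,
    hor_ofC, hor_ofC, ver_ofC, ver_ofC, mul_pow]
  have hz : ‖z‖ ^ 2 = z.re ^ 2 + z.im ^ 2 := by rw [Complex.sq_norm, Complex.normSq_apply]; ring
  have hw : ‖w‖ ^ 2 = w.re ^ 2 + w.im ^ 2 := by rw [Complex.sq_norm, Complex.normSq_apply]; ring
  rw [hz] at h1; rw [hw] at h2
  simp only [Complex.sq_norm, Complex.normSq_apply, Complex.sub_re, Complex.sub_im,
    Complex.smul_re, Complex.smul_im, smul_eq_mul]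
  have h1' : z.re * z.re + z.im * z.im + 1 ≠ 0 := by nlinarith
  have h2' : w.re * w.re + w.im * w.im + 1 ≠ 0 := by nlinarith
  have h1'' : 1 + (z.re * z.re + z.im * z.im) ≠ 0 := by nlinarith
  have h2'' : 1 + (w.re * w.re + w.im * w.im) ≠ 0 := by nlinarith
  field_simp
  ring

lemma hor_inv (x : RSphere) : hor (inv x) = (starRingEnd ℂ) (hor x) := by
  by_cases hx : x = infty
  · rw [hx, inv_infty, hor_ofC, hor_infty]; simp
  obtain ⟨z, rfl⟩ := exists_ofC hx
  by_cases hz : z = 0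
  · rw [hz, inv_ofC_zero, hor_ofC, hor_infty]; simp
  rw [inv_ofC hz, hor_ofC, hor_ofC, norm_inv]
  have hn : ‖z‖ ≠ 0 := norm_ne_zero_iff.mpr hz
  rw [Complex.inv_def, Complex.normSq_eq_norm_sq]
  rw [Complex.real_smul, Complex.real_smul, map_mul, Complex.conj_ofReal, mul_comm (starRingEnd ℂ z),
    ← mul_assoc, ← Complex.ofReal_mul]
  congr 2
  have : ‖z‖ ^ 2 + 1 ≠ 0 := by positivity
  field_simp
  ring

lemma ver_inv (x : RSphere) : ver (inv x) = - ver x := by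
  by_cases hx : x = infty
  · rw [hx, inv_infty, ver_ofC, ver_infty]; simp
  obtain ⟨z, rfl⟩ := exists_ofC hx
  by_cases hz : z = 0
  · rw [hz, inv_ofC_zero, ver_ofC, ver_infty]; simp
  rw [inv_ofC hz, ver_ofC, ver_ofC, norm_inv]
  have hn : ‖z‖ ≠ 0 := norm_ne_zero_iff.mpr hz
  have : ‖z‖ ^ 2 + 1 ≠ 0 := by positivity
  have : 1 + ‖z‖ ^ 2 ≠ 0 := by positivity
  field_simp
  ring

lemma dist_inv (x y : RSphere) : dist (inv x) (inv y) = dist x y := by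
  rw [← sq_eq_sq₀ dist_nonneg dist_nonneg, dist_sq, dist_sq, hor_inv, hor_inv, ver_inv, ver_inv,
    ← map_sub, RCLike.norm_conj]
  ring

lemma isometry_inv : Isometry inv := Isometry.of_dist_eq dist_inv

lemma continuous_inv : Continuous inv := isometry_inv.continuous

lemma dist_ofC_le (z w : ℂ) : dist (ofC z) (ofC w) ≤ 2 * ‖z - w‖ := by
  rw [dist_ofC]
  apply div_le_self (by positivity)
  have h1 : 1 ≤ √(1 + ‖z‖ ^ 2) := Real.one_le_sqrt.mpr (by nlinarith [norm_nonneg z])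
  have h2 : 1 ≤ √(1 + ‖w‖ ^ 2) := Real.one_le_sqrt.mpr (by nlinarith [norm_nonneg w])
  nlinarith

lemma continuous_ofC : Continuous ofC := by
  refine (LipschitzWith.of_dist_le_mul (K := 2) fun z w => ?_).continuous
  rw [dist_eq_norm z w]
  exact dist_ofC_le z w

lemma continuous_hor : Continuous hor := by
  have : Continuous embed := continuous_induced_dom
  exact ((WithLp.prod_continuous_ofLp 2 ℂ ℝ).comp this).fst

lemma continuous_ver : Continuous ver := by
  have : Continuous embed := continuous_induced_dom
  exact ((WithLp.prod_continuous_ofLp 2 ℂ ℝ).comp this).snd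

lemma toC_eq (x : RSphere) : toC x = ((1 - ver x)⁻¹ : ℝ) • hor x := by
  by_cases hx : x = infty
  · rw [hx, hor_infty]; simp [toC, infty, elim]
  · obtain ⟨z, rfl⟩ := exists_ofC hx
    rw [hor_ofC, ver_ofC, toC_ofC, smul_smul]
    have : ‖z‖ ^ 2 + 1 ≠ 0 := by positivity
    have h : (1 - (‖z‖ ^ 2 - 1) / (‖z‖ ^ 2 + 1))⁻¹ * (2 / (‖z‖ ^ 2 + 1)) = 1 := by
      have : 1 - (‖z‖ ^ 2 - 1) / (‖z‖ ^ 2 + 1) = 2 / (‖z‖ ^ 2 + 1) := by field_simp; ring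
      rw [this]; field_simp
    rw [h, one_smul]

lemma continuousAt_toC {x : RSphere} (hx : x ≠ infty) : ContinuousAt toC x := by
  have h1 : 1 - ver x ≠ 0 := by
    obtain ⟨z, rfl⟩ := exists_ofC hx
    rw [ver_ofC]
    have : ‖z‖ ^ 2 + 1 ≠ 0 := by positivity
    have h2 : 1 - (‖z‖ ^ 2 - 1) / (‖z‖ ^ 2 + 1) = 2 / (‖z‖ ^ 2 + 1) := by field_simp; ring
    rw [h2]; positivity
  have h2 : ContinuousAt (fun x => ((1 - ver x)⁻¹ : ℝ) • hor x) x :=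
    ((continuousAt_const.sub continuous_ver.continuousAt).inv₀ h1).smul continuous_hor.continuousAt
  exact h2.congr (Eventually.of_forall fun y => (toC_eq y).symm)

lemma eventually_ne_infty {x : RSphere} (hx : x ≠ infty) : ∀ᶠ y in 𝓝 x, y ≠ infty :=
  isOpen_ne.mem_nhds hx

lemma map_ofC_nhds (z : ℂ) : map ofC (𝓝 z) = 𝓝 (ofC z) := by
  apply le_antisymm continuous_ofC.continuousAt
  intro s hs
  have h1 : ∀ᶠ y in 𝓝 (ofC z), toC y ∈ ofC ⁻¹' s := by
    have := continuousAt_toC (ofC_ne_infty z)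
    exact this hs
  filter_upwards [h1, eventually_ne_infty (ofC_ne_infty z)] with y hy hy2
  rwa [mem_preimage, ofC_toC hy2] at hy

/-- The two standard charts: the identity and the inversion. -/
def IsChart (A : RSphere → RSphere) : Prop := A = id ∨ A = inv

lemma IsChart.dist_eq {A : RSphere → RSphere} (h : IsChart A) (x y : RSphere) :
    dist (A x) (A y) = dist x y := by
  rcases h with rfl | rfl
  · rfl
  · exact dist_inv x y

lemma IsChart.invol {A : RSphere → RSphere} (h : IsChart A) (x : RSphere) : A (A x) = x := by
  rcases h with rfl | rfl
  · rfl
  · exact inv_inv x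

lemma IsChart.continuous {A : RSphere → RSphere} (h : IsChart A) : Continuous A :=
  (Isometry.of_dist_eq h.dist_eq).continuous

lemma exists_isChart (x : RSphere) : ∃ A, IsChart A ∧ A x ≠ infty := by
  by_cases hx : x = infty
  · exact ⟨inv, Or.inr rfl, by rw [hx, inv_infty]; exact ofC_ne_infty 0⟩
  · exact ⟨id, Or.inl rfl, hx⟩

lemma exists_chart_eq (x : RSphere) : ∃ A, IsChart A ∧ ∃ z, x = A (ofC z) := by
  obtain ⟨A, hA, hx⟩ := exists_isChart x
  obtain ⟨z, hz⟩ := exists_ofC hx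
  exact ⟨A, hA, z, by rw [← hz, hA.invol]⟩

lemma IsChart.map_nhds {A : RSphere → RSphere} (h : IsChart A) (z : ℂ) :
    map (fun w => A (ofC w)) (𝓝 z) = 𝓝 (A (ofC z)) := by
  have h1 : map A (𝓝 (ofC z)) = 𝓝 (A (ofC z)) :=
    (Homeomorph.mk ⟨A, A, h.invol, h.invol⟩ h.continuous h.continuous).map_nhds_eq (ofC z)
  rw [← h1, ← map_ofC_nhds, Filter.map_map]
  rfl

lemma nhdsNE_neBot (x : RSphere) : (𝓝[≠] x).NeBot := by
  obtain ⟨A, hA, z, rfl⟩ := exists_chart_eq x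
  rw [nhdsWithin_neBot]
  intro t ht
  rw [← hA.map_nhds] at ht
  have h1 : (𝓝[≠] z).NeBot := inferInstance
  obtain ⟨w, hw, hwz⟩ := (nhdsWithin_neBot.mp h1) ht
  exact ⟨A (ofC w), hw, fun h => hwz (ofC_injective ((hA.invol (ofC w)).symm.trans
    ((congrArg A h).trans (hA.invol _))))⟩

instance : CompactSpace RSphere := by
  constructor
  have h1 : IsCompact (ofC '' closedBall 0 1) :=
    (isCompact_closedBall (0 : ℂ) 1).image continuous_ofC
  have h2 := h1.union (h1.image continuous_inv)
  convert h2
  symm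
  rw [eq_univ_iff_forall]
  intro x
  by_cases hx : x = infty
  · right
    exact ⟨ofC 0, ⟨0, by simp, rfl⟩, by rw [hx, inv_ofC_zero]⟩
  · obtain ⟨z, rfl⟩ := exists_ofC hx
    by_cases hz : ‖z‖ ≤ 1
    · left; exact ⟨z, by simpa using hz, rfl⟩
    · right
      push Not at hz
      have h0 : z ≠ 0 := by rintro rfl; simp at hz; linarith
      refine ⟨ofC z⁻¹, ⟨z⁻¹, ?_, rfl⟩, ?_⟩
      · simpa using inv_le_one_of_one_le₀ hz.le
      · rw [inv_ofC (inv_ne_zero h0), _root_.inv_inv]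

end RSphere

open RSphere in
/-- Strict conformality of `g` at `x` with dilatation `l`. -/
def SCAt (g : RSphere → RSphere) (x : RSphere) (l : ℝ) : Prop :=
  ∀ e > 0, ∀ᶠ p : RSphere × RSphere in 𝓝 (x, x),
    |dist (g p.1) (g p.2) - l * dist p.1 p.2| ≤ e * dist p.1 p.2

lemma SCAt.tendsto {g : RSphere → RSphere} {x : RSphere} {l : ℝ} (h : SCAt g x l) :
    Tendsto (fun y => dist (g y) (g x) / dist y x) (𝓝[≠] x) (𝓝 l) := by
  rw [Metric.tendsto_nhds]
  intro e he
  have h1 : Tendsto (fun y : RSphere => (y, x)) (𝓝[≠] x) (𝓝 (x, x)) :=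
    (Continuous.prodMk_left x).continuousAt.tendsto.mono_left nhdsWithin_le_nhds
  filter_upwards [h1.eventually (h (e / 2) (half_pos he)), self_mem_nhdsWithin] with y hy hyx
  have hd : 0 < dist y x := dist_pos.mpr hyx
  rw [Real.dist_eq]
  have : dist (g y) (g x) / dist y x - l = (dist (g y) (g x) - l * dist y x) / dist y x := by
    field_simp
  rw [this, abs_div, abs_of_pos hd, div_lt_iff₀ hd]
  nlinarith

lemma SCAt.sphDeriv_eq {g : RSphere → RSphere} {x : RSphere} {l : ℝ} (h : SCAt g x l) :
    sphDeriv g x = l := by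
  have := RSphere.nhdsNE_neBot x
  exact h.tendsto.limsup_eq

lemma SCAt.nonneg {g : RSphere → RSphere} {x : RSphere} {l : ℝ} (h : SCAt g x l) : 0 ≤ l := by
  have := RSphere.nhdsNE_neBot x
  exact ge_of_tendsto' h.tendsto fun y => by positivity

lemma SCAt.comp {g h : RSphere → RSphere} {x : RSphere} {l m : ℝ} (hg : SCAt g (h x) l)
    (hh : SCAt h x m) (hc : ContinuousAt h x) : SCAt (g ∘ h) x (l * m) := by
  intro e he
  have hl := hg.nonneg
  have hm := hh.nonneg
  have hcc : Tendsto (fun p : RSphere × RSphere => (h p.1, h p.2)) (𝓝 (x, x))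
      (𝓝 (h x, h x)) := by
    rw [nhds_prod_eq, nhds_prod_eq]
    exact Tendsto.prodMap hc hc
  have he1 : 0 < e / (2 * (m + 1)) := by positivity
  have he2 : 0 < min 1 (e / (2 * (l + 1))) := by positivity
  filter_upwards [hcc.eventually (hg _ he1), hh _ he2] with p h1 h2
  simp only [Function.comp] at h1 ⊢
  have hd : 0 ≤ dist p.1 p.2 := dist_nonneg
  set d := dist p.1 p.2
  set D := dist (h p.1) (h p.2)
  have h3 : D ≤ (m + 1) * d := by
    have := (abs_le.mp h2).2
    have h4 : min 1 (e / (2 * (l + 1))) * d ≤ 1 * d := by gcongr; exact min_le_left _ _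
    linarith
  have h5 : e / (2 * (m + 1)) * D ≤ e / 2 * d := by
    calc _ ≤ e / (2 * (m + 1)) * ((m + 1) * d) := by gcongr
      _ = _ := by field_simp
  have h6 : |l * (D - m * d)| ≤ e / 2 * d := by
    rw [abs_mul, abs_of_nonneg hl]
    calc _ ≤ l * (min 1 (e / (2 * (l + 1))) * d) := by gcongr
      _ ≤ (l + 1) * (e / (2 * (l + 1)) * d) := by
        gcongr
        · linarith
        · exact min_le_right _ _
      _ = _ := by field_simp
  have h7 : dist (g (h p.1)) (g (h p.2)) - l * m * d =
      (dist (g (h p.1)) (g (h p.2)) - l * D) + l * (D - m * d) := by ring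
  rw [h7]
  refine (abs_add_le _ _).trans ?_
  linarith

lemma SCAt.of_isometry {g : RSphere → RSphere} (h : ∀ x y, dist (g x) (g y) = dist x y)
    (x : RSphere) : SCAt g x 1 := by
  intro e he
  filter_upwards with p
  rw [h, one_mul, sub_self, abs_zero]
  positivity

lemma continuous_of_SCAt {g : RSphere → RSphere} {l : RSphere → ℝ} (h : ∀ x, SCAt g x (l x)) :
    Continuous l := by
  rw [continuous_iff_continuousAt]
  intro x
  rw [ContinuousAt, Metric.tendsto_nhds]
  intro e he
  have h1 := eventually_eventually_nhds.mpr (h x (e / 2) (half_pos he))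
  have h2 : Tendsto (fun y : RSphere => (y, y)) (𝓝 x) (𝓝 (x, x)) :=
    (continuous_id.prodMk continuous_id).continuousAt
  filter_upwards [h2.eventually h1] with y hy
  have hnb := RSphere.nhdsNE_neBot y
  have h3 : Tendsto (fun z : RSphere => (z, y)) (𝓝[≠] y) (𝓝 (y, y)) :=
    (Continuous.prodMk_left y).continuousAt.tendsto.mono_left nhdsWithin_le_nhds
  have h4 : Tendsto (fun z => |dist (g z) (g y) / dist z y - l x|) (𝓝[≠] y) (𝓝 |l y - l x|) :=
    ((h y).tendsto.sub_const _).abs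
  rw [Real.dist_eq]
  refine (le_of_tendsto h4 ?_).trans_lt (half_lt_self he)
  filter_upwards [h3.eventually hy, self_mem_nhdsWithin] with z hz hzy
  have hd : 0 < dist z y := dist_pos.mpr hzy
  have h5 : dist (g z) (g y) / dist z y - l x = (dist (g z) (g y) - l x * dist z y) / dist z y := by
    field_simp
  rw [h5, abs_div, abs_of_pos hd, div_le_iff₀ hd]
  exact hz

namespace RSphere

/-- Holomorphic self-maps of the Riemann sphere. -/
def Hol (g : RSphere → RSphere) : Prop :=
  Continuous g ∧ ∀ A B, IsChart A → IsChart B → ∀ z, B (g (A (ofC z))) ≠ infty →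
    DifferentiableAt ℂ (fun w => toC (B (g (A (ofC w))))) z

lemma Hol.continuous {g : RSphere → RSphere} (h : Hol g) : Continuous g := h.1

lemma Hol.id : Hol id := by
  refine ⟨continuous_id, ?_⟩
  have key : ∀ z, DifferentiableAt ℂ (fun w => toC (ofC w)) z := fun z => differentiableAt_id
  have key2 : ∀ z, inv (ofC z) ≠ infty → DifferentiableAt ℂ (fun w => toC (inv (ofC w))) z := by
    intro z hz
    have hz0 : z ≠ 0 := by rintro rfl; exact hz inv_ofC_zero
    refine (differentiableAt_inv hz0).congr_of_eventuallyEq ?_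
    filter_upwards [isOpen_ne.mem_nhds hz0] with w hw
    rw [inv_ofC hw, toC_ofC]
  rintro A B (rfl | rfl) (rfl | rfl) z hz
  · exact key z
  · exact key2 z hz
  · exact key2 z hz
  · simp only [_root_.id, inv_inv]; exact key z

lemma Hol.comp {g h : RSphere → RSphere} (hg : Hol g) (hh : Hol h) : Hol (g ∘ h) := by
  refine ⟨hg.1.comp hh.1, fun A B hA hB z hz => ?_⟩
  obtain ⟨C, hC, hx⟩ := exists_isChart (h (A (ofC z)))
  have h1 := hh.2 A C hA hC z hx
  have h2 : ∀ᶠ w in 𝓝 z, C (h (A (ofC w))) ≠ infty := by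
    have : Continuous fun w => C (h (A (ofC w))) :=
      hC.continuous.comp (hh.1.comp (hA.continuous.comp continuous_ofC))
    exact this.continuousAt.eventually (eventually_ne_infty hx)
  have h3 : ∀ w, C (h (A (ofC w))) ≠ infty →
      h (A (ofC w)) = C (ofC (toC (C (h (A (ofC w)))))) := by
    intro w hw
    rw [ofC_toC hw, hC.invol]
  have h4 := hg.2 C B hC hB (toC (C (h (A (ofC z))))) (by rw [← h3 z hx]; exact hz)
  refine (DifferentiableAt.comp z h4 h1).congr_of_eventuallyEq ?_
  filter_upwards [h2] with w hw
  simp only [Function.comp]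
  rw [← h3 w hw]

lemma Hol.iterate {g : RSphere → RSphere} (hg : Hol g) (n : ℕ) : Hol g^[n] := by
  induction n with
  | zero => exact Hol.id
  | succ n ih => rw [Function.iterate_succ']; exact hg.comp ih

lemma SCAt_ofC {φ : ℂ → ℂ} {a d : ℂ} (h : HasStrictDerivAt φ d a) :
    ∃ l : ℝ, (l = 0 ↔ d = 0) ∧ ∀ e > 0, ∀ᶠ p : ℂ × ℂ in 𝓝 (a, a),
      |dist (ofC (φ p.1)) (ofC (φ p.2)) - l * dist (ofC p.1) (ofC p.2)| ≤
        e * dist (ofC p.1) (ofC p.2) := by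
  have hpos : ∀ z : ℂ, 0 < √(1 + ‖z‖ ^ 2) := fun z => Real.sqrt_pos.mpr (by positivity)
  set k : ℂ × ℂ → ℝ := fun p => (√(1 + ‖p.1‖ ^ 2) * √(1 + ‖p.2‖ ^ 2)) /
    (√(1 + ‖φ p.1‖ ^ 2) * √(1 + ‖φ p.2‖ ^ 2)) with hk
  have hφ : ContinuousAt φ a := h.hasDerivAt.continuousAt
  have hkpos : ∀ p, 0 < k p := fun p =>
    div_pos (mul_pos (hpos _) (hpos _)) (mul_pos (hpos _) (hpos _))
  have hkc : ContinuousAt k (a, a) := by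
    have h1 : ContinuousAt (fun p : ℂ × ℂ => φ p.1) (a, a) :=
      ContinuousAt.comp (g := φ) (x := (a, a)) hφ continuousAt_fst
    have h2 : ContinuousAt (fun p : ℂ × ℂ => φ p.2) (a, a) :=
      ContinuousAt.comp (g := φ) (x := (a, a)) hφ continuousAt_snd
    have h3 : ContinuousAt (fun p : ℂ × ℂ => √(1 + ‖p.1‖ ^ 2)) (a, a) := by fun_prop
    have h4 : ContinuousAt (fun p : ℂ × ℂ => √(1 + ‖p.2‖ ^ 2)) (a, a) := by fun_prop
    have h5 : ContinuousAt (fun p : ℂ × ℂ => √(1 + ‖φ p.1‖ ^ 2)) (a, a) :=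
      ((continuousAt_const.add (h1.norm.pow 2))).sqrt
    have h6 : ContinuousAt (fun p : ℂ × ℂ => √(1 + ‖φ p.2‖ ^ 2)) (a, a) :=
      ((continuousAt_const.add (h2.norm.pow 2))).sqrt
    exact (h3.mul h4).div (h5.mul h6) (mul_pos (hpos _) (hpos _)).ne'
  refine ⟨‖d‖ * k (a, a), ?_, ?_⟩
  · rw [mul_eq_zero, norm_eq_zero]
    exact ⟨fun h => h.resolve_right (hkpos _).ne', Or.inl⟩
  intro e he
  have hk0 := hkpos (a, a)
  have he1 : 0 < e / (2 * (k (a, a) + 1)) := by positivity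
  have he2 : 0 < min 1 (e / (2 * (‖d‖ + 1))) := by positivity
  have hs := (HasFDerivAtFilter.isLittleO h).def he1
  filter_upwards [hs, (Metric.continuousAt_iff'.mp hkc) _ he2] with p h1 h2
  rw [Real.dist_eq] at h2
  set t := ‖p.1 - p.2‖ with ht
  have h3 : dist (ofC (φ p.1)) (ofC (φ p.2)) = ‖φ p.1 - φ p.2‖ * k p *
      (2 / (√(1 + ‖p.1‖ ^ 2) * √(1 + ‖p.2‖ ^ 2))) := by
    rw [dist_ofC, hk]
    have := (hpos p.1).ne'; have := (hpos p.2).ne'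
    have := (hpos (φ p.1)).ne'; have := (hpos (φ p.2)).ne'
    field_simp
  have h4 : dist (ofC p.1) (ofC p.2) = t * (2 / (√(1 + ‖p.1‖ ^ 2) * √(1 + ‖p.2‖ ^ 2))) := by
    rw [dist_ofC, ht]; ring
  rw [h3, h4]
  have hw : 0 < 2 / (√(1 + ‖p.1‖ ^ 2) * √(1 + ‖p.2‖ ^ 2)) :=
    div_pos two_pos (mul_pos (hpos _) (hpos _))
  set w := 2 / (√(1 + ‖p.1‖ ^ 2) * √(1 + ‖p.2‖ ^ 2))
  have ht0 : 0 ≤ t := norm_nonneg _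
  have h5 : |‖φ p.1 - φ p.2‖ - ‖d‖ * t| ≤ e / (2 * (k (a, a) + 1)) * t := by
    have h6 := abs_norm_sub_norm_le (φ p.1 - φ p.2) ((p.1 - p.2) • d)
    rw [norm_smul, ← ht, mul_comm t] at h6
    exact h6.trans h1
  have h7 : |‖φ p.1 - φ p.2‖ * k p - ‖d‖ * k (a, a) * t| ≤ e * t := by
    have h8 : ‖φ p.1 - φ p.2‖ * k p - ‖d‖ * k (a, a) * t =
        (‖φ p.1 - φ p.2‖ - ‖d‖ * t) * k p + ‖d‖ * t * (k p - k (a, a)) := by ring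
    rw [h8]
    refine (abs_add_le _ _).trans ?_
    rw [abs_mul, abs_mul, abs_of_pos (hkpos p), abs_of_nonneg (by positivity : 0 ≤ ‖d‖ * t)]
    have h9 : k p ≤ k (a, a) + 1 := by
      have := (abs_lt.mp h2).2
      have := min_le_left 1 (e / (2 * (‖d‖ + 1)))
      linarith
    have h10 : |‖φ p.1 - φ p.2‖ - ‖d‖ * t| * k p ≤ e / 2 * t := by
      calc _ ≤ (e / (2 * (k (a, a) + 1)) * t) * (k (a, a) + 1) := by gcongr
        _ = _ := by field_simp
    have h11 : ‖d‖ * t * |k p - k (a, a)| ≤ e / 2 * t := by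
      calc _ ≤ (‖d‖ + 1) * t * (e / (2 * (‖d‖ + 1))) := by
            gcongr
            · linarith
            · exact h2.le.trans (min_le_right _ _)
        _ = _ := by field_simp
    linarith
  have h12 : ‖φ p.1 - φ p.2‖ * k p * w - ‖d‖ * k (a, a) * (t * w) =
      (‖φ p.1 - φ p.2‖ * k p - ‖d‖ * k (a, a) * t) * w := by ring
  rw [h12, abs_mul, abs_of_pos hw]
  calc _ ≤ e * t * w := by gcongr
    _ = _ := by ring

/-- Chart data of a holomorphic map at a point. -/
lemma Hol.exists_chart {g : RSphere → RSphere} (hg : Hol g) {A B : RSphere → RSphere}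
    (hA : IsChart A) (hB : IsChart B) {a : ℂ} (hBa : B (g (A (ofC a))) ≠ infty) :
    HasStrictDerivAt (fun w => toC (B (g (A (ofC w)))))
      (deriv (fun w => toC (B (g (A (ofC w))))) a) a ∧
    ∀ᶠ w in 𝓝 a, g (A (ofC w)) = B (ofC (toC (B (g (A (ofC w)))))) := by
  have h2 : ∀ᶠ w in 𝓝 a, B (g (A (ofC w))) ≠ infty := by
    have : Continuous fun w => B (g (A (ofC w))) :=
      hB.continuous.comp (hg.1.comp (hA.continuous.comp continuous_ofC))
    exact this.continuousAt.eventually (eventually_ne_infty hBa)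
  have h3 : AnalyticAt ℂ (fun w => toC (B (g (A (ofC w))))) a := by
    rw [Complex.analyticAt_iff_eventually_differentiableAt]
    filter_upwards [h2] with w hw using hg.2 A B hA hB w hw
  refine ⟨h3.hasStrictDerivAt, ?_⟩
  filter_upwards [h2] with w hw
  rw [ofC_toC hw, hB.invol]

lemma Hol.SCAt_chart {g : RSphere → RSphere} (hg : Hol g) {A B : RSphere → RSphere}
    (hA : IsChart A) (hB : IsChart B) {a : ℂ} (hBa : B (g (A (ofC a))) ≠ infty) :
    ∃ l, SCAt g (A (ofC a)) l ∧
      (l = 0 ↔ deriv (fun w => toC (B (g (A (ofC w))))) a = 0) := by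
  obtain ⟨h1, h2⟩ := hg.exists_chart hA hB hBa
  obtain ⟨l, hl, h3⟩ := SCAt_ofC h1
  refine ⟨l, fun e he => ?_, hl⟩
  rw [nhds_prod_eq, ← hA.map_nhds, Filter.prod_map_map_eq, eventually_map, ← nhds_prod_eq]
  have h4 := h2.prod_mk h2
  rw [← nhds_prod_eq] at h4
  filter_upwards [h3 e he, h4] with p h5 h6
  rw [h6.1, h6.2, hB.dist_eq, hA.dist_eq]
  exact h5

lemma Hol.SCAt {g : RSphere → RSphere} (hg : Hol g) (x : RSphere) :
    SCAt g x (sphDeriv g x) := by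
  obtain ⟨A, hA, a, rfl⟩ := exists_chart_eq x
  obtain ⟨B, hB, hBa⟩ := exists_isChart (g (A (ofC a)))
  obtain ⟨l, h, -⟩ := hg.SCAt_chart hA hB hBa
  rwa [h.sphDeriv_eq]

lemma Hol.sphDeriv_eq_zero_iff {g : RSphere → RSphere} (hg : Hol g) {A B : RSphere → RSphere}
    (hA : IsChart A) (hB : IsChart B) {a : ℂ} (hBa : B (g (A (ofC a))) ≠ infty) :
    sphDeriv g (A (ofC a)) = 0 ↔ deriv (fun w => toC (B (g (A (ofC w))))) a = 0 := by
  obtain ⟨l, h, h2⟩ := hg.SCAt_chart hA hB hBa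
  rw [h.sphDeriv_eq, h2]

lemma Hol.nhds_le_map {g : RSphere → RSphere} (hg : Hol g) {x : RSphere}
    (hx : sphDeriv g x ≠ 0) : 𝓝 (g x) ≤ map g (𝓝 x) := by
  obtain ⟨A, hA, a, rfl⟩ := exists_chart_eq x
  obtain ⟨B, hB, hBa⟩ := exists_isChart (g (A (ofC a)))
  obtain ⟨h1, h2⟩ := hg.exists_chart hA hB hBa
  rw [Ne, hg.sphDeriv_eq_zero_iff hA hB hBa] at hx
  have h3 := h1.map_nhds_eq hx
  have h4 : map (fun w => g (A (ofC w))) (𝓝 a) = 𝓝 (g (A (ofC a))) := by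
    rw [Filter.map_congr h2, h2.self_of_nhds, ← hB.map_nhds, ← h3, Filter.map_map]
    rfl
  rw [← h4, ← hA.map_nhds, Filter.map_map]
  rfl

lemma Hol.sphDeriv_comp {g h : RSphere → RSphere} (hg : Hol g) (hh : Hol h) (x : RSphere) :
    sphDeriv (g ∘ h) x = sphDeriv g (h x) * sphDeriv h x :=
  ((hg.SCAt (h x)).comp (hh.SCAt x) hh.1.continuousAt).sphDeriv_eq

lemma Hol.continuous_sphDeriv {g : RSphere → RSphere} (hg : Hol g) : Continuous (sphDeriv g) :=
  continuous_of_SCAt hg.SCAt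

lemma Hol.sphDeriv_nonneg {g : RSphere → RSphere} (hg : Hol g) (x : RSphere) : 0 ≤ sphDeriv g x :=
  (hg.SCAt x).nonneg

end RSphere

namespace RSphere

open Polynomial

/-- The point of the sphere with homogeneous coordinates `[a : b]`. -/
noncomputable def ratPt (a b : ℂ) : RSphere := if b = 0 then infty else ofC (a / b)

lemma ratPt_zero_right (a : ℂ) : ratPt a 0 = infty := if_pos rfl

lemma ratPt_of_ne {a b : ℂ} (hb : b ≠ 0) : ratPt a b = ofC (a / b) := if_neg hb

lemma ratPt_eq_infty_iff {a b : ℂ} : ratPt a b = infty ↔ b = 0 := by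
  by_cases hb : b = 0
  · simp [ratPt, hb]
  · simp [ratPt, hb]

lemma ratPt_mul {t : ℂ} (ht : t ≠ 0) (a b : ℂ) : ratPt (t * a) (t * b) = ratPt a b := by
  by_cases hb : b = 0
  · simp [hb, ratPt_zero_right]
  · rw [ratPt_of_ne hb, ratPt_of_ne (mul_ne_zero ht hb), mul_div_mul_left _ _ ht]

lemma inv_ratPt {a b : ℂ} (h : a ≠ 0 ∨ b ≠ 0) : inv (ratPt a b) = ratPt b a := by
  by_cases hb : b = 0
  · have ha : a ≠ 0 := h.resolve_right (not_not.mpr hb)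
    rw [hb, ratPt_zero_right, inv_infty, ratPt_of_ne ha, zero_div]
  · rw [ratPt_of_ne hb]
    by_cases ha : a = 0
    · rw [ha, zero_div, inv_ofC_zero, ratPt_zero_right]
    · rw [inv_ofC (div_ne_zero ha hb), ratPt_of_ne ha, inv_div]

lemma exists_ratPt (x : RSphere) : ∃ a b : ℂ, (a ≠ 0 ∨ b ≠ 0) ∧ x = ratPt a b := by
  by_cases hx : x = infty
  · exact ⟨1, 0, Or.inl one_ne_zero, by rw [hx, ratPt_zero_right]⟩
  · obtain ⟨z, rfl⟩ := exists_ofC hx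
    exact ⟨z, 1, Or.inr one_ne_zero, by rw [ratPt_of_ne one_ne_zero, div_one]⟩

lemma continuous_ratPt {P Q : ℂ[X]} (h : ∀ z, P.eval z ≠ 0 ∨ Q.eval z ≠ 0) :
    Continuous fun z => ratPt (P.eval z) (Q.eval z) := by
  have key : ∀ (P Q : ℂ[X]) (z : ℂ), Q.eval z ≠ 0 →
      ContinuousAt (fun z => ratPt (P.eval z) (Q.eval z)) z := by
    intro P Q z hz
    have h1 : ContinuousAt (fun z => ofC (P.eval z / Q.eval z)) z :=
      continuous_ofC.continuousAt.comp (P.continuous.continuousAt.div Q.continuous.continuousAt hz)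
    refine h1.congr ?_
    filter_upwards [Q.continuous.continuousAt.eventually_ne hz] with w hw
    rw [ratPt_of_ne hw]
  rw [continuous_iff_continuousAt]
  intro z
  by_cases hz : Q.eval z = 0
  · have hP := (h z).resolve_right (not_not.mpr hz)
    have := continuous_inv.continuousAt.comp (key Q P z hP)
    refine this.congr (Eventually.of_forall fun w => ?_)
    simp only [Function.comp]
    rw [inv_ratPt (h w).symm]
  · exact key P Q z hz

/-- `g` is given in the affine chart by the quotient `P / Q` of polynomials without common
zeros. -/
def RatRep (g : RSphere → RSphere) (P Q : ℂ[X]) : Prop :=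
  ∀ z, (P.eval z ≠ 0 ∨ Q.eval z ≠ 0) ∧ g (ofC z) = ratPt (P.eval z) (Q.eval z)

lemma RatRep.inv {g : RSphere → RSphere} {P Q : ℂ[X]} (h : RatRep g P Q) :
    RatRep (fun x => inv (g x)) Q P := fun z =>
  ⟨(h z).1.symm, by simp only [(h z).2, inv_ratPt (h z).1]⟩

lemma RatRep.eventuallyEq {g : RSphere → RSphere} {P Q : ℂ[X]} (h : RatRep g P Q) {z : ℂ}
    (hz : g (ofC z) ≠ infty) :
    Q.eval z ≠ 0 ∧ (fun w => toC (g (ofC w))) =ᶠ[𝓝 z] fun w => P.eval w / Q.eval w := by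
  rw [(h z).2, Ne, ratPt_eq_infty_iff] at hz
  refine ⟨hz, ?_⟩
  filter_upwards [Q.continuous.continuousAt.eventually_ne hz] with w hw
  rw [(h w).2, ratPt_of_ne hw, toC_ofC]

lemma RatRep.differentiableAt {g : RSphere → RSphere} {P Q : ℂ[X]} (h : RatRep g P Q) {z : ℂ}
    (hz : g (ofC z) ≠ infty) : DifferentiableAt ℂ (fun w => toC (g (ofC w))) z := by
  obtain ⟨h1, h2⟩ := h.eventuallyEq hz
  exact (P.differentiableAt.div Q.differentiableAt h1).congr_of_eventuallyEq h2

lemma RatRep.continuous {g : RSphere → RSphere} {P Q : ℂ[X]} (h : RatRep g P Q) :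
    Continuous fun z => g (ofC z) := by
  simp_rw [fun z => (h z).2]
  exact continuous_ratPt fun z => (h z).1

lemma continuous_of_charts {g : RSphere → RSphere} (h1 : Continuous fun z => g (ofC z))
    (h2 : Continuous fun z => g (RSphere.inv (ofC z))) : Continuous g := by
  rw [continuous_iff_continuousAt]
  intro x
  obtain ⟨A, hA, a, rfl⟩ := exists_chart_eq x
  rw [ContinuousAt, ← hA.map_nhds, tendsto_map'_iff]
  rcases hA with rfl | rfl
  · exact h1.continuousAt
  · exact h2.continuousAt

lemma RatRep.hol {g : RSphere → RSphere} {P Q P' Q' : ℂ[X]} (h : RatRep g P Q)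
    (h' : RatRep (fun x => g (RSphere.inv x)) P' Q') : Hol g := by
  refine ⟨continuous_of_charts h.continuous h'.continuous, ?_⟩
  rintro A B (rfl | rfl) (rfl | rfl) z hz
  · exact h.differentiableAt hz
  · exact h.inv.differentiableAt hz
  · exact h'.differentiableAt hz
  · exact h'.inv.differentiableAt hz

/-- The Möbius transformation with the given coefficients. -/
noncomputable def mob (a b c d : ℂ) (x : RSphere) : RSphere :=
  elim x (ratPt a c) fun z => ratPt (a * z + b) (c * z + d)

lemma mob_ratPt (a b c d : ℂ) {u v : ℂ} (h : u ≠ 0 ∨ v ≠ 0) :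
    mob a b c d (ratPt u v) = ratPt (a * u + b * v) (c * u + d * v) := by
  by_cases hv : v = 0
  · have hu : u ≠ 0 := h.resolve_right (not_not.mpr hv)
    rw [hv, ratPt_zero_right, mul_zero, mul_zero, add_zero, add_zero, mul_comm a, mul_comm c,
      ratPt_mul hu]
    rfl
  · rw [ratPt_of_ne hv, ← ratPt_mul (inv_ne_zero hv)]
    change ratPt _ _ = _
    congr 1 <;> field_simp

lemma lin_ne_zero {a b c d u v : ℂ} (hdet : a * d - b * c ≠ 0) (h : u ≠ 0 ∨ v ≠ 0) :
    a * u + b * v ≠ 0 ∨ c * u + d * v ≠ 0 := by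
  by_contra! hcon
  have h1 : (a * d - b * c) * u = 0 := by linear_combination d * hcon.1 - b * hcon.2
  have h2 : (a * d - b * c) * v = 0 := by linear_combination a * hcon.2 - c * hcon.1
  rcases h with h | h
  · exact (mul_ne_zero hdet h) h1
  · exact (mul_ne_zero hdet h) h2

lemma mob_adj {a b c d : ℂ} (hdet : a * d - b * c ≠ 0) (x : RSphere) :
    mob d (-b) (-c) a (mob a b c d x) = x := by
  obtain ⟨u, v, h, rfl⟩ := exists_ratPt x
  rw [mob_ratPt _ _ _ _ h, mob_ratPt _ _ _ _ (lin_ne_zero hdet h), ← ratPt_mul hdet u v]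
  congr 1 <;> ring

lemma hol_mob {a b c d : ℂ} (hdet : a * d - b * c ≠ 0) : Hol (mob a b c d) := by
  have h1 : RatRep (mob a b c d) (C a * X + C b) (C c * X + C d) := by
    intro z
    have := lin_ne_zero hdet (u := z) (v := 1) (Or.inr one_ne_zero)
    simp only [eval_add, eval_mul, eval_C, eval_X]
    rw [mul_one, mul_one] at this
    exact ⟨this, rfl⟩
  have h2 : RatRep (fun x => mob a b c d (RSphere.inv x)) (C a + C b * X) (C c + C d * X) := by
    intro z
    have := lin_ne_zero hdet (u := 1) (v := z) (Or.inl one_ne_zero)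
    simp only [eval_add, eval_mul, eval_C, eval_X]
    rw [mul_one, mul_one] at this
    refine ⟨this, ?_⟩
    have h3 : ofC z = ratPt z 1 := by rw [ratPt_of_ne one_ne_zero, div_one]
    rw [h3, inv_ratPt (Or.inr one_ne_zero), mob_ratPt _ _ _ _ (Or.inl one_ne_zero), mul_one,
      mul_one]
  exact h1.hol h2

/-- Three distinct points can be moved to `0, 1, ∞` by a Möbius transformation. -/
lemma exists_mob {x y z : RSphere} (hxy : x ≠ y) (hyz : y ≠ z) (hxz : x ≠ z) :
    ∃ a b c d : ℂ, a * d - b * c ≠ 0 ∧ mob a b c d x = ofC 0 ∧ mob a b c d y = ofC 1 ∧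
      mob a b c d z = infty := by
  have key : ∀ {u v u' v' : ℂ}, (u ≠ 0 ∨ v ≠ 0) → (u' ≠ 0 ∨ v' ≠ 0) →
      ratPt u v ≠ ratPt u' v' → v * u' - u * v' ≠ 0 := by
    intro u v u' v' h h' hne h0
    apply hne
    by_cases hv : v = 0
    · have hu := h.resolve_right (not_not.mpr hv)
      have hv' : v' = 0 := by simpa [hv, hu] using h0
      rw [hv, hv', ratPt_zero_right, ratPt_zero_right]
    · by_cases hv' : v' = 0
      · have hu' := h'.resolve_right (not_not.mpr hv')
        simp [hv', hu', hv] at h0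
      · rw [ratPt_of_ne hv, ratPt_of_ne hv']
        congr 1
        field_simp
        linear_combination -h0
  obtain ⟨u1, v1, h1, rfl⟩ := exists_ratPt x
  obtain ⟨u2, v2, h2, rfl⟩ := exists_ratPt y
  obtain ⟨u3, v3, h3, rfl⟩ := exists_ratPt z
  have k12 := key h1 h2 hxy
  have k13 := key h1 h3 hxz
  have k32 := key h3 h2 hyz.symm
  set k1 := v3 * u2 - u3 * v2
  set k3 := v1 * u2 - u1 * v2
  refine ⟨k1 * v1, -(k1 * u1), k3 * v3, -(k3 * u3), ?_, ?_, ?_, ?_⟩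
  · have : k1 * v1 * -(k3 * u3) - -(k1 * u1) * (k3 * v3) =
        -(k1 * k3 * (v1 * u3 - u1 * v3)) := by ring
    rw [this, neg_ne_zero]
    exact mul_ne_zero (mul_ne_zero k32 k12) k13
  · rw [mob_ratPt _ _ _ _ h1]
    have e1 : k1 * v1 * u1 + -(k1 * u1) * v1 = 0 := by ring
    have e2 : k3 * v3 * u1 + -(k3 * u3) * v1 = -(k3 * (v1 * u3 - u1 * v3)) := by ring
    rw [e1, e2, ratPt_of_ne (neg_ne_zero.mpr (mul_ne_zero k12 k13)), zero_div]
  · rw [mob_ratPt _ _ _ _ h2]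
    have e1 : k1 * v1 * u2 + -(k1 * u1) * v2 = k1 * k3 := by ring
    have e2 : k3 * v3 * u2 + -(k3 * u3) * v2 = k1 * k3 := by ring
    rw [e1, e2, ratPt_of_ne (mul_ne_zero k32 k12), div_self (mul_ne_zero k32 k12)]
  · rw [mob_ratPt _ _ _ _ h3]
    have e2 : k3 * v3 * u3 + -(k3 * u3) * v3 = 0 := by ring
    rw [e2, ratPt_zero_right]

end RSphere

section RationalMap

open RSphere Polynomial

lemma not_common_root {p q : ℂ[X]} (h : IsCoprime p q) (z : ℂ) : p.eval z ≠ 0 ∨ q.eval z ≠ 0 := by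
  obtain ⟨a, b, hab⟩ := h
  by_contra! hcon
  have := congrArg (eval z) hab
  simp [hcon.1, hcon.2] at this

lemma IsRationalMap.den_ne_zero {f : RSphere → RSphere} {p q : ℂ[X]} (hf : IsRationalMap f p q)
    (hdeg : 2 ≤ ratDeg p q) : q ≠ 0 := by
  rintro rfl
  have h1 : IsUnit p := isCoprime_zero_right.mp hf.coprime
  have h2 := natDegree_eq_zero_of_isUnit h1
  simp [ratDeg, h2] at hdeg

lemma IsRationalMap.ratRep {f : RSphere → RSphere} {p q : ℂ[X]} (hf : IsRationalMap f p q)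
    (hdeg : 2 ≤ ratDeg p q) : RatRep f p q := by
  have hnc := not_common_root hf.coprime
  have hq := hf.den_ne_zero hdeg
  have h1 : (fun z => f (ofC z)) = fun z => ratPt (p.eval z) (q.eval z) := by
    have hfin : {z | q.eval z = 0}.Finite := by
      refine (q.roots.toFinset.finite_toSet).subset fun z hz => ?_
      simpa [hq] using hz
    refine Continuous.ext_on (hfin.countable.dense_compl ℂ)
      (hf.continuous.comp continuous_ofC) (continuous_ratPt hnc) fun z hz => ?_
    rw [ratPt_of_ne hz, hf.eval z hz]
  exact fun z => ⟨hnc z, congrFun h1 z⟩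

lemma eval_reflect {p : ℂ[X]} {n : ℕ} (hp : p.natDegree ≤ n) {w : ℂ} (hw : w ≠ 0) :
    (p.reflect n).eval w = w ^ n * p.eval w⁻¹ := by
  have : Invertible w⁻¹ := invertibleOfNonzero (inv_ne_zero hw)
  have h := eval₂_reflect_mul_pow (RingHom.id ℂ) w⁻¹ n p hp
  rw [invOf_eq_inv, _root_.inv_inv] at h
  rw [eval, eval, ← h, mul_comm, mul_assoc, inv_pow, inv_mul_cancel₀ (pow_ne_zero n hw), mul_one]

lemma eval_zero_reflect (p : ℂ[X]) (n : ℕ) : (p.reflect n).eval 0 = p.coeff n := by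
  rw [← coeff_zero_eq_eval_zero, coeff_reflect, revAt_le (Nat.zero_le n), Nat.sub_zero]

lemma IsRationalMap.ratRep_inv {f : RSphere → RSphere} {p q : ℂ[X]} (hf : IsRationalMap f p q)
    (hdeg : 2 ≤ ratDeg p q) : RatRep (fun x => f (inv x)) (p.reflect (ratDeg p q))
      (q.reflect (ratDeg p q)) := by
  have hr := hf.ratRep hdeg
  have hp : p.natDegree ≤ ratDeg p q := le_max_left _ _
  have hq : q.natDegree ≤ ratDeg p q := le_max_right _ _
  have hnc : ∀ z, (p.reflect (ratDeg p q)).eval z ≠ 0 ∨ (q.reflect (ratDeg p q)).eval z ≠ 0 := by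
    intro z
    by_cases hz : z = 0
    · rw [hz, eval_zero_reflect, eval_zero_reflect]
      rcases max_choice p.natDegree q.natDegree with h | h
      · left
        have hp0 : p ≠ 0 := by
          rintro rfl
          simp only [ratDeg] at hdeg
          rw [h] at hdeg
          simp at hdeg
        rw [ratDeg, h]
        exact leadingCoeff_ne_zero.mpr hp0
      · right
        rw [ratDeg, h]
        exact leadingCoeff_ne_zero.mpr (hf.den_ne_zero hdeg)
    · rw [eval_reflect hp hz, eval_reflect hq hz]
      exact (not_common_root hf.coprime z⁻¹).imp (mul_ne_zero (pow_ne_zero _ hz))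
        (mul_ne_zero (pow_ne_zero _ hz))
  have h1 : (fun z => f (inv (ofC z))) = fun z => ratPt ((p.reflect (ratDeg p q)).eval z)
      ((q.reflect (ratDeg p q)).eval z) := by
    refine Continuous.ext_on ((finite_singleton (0 : ℂ)).countable.dense_compl ℂ)
      (hf.continuous.comp (continuous_inv.comp continuous_ofC)) (continuous_ratPt hnc) fun z hz => ?_
    have hz0 : z ≠ 0 := hz
    rw [eval_reflect hp hz0, eval_reflect hq hz0, ratPt_mul (pow_ne_zero _ hz0), inv_ofC hz0,
      (hr z⁻¹).2]
  exact fun z => ⟨hnc z, congrFun h1 z⟩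

lemma IsRationalMap.hol {f : RSphere → RSphere} {p q : ℂ[X]} (hf : IsRationalMap f p q)
    (hdeg : 2 ≤ ratDeg p q) : Hol f :=
  (hf.ratRep hdeg).hol (hf.ratRep_inv hdeg)

lemma wronskian_ne_zero_of_ratDeg {p q : ℂ[X]} (h : IsCoprime p q) (hdeg : 2 ≤ ratDeg p q) :
    wronskian p q ≠ 0 := by
  rw [Ne, h.wronskian_eq_zero_iff]
  rintro ⟨h1, h2⟩
  have h1' := derivative_eq_zero.mp h1
  have h2' := derivative_eq_zero.mp h2
  simp [ratDeg, h1', h2'] at hdeg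

/-- A rational map of degree at least two has finitely many critical points. -/
lemma IsRationalMap.finite_critSet {f : RSphere → RSphere} {p q : ℂ[X]}
    (hf : IsRationalMap f p q) (hdeg : 2 ≤ ratDeg p q) : (critSet f).Finite := by
  have hW := wronskian_ne_zero_of_ratDeg hf.coprime hdeg
  have hh := hf.hol hdeg
  have hr := hf.ratRep hdeg
  have key : ∀ (P Q : ℂ[X]) (z : ℂ), Q.eval z ≠ 0 →
      deriv (fun w => P.eval w / Q.eval w) z = 0 → (wronskian P Q).eval z = 0 := by
    intro P Q z hz hd
    rw [deriv_fun_div P.differentiableAt Q.differentiableAt hz, div_eq_zero_iff] at hd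
    have := hd.resolve_right (pow_ne_zero 2 hz)
    simp only [Polynomial.deriv] at this
    simp only [wronskian, eval_sub, eval_mul]
    linear_combination -this
  refine (((wronskian p q).roots.toFinset.finite_toSet.image ofC).union
    (finite_singleton infty)).subset fun x hx => ?_
  by_cases hxi : x = infty
  · right; exact hxi
  left
  obtain ⟨z, rfl⟩ := exists_ofC hxi
  refine ⟨z, ?_, rfl⟩
  have hx0 : sphDeriv f (ofC z) = 0 := hx
  suffices (wronskian p q).eval z = 0 by simpa [hW] using this
  by_cases hz : f (ofC z) = infty
  · have h1 : inv (f (id (ofC z))) ≠ infty := by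
      rw [id, hz, inv_infty]; exact ofC_ne_infty 0
    have h2 := (hh.sphDeriv_eq_zero_iff (Or.inl rfl) (Or.inr rfl) h1).mp hx0
    obtain ⟨h3, h4⟩ := hr.inv.eventuallyEq h1
    have h5 := key q p z h3 (by rw [← h4.deriv_eq]; exact h2)
    rw [← wronskian_neg_eq, eval_neg, h5, neg_zero]
  · have h1 : id (f (id (ofC z))) ≠ infty := hz
    have h2 := (hh.sphDeriv_eq_zero_iff (Or.inl rfl) (Or.inl rfl) h1).mp hx0
    obtain ⟨h3, h4⟩ := hr.eventuallyEq h1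
    exact key p q z h3 (by rw [← h4.deriv_eq]; exact h2)

/-- Fibres of a rational map have cardinality bounded in terms of the degree. -/
lemma IsRationalMap.fiber {f : RSphere → RSphere} {p q : ℂ[X]}
    (hf : IsRationalMap f p q) (hdeg : 2 ≤ ratDeg p q) (y : RSphere) :
    (f ⁻¹' {y}).Finite ∧ (f ⁻¹' {y}).ncard ≤ ratDeg p q + 1 := by
  have hr := hf.ratRep hdeg
  have key : ∃ P : ℂ[X], P ≠ 0 ∧ P.natDegree ≤ ratDeg p q ∧
      ∀ z, f (ofC z) = y → P.eval z = 0 := by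
    by_cases hy : y = infty
    · refine ⟨q, hf.den_ne_zero hdeg, le_max_right _ _, fun z hz => ?_⟩
      rwa [(hr z).2, hy, ratPt_eq_infty_iff] at hz
    · obtain ⟨c, rfl⟩ := exists_ofC hy
      refine ⟨p - C c * q, ?_, ?_, fun z hz => ?_⟩
      · intro h0
        have h1 : p = C c * q := sub_eq_zero.mp h0
        have h2 : IsUnit q := by
          have := hf.coprime
          rw [h1] at this
          exact isCoprime_self.mp (this.of_mul_left_right)
        have h3 := natDegree_eq_zero_of_isUnit h2
        have h4 : p.natDegree ≤ 0 := by
          rw [h1, ← h3]; exact natDegree_C_mul_le c q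
        simp [ratDeg, h3, Nat.le_zero.mp h4] at hdeg
      · refine (natDegree_sub_le _ _).trans ?_
        exact max_le_max le_rfl (natDegree_C_mul_le c q)
      · rw [(hr z).2] at hz
        have hq0 : q.eval z ≠ 0 := by
          intro h0
          rw [h0, ratPt_zero_right] at hz
          exact ofC_ne_infty c hz.symm
        rw [ratPt_of_ne hq0] at hz
        have := ofC_injective hz
        rw [eval_sub, eval_mul, eval_C, ← this]
        field_simp
        ring
  obtain ⟨P, hP0, hPd, hP⟩ := key
  classical
  set S : Finset RSphere := insert infty (P.roots.toFinset.image ofC) with hS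
  have hsub : f ⁻¹' {y} ⊆ S := by
    intro x hx
    by_cases hxi : x = infty
    · simp [hS, hxi]
    · obtain ⟨z, rfl⟩ := exists_ofC hxi
      have := hP z hx
      simp only [hS, Finset.coe_insert, Finset.coe_image]
      right
      exact ⟨z, by simpa [hP0] using this, rfl⟩
  refine ⟨S.finite_toSet.subset hsub, ?_⟩
  calc (f ⁻¹' {y}).ncard ≤ (S : Set RSphere).ncard := ncard_le_ncard hsub S.finite_toSet
    _ = S.card := ncard_coe_finset S
    _ ≤ (P.roots.toFinset.image ofC).card + 1 := Finset.card_insert_le _ _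
    _ ≤ P.roots.toFinset.card + 1 := by gcongr; exact Finset.card_image_le
    _ ≤ Multiset.card P.roots + 1 := by gcongr; exact Multiset.toFinset_card_le _
    _ ≤ ratDeg p q + 1 := by gcongr; exact (card_roots' P).trans hPd

end RationalMap

open RSphere in
/-- **Montel's theorem for iterates**: an open set meeting the Julia set has an iterate hitting one
of any three given distinct points. -/
lemma exists_iterate_eq_of_julia {f : RSphere → RSphere} (hf : Hol f) {x y z : RSphere}
    (hxy : x ≠ y) (hyz : y ≠ z) (hxz : x ≠ z) {U : Set RSphere} (hU : IsOpen U)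
    (hUJ : (U ∩ juliaSet f).Nonempty) :
    ∃ n, ∃ w ∈ U, f^[n] w = x ∨ f^[n] w = y ∨ f^[n] w = z := by
  by_contra! hcon
  obtain ⟨w₀, hw₀, hJ⟩ := hUJ
  refine hJ ⟨U, hU, hw₀, fun w hw => ?_⟩
  refine EquicontinuousAt.equicontinuousWithinAt ?_ U
  obtain ⟨a', b', c', d', hdet, hx, hy, hz⟩ := exists_mob hxy hyz hxz
  set T := mob a' b' c' d' with hT
  set N := mob d' (-b') (-c') a' with hN
  have hNT : ∀ u, N (T u) = u := mob_adj hdet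
  have hTinj : Function.Injective T := Function.LeftInverse.injective hNT
  have hTH : Hol T := hol_mob hdet
  have hNc : UniformContinuous N := by
    have h1 : d' * a' - -b' * -c' ≠ 0 := by rw [neg_mul_neg, mul_comm d']; exact hdet
    exact CompactSpace.uniformContinuous_of_continuous (hol_mob h1).continuous
  obtain ⟨A, hA, a, rfl⟩ := exists_chart_eq w
  have h2 : (fun u => A (ofC u)) ⁻¹' U ∈ 𝓝 a := by
    have := hU.mem_nhds hw
    rwa [← hA.map_nhds] at this
  obtain ⟨R, hR, hRU⟩ := Metric.mem_nhds_iff.mp h2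
  obtain ⟨C, hC, hmon⟩ := exists_montel_bound
  have hlip : ∀ n : ℕ, ∀ u ∈ ball a (R / 2),
      dist (T (f^[n] (A (ofC u)))) (T (f^[n] (A (ofC a)))) ≤ 2 * (C * (‖u - a‖ / R)) := by
    intro n
    have hne : ∀ u ∈ ball a R, T (f^[n] (A (ofC u))) ≠ infty := fun u hu h =>
      (hcon n _ (hRU hu)).2.2 (hTinj (h.trans hz.symm))
    set h : ℂ → ℂ := fun u => toC (T (f^[n] (A (ofC u)))) with hh
    have hval : ∀ u ∈ ball a R, T (f^[n] (A (ofC u))) = ofC (h u) := fun u hu =>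
      (ofC_toC (hne u hu)).symm
    have hd : DifferentiableOn ℂ h (ball a R) := fun u hu =>
      ((hTH.comp (hf.iterate n)).2 A id hA (Or.inl rfl) u (hne u hu)).differentiableWithinAt
    have h01 : ∀ u ∈ ball a R, h u ≠ 0 ∧ h u ≠ 1 := by
      intro u hu
      have h3 := hcon n _ (hRU hu)
      refine ⟨fun h0 => h3.1 (hTinj ?_), fun h1 => h3.2.1 (hTinj ?_)⟩
      · rw [hx, ← h0]; exact hval u hu
      · rw [hy, ← h1]; exact hval u hu
    have hsub : ball a (R / 2) ⊆ ball a R := ball_subset_ball (by linarith)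
    have ha : a ∈ ball a R := mem_ball_self hR
    rcases hmon h a R hR hd h01 with h3 | h3
    · intro u hu
      rw [hval u (hsub hu), hval a ha]
      exact (dist_ofC_le _ _).trans (by linarith [h3 u hu])
    · intro u hu
      rw [hval u (hsub hu), hval a ha, ← dist_inv, inv_ofC (h01 u (hsub hu)).1,
        inv_ofC (h01 a ha).1]
      exact (dist_ofC_le _ _).trans (by linarith [h3 u hu])
  rw [Metric.equicontinuousAt_iff_right]
  intro e he
  obtain ⟨δ, hδ, hδN⟩ := Metric.uniformContinuous_iff.mp hNc e he
  rw [← hA.map_nhds, eventually_map]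
  have hlim : Tendsto (fun u : ℂ => 2 * (C * (‖u - a‖ / R))) (𝓝 a) (𝓝 0) := by
    have : Continuous (fun u : ℂ => 2 * (C * (‖u - a‖ / R))) := by fun_prop
    simpa using this.tendsto a
  filter_upwards [hlim.eventually_lt_const hδ, ball_mem_nhds a (half_pos hR)] with u hu1 hu2 n
  have := hδN ((hlip n u hu2).trans_lt hu1)
  rwa [hNT, hNT, dist_comm] at this

open RSphere in
/-- A non-critical preimage of a point of the Julia set is in the Julia set. -/
lemma mem_juliaSet_of_sphDeriv_ne_zero {f : RSphere → RSphere} (hf : Hol f) {x : RSphere}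
    (hx : f x ∈ juliaSet f) (hd : sphDeriv f x ≠ 0) : x ∈ juliaSet f := by
  rintro ⟨U, hU, hxU, hE⟩
  apply hx
  -- the image of a small neighbourhood
  have hnon : ∀ y, sphDeriv f y ≠ 0 → 𝓝 (f y) ≤ map f (𝓝 y) := fun y hy => hf.nhds_le_map hy
  set V := U ∩ {y | sphDeriv f y ≠ 0} with hV
  have hVo : IsOpen V := hU.inter (hf.continuous_sphDeriv.isOpen_preimage _ isOpen_ne)
  have hfV : IsOpen (f '' V) := by
    rw [isOpen_iff_mem_nhds]
    rintro _ ⟨y, hy, rfl⟩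
    exact hnon y hy.2 (image_mem_map (hVo.mem_nhds hy))
  refine ⟨f '' V, hfV, mem_image_of_mem f ⟨hxU, hd⟩, ?_⟩
  rintro _ ⟨y, hy, rfl⟩
  refine EquicontinuousAt.equicontinuousWithinAt ?_ _
  rw [Metric.equicontinuousAt_iff_right]
  intro e he
  have h1 : ∀ᶠ u in 𝓝 y, ∀ n : ℕ, dist (f^[n] y) (f^[n] u) < e := by
    have h2 := hE y hy.1 _ (Metric.dist_mem_uniformity he)
    rw [hU.nhdsWithin_eq hy.1] at h2
    exact h2
  have h3 := hnon y hy.2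
  apply h3
  rw [mem_map]
  filter_upwards [h1] with u hu n
  exact hu (n + 1)

open RSphere

/-- Uniform conformality of a holomorphic map on the sphere. -/
lemma RSphere.Hol.uniform_SCAt {f : RSphere → RSphere} (hf : Hol f) {e : ℝ} (he : 0 < e) :
    ∃ δ > 0, ∀ x y z : RSphere, dist y x < δ → dist z x < δ →
      |dist (f y) (f z) - sphDeriv f x * dist y z| ≤ e * dist y z := by
  have h1 : ∀ᶠ p : RSphere × RSphere in uniformity RSphere,
      |dist (f p.1) (f p.2) - sphDeriv f p.1 * dist p.1 p.2| ≤ e / 2 * dist p.1 p.2 := by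
    rw [← nhdsSet_diagonal_eq_uniformity]
    rw [eventually_nhdsSet_iff_forall]
    rintro ⟨x, y⟩ (hxy : x = y)
    subst hxy
    have hc : Tendsto (fun p : RSphere × RSphere => sphDeriv f p.1) (𝓝 (x, x))
        (𝓝 (sphDeriv f x)) := (hf.continuous_sphDeriv.comp continuous_fst).continuousAt
    filter_upwards [hf.SCAt x (e / 4) (by positivity),
      (Metric.tendsto_nhds.mp hc) (e / 4) (by positivity)] with p hp hq
    rw [Real.dist_eq] at hq
    have h2 : dist (f p.1) (f p.2) - sphDeriv f p.1 * dist p.1 p.2 =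
        (dist (f p.1) (f p.2) - sphDeriv f x * dist p.1 p.2) -
          (sphDeriv f p.1 - sphDeriv f x) * dist p.1 p.2 := by ring
    rw [h2]
    refine (abs_sub _ _).trans ?_
    rw [abs_mul, abs_of_nonneg (dist_nonneg : 0 ≤ dist p.1 p.2)]
    nlinarith [dist_nonneg (x := p.1) (y := p.2)]
  obtain ⟨δ₁, hδ₁, h1⟩ := Metric.mem_uniformity_dist.mp h1
  have hu := CompactSpace.uniformContinuous_of_continuous hf.continuous_sphDeriv
  obtain ⟨δ₂, hδ₂, h2⟩ := Metric.uniformContinuous_iff.mp hu (e / 2) (by positivity)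
  refine ⟨min (δ₁ / 2) δ₂, by positivity, fun x y z hy hz => ?_⟩
  have hyz : dist y z < δ₁ := by
    have := dist_triangle_right y z x
    have := min_le_left (δ₁ / 2) δ₂
    linarith
  have h3 := h1 hyz
  have h4 := h2 (hy.trans_le (min_le_right _ _))
  simp only [] at h3
  rw [Real.dist_eq] at h4
  have h5 : dist (f y) (f z) - sphDeriv f x * dist y z =
      (dist (f y) (f z) - sphDeriv f y * dist y z) +
        (sphDeriv f y - sphDeriv f x) * dist y z := by ring
  rw [h5]
  refine (abs_add_le _ _).trans ?_
  have h6 : |dist (f y) (f z) - sphDeriv f y * dist y z| ≤ e / 2 * dist y z := h3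
  rw [abs_mul, abs_of_nonneg (dist_nonneg : 0 ≤ dist y z)]
  nlinarith [dist_nonneg (x := y) (y := z)]

lemma RSphere.Hol.exists_lipschitz {f : RSphere → RSphere} (hf : Hol f) :
    ∃ K : ℝ, 1 < K ∧ (∀ x y, dist (f x) (f y) ≤ K * dist x y) ∧ ∀ x, sphDeriv f x ≤ K := by
  obtain ⟨M, hM⟩ := (isCompact_univ.image hf.continuous_sphDeriv).bddAbove
  have hM' : ∀ x, sphDeriv f x ≤ M := fun x => hM ⟨x, mem_univ _, rfl⟩
  obtain ⟨δ, hδ, h⟩ := hf.uniform_SCAt one_pos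
  set C := diam (univ : Set RSphere) with hC
  have hC' : ∀ x y : RSphere, dist x y ≤ C := fun x y =>
    dist_le_diam_of_mem isCompact_univ.isBounded (mem_univ _) (mem_univ _)
  have hC0 : 0 ≤ C := diam_nonneg
  refine ⟨max 2 (max (M + 1) (C / δ)), lt_max_of_lt_left one_lt_two, fun x y => ?_, fun x => ?_⟩
  · by_cases hxy : dist x y < δ
    · have h1 := (abs_le.mp (h y x y hxy (by simpa using hδ))).2
      have h2 : dist (f x) (f y) ≤ (M + 1) * dist x y := by
        nlinarith [hM' y, dist_nonneg (x := x) (y := y)]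
      refine h2.trans ?_
      gcongr
      exact (le_max_left _ _).trans (le_max_right _ _)
    · push Not at hxy
      calc dist (f x) (f y) ≤ C / δ * δ := by rw [div_mul_cancel₀ _ hδ.ne']; exact hC' _ _
        _ ≤ _ := by
          gcongr
          exact (le_max_right _ _).trans (le_max_right _ _)
  · have := hM' x
    exact (by linarith : sphDeriv f x ≤ M + 1).trans ((le_max_left _ _).trans (le_max_right _ _))

lemma RSphere.Hol.dist_iterate_le {f : RSphere → RSphere} {K : ℝ} (hK : 1 < K)
    (h : ∀ x y, dist (f x) (f y) ≤ K * dist x y) (n : ℕ) (x y : RSphere) :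
    dist (f^[n] x) (f^[n] y) ≤ K ^ n * dist x y := by
  induction n with
  | zero => simp
  | succ n ih =>
    rw [Function.iterate_succ_apply', Function.iterate_succ_apply']
    refine (h _ _).trans ?_
    rw [pow_succ', mul_assoc]
    gcongr

lemma RSphere.Hol.sphDeriv_iterate_succ {f : RSphere → RSphere} (hf : Hol f) (n : ℕ)
    (x : RSphere) : sphDeriv f^[n + 1] x = sphDeriv f^[n] (f x) * sphDeriv f x := by
  rw [Function.iterate_succ]; exact (hf.iterate n).sphDeriv_comp hf x

lemma RSphere.Hol.sphDeriv_iterate_zero (f : RSphere → RSphere) (x : RSphere) :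
    sphDeriv f^[0] x = 1 := by
  have : _root_.SCAt f^[0] x 1 := _root_.SCAt.of_isometry (fun _ _ => rfl) x
  exact this.sphDeriv_eq

lemma RSphere.Hol.sphDeriv_iterate_add {f : RSphere → RSphere} (hf : Hol f) (m n : ℕ)
    (x : RSphere) : sphDeriv f^[m + n] x = sphDeriv f^[m] (f^[n] x) * sphDeriv f^[n] x := by
  rw [Function.iterate_add]; exact (hf.iterate m).sphDeriv_comp (hf.iterate n) x

lemma RSphere.Hol.sphDeriv_iterate_le {f : RSphere → RSphere} (hf : Hol f) {K : ℝ}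
    (h : ∀ x, sphDeriv f x ≤ K) (n : ℕ) (x : RSphere) : sphDeriv f^[n] x ≤ K ^ n := by
  have hK : 0 ≤ K := (hf.sphDeriv_nonneg x).trans (h x)
  induction n generalizing x with
  | zero => rw [Hol.sphDeriv_iterate_zero, pow_zero]
  | succ n ih =>
    rw [hf.sphDeriv_iterate_succ, pow_succ]
    exact mul_le_mul (ih _) (h x) (hf.sphDeriv_nonneg x) (by positivity)

/-- Uniform distortion near a set on which the derivative is bounded below. -/
lemma RSphere.Hol.uniform_distortion {f : RSphere → RSphere} (hf : Hol f) {L : Set RSphere}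
    {c : ℝ} (hc : 0 < c) (hL : ∀ x ∈ L, c ≤ sphDeriv f x) {η : ℝ} (hη : 0 < η) :
    ∃ δ > 0, ∀ x ∈ L, ∀ y z, dist y x < δ → dist z x < δ →
      Real.exp (-η) * sphDeriv f x * dist y z ≤ dist (f y) (f z) ∧
        dist (f y) (f z) ≤ Real.exp η * sphDeriv f x * dist y z := by
  have h1 : 0 < 1 - Real.exp (-η) := by
    rw [sub_pos, Real.exp_lt_one_iff]; linarith
  obtain ⟨δ, hδ, h⟩ := hf.uniform_SCAt (mul_pos hc h1)
  refine ⟨δ, hδ, fun x hx y z hy hz => ?_⟩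
  have h2 := abs_le.mp (h x y z hy hz)
  have h3 : 1 - Real.exp (-η) ≤ Real.exp η - 1 := by
    have := Real.add_one_le_exp η
    have h4 : Real.exp η * Real.exp (-η) = 1 := by rw [← Real.exp_add]; simp
    nlinarith [sq_nonneg (Real.exp η - 1), Real.exp_pos (-η)]
  have h5 : c * (1 - Real.exp (-η)) * dist y z ≤
      sphDeriv f x * (1 - Real.exp (-η)) * dist y z := by
    gcongr; exact hL x hx
  have h6 : c * (1 - Real.exp (-η)) * dist y z ≤ sphDeriv f x * (Real.exp η - 1) * dist y z := by
    gcongr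
    · exact hf.sphDeriv_nonneg x
    · exact hL x hx
  constructor <;> nlinarith

/-- Uniform local surjectivity near a compact set without critical points. -/
lemma RSphere.Hol.uniform_surj {f : RSphere → RSphere} (hf : Hol f) {L : Set RSphere}
    (hLc : IsCompact L) (hL : ∀ x ∈ L, sphDeriv f x ≠ 0) {δ : ℝ} (hδ : 0 < δ) :
    ∃ r > 0, ∀ x ∈ L, ∀ u, dist u (f x) < r → ∃ v, dist v x < δ ∧ f v = u := by
  refine hLc.induction_on (p := fun s => ∃ r > 0, ∀ x ∈ s, ∀ u, dist u (f x) < r →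
    ∃ v, dist v x < δ ∧ f v = u) ⟨1, one_pos, by simp⟩ ?_ ?_ ?_
  · rintro s t hst ⟨r, hr, h⟩
    exact ⟨r, hr, fun x hx => h x (hst hx)⟩
  · rintro s t ⟨r, hr, h⟩ ⟨r', hr', h'⟩
    refine ⟨min r r', lt_min hr hr', ?_⟩
    rintro x (hx | hx) u hu
    · exact h x hx u (hu.trans_le (min_le_left _ _))
    · exact h' x hx u (hu.trans_le (min_le_right _ _))
  · intro x hx
    have h1 : f '' ball x (δ / 2) ∈ 𝓝 (f x) :=
      hf.nhds_le_map (hL x hx) (image_mem_map (ball_mem_nhds x (half_pos hδ)))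
    obtain ⟨r, hr, h2⟩ := Metric.mem_nhds_iff.mp h1
    refine ⟨ball x (δ / 2) ∩ f ⁻¹' ball (f x) (r / 2), mem_nhdsWithin_of_mem_nhds
      (inter_mem (ball_mem_nhds x (half_pos hδ))
        (hf.continuous.continuousAt (ball_mem_nhds _ (half_pos hr)))),
      r / 2, half_pos hr, ?_⟩
    rintro y ⟨hy1, hy2⟩ u hu
    have hu2 : u ∈ ball (f x) r := by
      have := dist_triangle u (f y) (f x)
      rw [mem_ball]
      have : dist (f y) (f x) < r / 2 := hy2
      linarith
    obtain ⟨v, hv, rfl⟩ := h2 hu2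
    refine ⟨v, ?_, rfl⟩
    have := dist_triangle_right v y x
    rw [mem_ball] at hv hy1
    linarith

/-- `w` is an inverse branch of `f^[N]` on `S` with logarithmic expansion between `a` and `b`. -/
def Branch (f w : RSphere → RSphere) (N : ℕ) (S : Set RSphere) (a b : ℝ) : Prop :=
  (∀ u ∈ S, f^[N] (w u) = u) ∧ ∀ u ∈ S, ∀ u' ∈ S,
    Real.exp (-b) * dist u u' ≤ dist (w u) (w u') ∧ dist (w u) (w u') ≤ Real.exp (-a) * dist u u'

lemma Branch.mono {f w : RSphere → RSphere} {N : ℕ} {S T : Set RSphere} {a b : ℝ}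
    (h : Branch f w N S a b) (hT : T ⊆ S) : Branch f w N T a b :=
  ⟨fun u hu => h.1 u (hT hu), fun u hu u' hu' => h.2 u (hT hu) u' (hT hu')⟩

lemma Branch.weaken {f w : RSphere → RSphere} {N : ℕ} {S : Set RSphere} {a b a' b' : ℝ}
    (h : Branch f w N S a b) (ha : a' ≤ a) (hb : b ≤ b') : Branch f w N S a' b' := by
  refine ⟨h.1, fun u hu u' hu' => ⟨le_trans ?_ (h.2 u hu u' hu').1,
    (h.2 u hu u' hu').2.trans ?_⟩⟩
  · gcongr
  · gcongr

lemma Branch.comp {f v w : RSphere → RSphere} {M N : ℕ} {S T : Set RSphere} {a b a' b' : ℝ}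
    (h : Branch f v M T a b) (h' : Branch f w N S a' b') (hm : MapsTo w S T) :
    Branch f (v ∘ w) (M + N) S (a + a') (b + b') := by
  refine ⟨fun u hu => ?_, fun u hu u' hu' => ?_⟩
  · rw [add_comm, Function.iterate_add_apply, Function.comp, h.1 _ (hm hu), h'.1 _ hu]
  · have h1 := h.2 _ (hm hu) _ (hm hu')
    have h2 := h'.2 _ hu _ hu'
    simp only [Function.comp]
    rw [neg_add, neg_add, Real.exp_add, Real.exp_add, mul_assoc, mul_assoc]
    exact ⟨le_trans (by gcongr; exact h2.1) h1.1, h1.2.trans (by gcongr; exact h2.2)⟩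

lemma Branch.le {f w : RSphere → RSphere} {N : ℕ} {S : Set RSphere} {a b : ℝ}
    (h : Branch f w N S a b) {u u' : RSphere} (hu : u ∈ S) (hu' : u' ∈ S) (hne : u ≠ u') :
    a ≤ b := by
  have h1 := h.2 u hu u' hu'
  have h2 := le_of_mul_le_mul_right (h1.1.trans h1.2) (dist_pos.mpr hne)
  rw [Real.exp_le_exp] at h2
  linarith

/-- The derivative along an inverse branch. -/
lemma Branch.sphDeriv_mem {f w : RSphere → RSphere} {N : ℕ} {S : Set RSphere} {a b : ℝ}
    (h : Branch f w N S a b) (hf : Hol f) {u : RSphere} (hu : S ∈ 𝓝 u) :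
    Real.exp a ≤ sphDeriv f^[N] (w u) ∧ sphDeriv f^[N] (w u) ≤ Real.exp b := by
  have hS : u ∈ S := mem_of_mem_nhds hu
  have hnb := RSphere.nhdsNE_neBot u
  have hw : Tendsto w (𝓝[≠] u) (𝓝[≠] (w u)) := by
    rw [tendsto_nhdsWithin_iff]
    constructor
    · rw [tendsto_iff_dist_tendsto_zero]
      have h1 : Tendsto (fun v => Real.exp (-a) * dist v u) (𝓝[≠] u) (𝓝 0) := by
        have : Continuous fun v => Real.exp (-a) * dist v u := by fun_prop
        have := this.tendsto u
        simp only [dist_self, mul_zero] at this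
        exact this.mono_left nhdsWithin_le_nhds
      refine squeeze_zero' (Eventually.of_forall fun _ => dist_nonneg) ?_ h1
      filter_upwards [mem_nhdsWithin_of_mem_nhds hu] with v hv using (h.2 v hv u hS).2
    · filter_upwards [mem_nhdsWithin_of_mem_nhds hu, self_mem_nhdsWithin] with v hv hvu heq
      exact hvu (by rw [mem_singleton_iff, ← h.1 v hv, ← h.1 u hS, heq])
  have h1 := ((hf.iterate N).SCAt (w u)).tendsto.comp hw
  have h2 : ∀ᶠ v in 𝓝[≠] u, Real.exp a ≤ dist (f^[N] (w v)) (f^[N] (w u)) / dist (w v) (w u) ∧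
      dist (f^[N] (w v)) (f^[N] (w u)) / dist (w v) (w u) ≤ Real.exp b := by
    filter_upwards [mem_nhdsWithin_of_mem_nhds hu, self_mem_nhdsWithin,
      (tendsto_nhdsWithin_iff.mp hw).2] with v hv hvu hvw
    have hp : 0 < dist (w v) (w u) := dist_pos.mpr hvw
    rw [h.1 v hv, h.1 u hS, le_div_iff₀ hp, div_le_iff₀ hp]
    have h3 := h.2 v hv u hS
    constructor
    · calc _ ≤ Real.exp a * (Real.exp (-a) * dist v u) := by gcongr; exact h3.2
        _ = _ := by rw [← mul_assoc, ← Real.exp_add]; simp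
    · calc dist v u = Real.exp b * (Real.exp (-b) * dist v u) := by
            rw [← mul_assoc, ← Real.exp_add]; simp
        _ ≤ _ := by gcongr; exact h3.1
  exact ⟨ge_of_tendsto h1 (h2.mono fun _ h => h.1), le_of_tendsto h1 (h2.mono fun _ h => h.2)⟩

/-- Local inverse at a non-critical point. -/
lemma RSphere.Hol.exists_branch {f : RSphere → RSphere} (hf : Hol f) {m : ℕ} {w : RSphere}
    (hw : sphDeriv f^[m] w ≠ 0) {τ : ℝ} (hτ : 0 < τ) :
    ∃ ρ > 0, ∃ φ a b, Branch f φ m (closedBall (f^[m] w) ρ) a b ∧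
      ∀ u ∈ closedBall (f^[m] w) ρ, dist (φ u) w < τ := by
  have hg := hf.iterate m
  set D := sphDeriv f^[m] w with hD
  have hD0 : 0 < D := lt_of_le_of_ne (hg.sphDeriv_nonneg w) (Ne.symm hw)
  have h1 := hg.SCAt w (D / 2) (half_pos hD0)
  obtain ⟨δ, hδ, h2⟩ := Metric.eventually_nhds_iff.mp h1
  have h3 : f^[m] '' ball w (min δ τ) ∈ 𝓝 (f^[m] w) :=
    hg.nhds_le_map hw (image_mem_map (ball_mem_nhds w (lt_min hδ hτ)))
  obtain ⟨ρ, hρ, h4⟩ := Metric.nhds_basis_closedBall.mem_iff.mp h3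
  have h4' : ∀ u, ∃ v, u ∈ closedBall (f^[m] w) ρ → v ∈ ball w (min δ τ) ∧ f^[m] v = u := by
    intro u
    by_cases hu : u ∈ closedBall (f^[m] w) ρ
    · obtain ⟨v, hv⟩ := h4 hu
      exact ⟨v, fun _ => hv⟩
    · exact ⟨u, fun h => absurd h hu⟩
  choose φ hφ using h4'
  have hφ1 := fun u hu => (hφ u hu).1
  have hφ2 := fun u hu => (hφ u hu).2
  refine ⟨ρ, hρ, φ, Real.log (D / 2), Real.log (3 * D / 2), ⟨fun u hu => hφ2 _ hu, ?_⟩,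
    fun u hu => (mem_ball.mp (hφ1 _ hu)).trans_le (min_le_right _ _)⟩
  intro u hu u' hu'
  have h5 : dist (φ u, φ u') (w, w) < δ := by
    rw [Prod.dist_eq, max_lt_iff]
    exact ⟨(mem_ball.mp (hφ1 _ hu)).trans_le (min_le_left _ _),
      (mem_ball.mp (hφ1 _ hu')).trans_le (min_le_left _ _)⟩
  have h6 := abs_le.mp (h2 h5)
  simp only [hφ2 _ hu, hφ2 _ hu'] at h6
  rw [Real.exp_neg, Real.exp_neg, Real.exp_log (by positivity), Real.exp_log (by positivity)]
  constructor
  · rw [inv_mul_le_iff₀ (by positivity)]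
    linarith
  · rw [le_inv_mul_iff₀ (by positivity)]
    linarith

@[simp] lemma sphDeriv_id (x : RSphere) : sphDeriv id x = 1 :=
  Hol.sphDeriv_iterate_zero id x

lemma iterate_mem_of_mapsTo {f : RSphere → RSphere} {L : Set RSphere} (h : ∀ x ∈ L, f x ∈ L)
    (n : ℕ) {x : RSphere} (hx : x ∈ L) : f^[n] x ∈ L := by
  induction n with
  | zero => exact hx
  | succ n ih => rw [Function.iterate_succ_apply']; exact h _ ih

lemma tracking {f : RSphere → RSphere} (hf : Hol f) {L : Set RSphere} (hinv : ∀ x ∈ L, f x ∈ L)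
    {η δ : ℝ} (h : ∀ x ∈ L, ∀ y z, dist y x < δ → dist z x < δ →
      Real.exp (-η) * sphDeriv f x * dist y z ≤ dist (f y) (f z) ∧
        dist (f y) (f z) ≤ Real.exp η * sphDeriv f x * dist y z) (n : ℕ) :
    ∀ x ∈ L, ∀ y z : RSphere, (∀ k < n, dist (f^[k] y) (f^[k] x) < δ) →
      (∀ k < n, dist (f^[k] z) (f^[k] x) < δ) →
      Real.exp (-(η * n)) * sphDeriv f^[n] x * dist y z ≤ dist (f^[n] y) (f^[n] z) ∧
        dist (f^[n] y) (f^[n] z) ≤ Real.exp (η * n) * sphDeriv f^[n] x * dist y z := by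
  induction n with
  | zero => intro x _ y z _ _; simp
  | succ n ih =>
    intro x hx y z hy hz
    have h1 := h x hx y z (hy 0 n.succ_pos) (hz 0 n.succ_pos)
    have h2 := ih (f x) (hinv x hx) (f y) (f z) (fun k hk => hy (k + 1) (by omega))
      (fun k hk => hz (k + 1) (by omega))
    have hn := (hf.iterate n).sphDeriv_nonneg (f x)
    rw [hf.sphDeriv_iterate_succ, Function.iterate_succ_apply, Function.iterate_succ_apply]
    push_cast
    rw [mul_add, mul_one, neg_add, Real.exp_add, Real.exp_add]
    constructor
    · calc _ = Real.exp (-(η * n)) * sphDeriv f^[n] (f x) *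
            (Real.exp (-η) * sphDeriv f x * dist y z) := by ring
        _ ≤ Real.exp (-(η * n)) * sphDeriv f^[n] (f x) * dist (f y) (f z) := by
          gcongr; exact h1.1
        _ ≤ _ := h2.1
    · calc _ ≤ Real.exp (η * n) * sphDeriv f^[n] (f x) * dist (f y) (f z) := h2.2
        _ ≤ Real.exp (η * n) * sphDeriv f^[n] (f x) *
            (Real.exp η * sphDeriv f x * dist y z) := by
          gcongr; exact h1.2
        _ = _ := by ring

lemma ExpandingOn.sphDeriv_iterate_pos {f : RSphere → RSphere} {L : Set RSphere}
    (h : ExpandingOn f L) {x : RSphere} (hx : x ∈ L) (n : ℕ) : 0 < sphDeriv f^[n] x := by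
  obtain ⟨c, hc, l, hl, h⟩ := h
  rcases Nat.eq_zero_or_pos n with rfl | hn
  · rw [Hol.sphDeriv_iterate_zero]; exact one_pos
  · exact lt_of_lt_of_le (by positivity) (h x hx n hn)

/-- Inverse branches shadowing orbits in a hyperbolic set. -/
lemma exists_shadow {f : RSphere → RSphere} (hf : Hol f) {L : Set RSphere} (hLc : IsCompact L)
    (hinv : ∀ x ∈ L, f x ∈ L) (hexp : ExpandingOn f L) {η δ₀ : ℝ} (hη : 0 < η) (hδ₀ : 0 < δ₀) :
    ∃ r > 0, ∀ x ∈ L, ∀ n : ℕ, ∃ w,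
      Branch f w n (ball (f^[n] x) r) (Real.log (sphDeriv f^[n] x) - η * n)
        (Real.log (sphDeriv f^[n] x) + η * n) ∧
      (∀ u ∈ ball (f^[n] x) r, ∀ k < n, dist (f^[k] (w u)) (f^[k] x) < δ₀) ∧
      ∀ u ∈ ball (f^[n] x) r,
        dist (w u) x ≤ Real.exp (-(Real.log (sphDeriv f^[n] x) - η * n)) * r := by
  have hpos := fun x hx n => hexp.sphDeriv_iterate_pos (x := x) hx n
  obtain ⟨c, hc, l, hl, hexp⟩ := hexp
  set η' := min η (Real.log l) with hη'
  have hlog : 0 < Real.log l := Real.log_pos hl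
  have hη'0 : 0 < η' := lt_min hη hlog
  have hel : Real.exp η' ≤ l := by
    rw [← Real.exp_log (zero_lt_one.trans hl)]
    exact Real.exp_le_exp.mpr (min_le_right _ _)
  have hc1 : ∀ x ∈ L, c * l ≤ sphDeriv f x := fun x hx => by simpa using hexp x hx 1 le_rfl
  obtain ⟨δ₁, hδ₁, hdist⟩ := hf.uniform_distortion (mul_pos hc (zero_lt_one.trans hl)) hc1 hη'0
  set δ := min δ₀ δ₁ with hδ
  have hδ0 : 0 < δ := lt_min hδ₀ hδ₁
  replace hdist : ∀ x ∈ L, ∀ y z, dist y x < δ → dist z x < δ →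
      Real.exp (-η') * sphDeriv f x * dist y z ≤ dist (f y) (f z) ∧
        dist (f y) (f z) ≤ Real.exp η' * sphDeriv f x * dist y z := fun x hx y z hy hz =>
    hdist x hx y z (hy.trans_le (min_le_right _ _)) (hz.trans_le (min_le_right _ _))
  obtain ⟨r₁, hr₁, hsurj⟩ := hf.uniform_surj hLc
    (fun x hx => (by simpa using (hpos x hx 1).ne' : sphDeriv f x ≠ 0)) hδ0
  set r := r₁ * min 1 c with hr
  have hr0 : 0 < r := mul_pos hr₁ (lt_min one_pos hc)
  have key : ∀ n : ℕ, ∀ x ∈ L, ∀ u, dist u (f^[n] x) < r →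
      ∃ v, f^[n] v = u ∧ ∀ k < n, dist (f^[k] v) (f^[k] x) < δ := by
    intro n
    induction n with
    | zero => exact fun x hx u hu => ⟨u, rfl, by simp⟩
    | succ n ih =>
      intro x hx u hu
      obtain ⟨v', hv', hk⟩ := ih (f x) (hinv x hx) u hu
      have h1 : dist v' (f x) < r₁ := by
        have h2 := (tracking hf hinv hdist n (f x) (hinv x hx) v' (f x) hk
          (fun k _ => by simpa using hδ0)).1
        rw [hv'] at h2
        rcases Nat.eq_zero_or_pos n with rfl | hn
        · simp at h2
          refine (h2.trans_lt hu).trans_le ?_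
          rw [hr]; exact mul_le_of_le_one_right hr₁.le (min_le_left _ _)
        · have h3 := hexp (f x) (hinv x hx) n hn
          have h4 : c ≤ Real.exp (-(η' * n)) * sphDeriv f^[n] (f x) := by
            rw [Real.exp_neg, le_inv_mul_iff₀ (Real.exp_pos _), mul_comm η', Real.exp_nat_mul]
            refine le_trans ?_ h3
            rw [mul_comm]
            gcongr
          have h5 : c * dist v' (f x) < c * r₁ := by
            calc c * dist v' (f x) ≤ _ := by gcongr
              _ ≤ _ := h2
              _ < _ := hu
              _ ≤ _ := by rw [hr, mul_comm c]; gcongr; exact min_le_right _ _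
          exact lt_of_mul_lt_mul_left h5 hc.le
      obtain ⟨v, hv, hfv⟩ := hsurj x hx v' h1
      refine ⟨v, by rw [Function.iterate_succ_apply, hfv, hv'], fun k hk' => ?_⟩
      rcases k with _ | k
      · exact hv
      · rw [Function.iterate_succ_apply, Function.iterate_succ_apply, hfv]
        exact hk k (by omega)
  refine ⟨r, hr0, fun x hx n => ?_⟩
  have key' : ∀ u, ∃ v, u ∈ ball (f^[n] x) r → f^[n] v = u ∧
      ∀ k < n, dist (f^[k] v) (f^[k] x) < δ := by
    intro u
    by_cases hu : u ∈ ball (f^[n] x) r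
    · obtain ⟨v, hv⟩ := key n x hx u hu
      exact ⟨v, fun _ => hv⟩
    · exact ⟨u, fun h => absurd h hu⟩
  choose w hw using key'
  have hD := hpos x hx n
  have hn : η' * n ≤ η * n := by gcongr; exact min_le_left _ _
  have e1 : Real.exp (-(Real.log (sphDeriv f^[n] x) - η' * n)) =
      (Real.exp (-(η' * n)) * sphDeriv f^[n] x)⁻¹ := by
    rw [Real.exp_neg, sub_eq_add_neg, Real.exp_add, Real.exp_log hD, mul_comm]
  have e2 : Real.exp (-(Real.log (sphDeriv f^[n] x) + η' * n)) =
      (Real.exp (η' * n) * sphDeriv f^[n] x)⁻¹ := by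
    rw [Real.exp_neg, Real.exp_add, Real.exp_log hD, mul_comm]
  refine ⟨w, Branch.weaken (a := Real.log (sphDeriv f^[n] x) - η' * n)
    (b := Real.log (sphDeriv f^[n] x) + η' * n) ⟨fun u hu => (hw u hu).1, fun u hu u' hu' => ?_⟩
      (by linarith) (by linarith),
    fun u hu k hk => ((hw u hu).2 k hk).trans_le (min_le_left _ _), fun u hu => ?_⟩
  · have h2 := tracking hf hinv hdist n x hx (w u) (w u') (hw u hu).2 (hw u' hu').2
    rw [(hw u hu).1, (hw u' hu').1] at h2
    rw [e1, e2, inv_mul_le_iff₀ (by positivity), le_inv_mul_iff₀ (by positivity)]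
    exact ⟨h2.2, h2.1⟩
  · have h2 := (tracking hf hinv hdist n x hx (w u) x (hw u hu).2
      (fun k _ => by simpa using hδ0)).1
    rw [(hw u hu).1] at h2
    calc dist (w u) x ≤ Real.exp (-(Real.log (sphDeriv f^[n] x) - η' * n)) * r := by
          rw [e1, le_inv_mul_iff₀ (by positivity)]
          exact h2.trans (mem_ball.mp hu).le
      _ ≤ _ := by gcongr

/-- The non-critical backward tree of a point. -/
def backTree (f : RSphere → RSphere) (z : RSphere) : Set RSphere :=
  {t | ∃ m : ℕ, f^[m] t = z ∧ sphDeriv f^[m] t ≠ 0}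

lemma backTree_exceptional {f : RSphere → RSphere} (hf : Hol f) {L : Set RSphere}
    (hinv : f '' L = L) (hexp : ExpandingOn f L) {z : RSphere} (hz : z ∈ L)
    (hfin : (backTree f z).Finite) : f ⁻¹' backTree f z \ critSet f = backTree f z := by
  have hpos := fun x hx n => hexp.sphDeriv_iterate_pos (x := x) hx n
  have hfL : ∀ x ∈ L, f x ∈ L := fun x hx => hinv ▸ mem_image_of_mem f hx
  have hback : ∀ n : ℕ, ∃ t ∈ L, f^[n] t = z := by
    intro n
    induction n with
    | zero => exact ⟨z, hz, rfl⟩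
    | succ n ih =>
      obtain ⟨t, ht, htz⟩ := ih
      rw [← hinv] at ht
      obtain ⟨s, hs, rfl⟩ := ht
      exact ⟨s, hs, htz⟩
  have hper : ∃ p : ℕ, f^[p + 1] z = z := by
    have hsel : ∀ x : L, ∃ y : L, f y = x := by
      rintro ⟨x, hx⟩
      rw [← hinv] at hx
      obtain ⟨y, hy, rfl⟩ := hx
      exact ⟨⟨y, hy⟩, rfl⟩
    choose g hg using hsel
    have hgi : ∀ (n k : ℕ), f^[n] (g^[n + k] ⟨z, hz⟩ : L) = (g^[k] ⟨z, hz⟩ : L) := by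
      intro n k
      induction n with
      | zero => simp
      | succ n ih =>
        rw [Function.iterate_succ_apply, show n + 1 + k = n + k + 1 by ring,
          Function.iterate_succ_apply' g, hg, ih]
    have hmem : ∀ n : ℕ, ((g^[n] ⟨z, hz⟩ : L) : RSphere) ∈ backTree f z := fun n =>
      ⟨n, by simpa using hgi n 0, (hpos _ (Subtype.coe_prop _) n).ne'⟩
    obtain ⟨i, -, j, -, hij, heq⟩ := infinite_univ.exists_lt_map_eq_of_mapsTo
      (f := fun n : ℕ => ((g^[n] ⟨z, hz⟩ : L) : RSphere)) (fun n _ => hmem n) hfin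
    obtain ⟨p, rfl⟩ : ∃ p, j = i + (p + 1) := ⟨j - i - 1, by omega⟩
    have h1 := hgi i 0
    have h2 := hgi i (p + 1)
    have h3 := hgi (p + 1) 0
    simp only [add_zero] at h1 h3
    refine ⟨p, ?_⟩
    rw [← heq, h1] at h2
    have h4 : ((g^[0] ⟨z, hz⟩ : L) : RSphere) = z := rfl
    rw [h4] at h2 h3
    rw [← h2] at h3
    exact h3
  ext t
  constructor
  · rintro ⟨⟨m, hm1, hm2⟩, hc⟩
    refine ⟨m + 1, hm1, ?_⟩
    rw [hf.sphDeriv_iterate_succ]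
    exact mul_ne_zero hm2 hc
  · rintro ⟨m, hm1, hm2⟩
    rcases m with _ | m
    · have ht : t = z := hm1
      subst ht
      obtain ⟨p, hp⟩ := hper
      have h1 : sphDeriv f t ≠ 0 := by simpa using (hpos t hz 1).ne'
      exact ⟨⟨p, hp, (hpos _ (hfL t hz) p).ne'⟩, h1⟩
    · rw [hf.sphDeriv_iterate_succ] at hm2
      exact ⟨⟨m, hm1, left_ne_zero_of_mul hm2⟩, right_ne_zero_of_mul hm2⟩

lemma exists_critical_of_sphDeriv_iterate_eq_zero {f : RSphere → RSphere} (hf : Hol f) (n : ℕ) :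
    ∀ w, sphDeriv f^[n] w = 0 → ∃ k < n, sphDeriv f (f^[k] w) = 0 := by
  induction n with
  | zero => intro w h; simp at h
  | succ n ih =>
    intro w h
    rw [hf.sphDeriv_iterate_succ] at h
    rcases mul_eq_zero.mp h with h | h
    · obtain ⟨k, hk, h⟩ := ih _ h
      exact ⟨k + 1, by omega, h⟩
    · exact ⟨0, n.succ_pos, h⟩

lemma finite_orbit_inter_backTree (f : RSphere → RSphere) (z c : RSphere) :
    (range (fun j : ℕ => f^[j] c) ∩ backTree f z).Finite := by
  by_cases hS : {j : ℕ | f^[j] c ∈ backTree f z}.Finite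
  · refine (hS.image (fun j => f^[j] c)).subset ?_
    rintro _ ⟨⟨j, rfl⟩, hj⟩
    exact ⟨j, hj, rfl⟩
  · have hS' : Set.Infinite {j : ℕ | f^[j] c ∈ backTree f z} := hS
    obtain ⟨j, ⟨m, hm, -⟩, -⟩ := hS'.exists_gt 0
    obtain ⟨j', ⟨m', hm', -⟩, hj'⟩ := hS'.exists_gt (m + j)
    rw [← Function.iterate_add_apply] at hm hm'
    set s := m + j
    obtain ⟨p, hp⟩ : ∃ p, m' + j' = p + 1 + s := ⟨m' + j' - s - 1, by omega⟩
    have hper : f^[p + 1] z = z := by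
      rw [hp, Function.iterate_add_apply, hm] at hm'
      exact hm'
    have hfin : (range (fun j : ℕ => f^[j] c)).Finite := by
      refine ((Set.finite_Iio (s + (p + 1))).image (fun j => f^[j] c)).subset ?_
      rintro _ ⟨j, rfl⟩
      by_cases hjs : j < s
      · exact ⟨j, by simp; omega, rfl⟩
      · obtain ⟨i, rfl⟩ : ∃ i, j = i + s := ⟨j - s, by omega⟩
        refine ⟨i % (p + 1) + s, ?_, ?_⟩
        · have := Nat.mod_lt i (show p + 1 > 0 by omega)
          simp only [mem_Iio]; omega
        · have hpp : Function.IsPeriodicPt f (p + 1) z := hper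
          simp only [Function.iterate_add_apply, hm]
          exact hpp.iterate_mod_apply i
    exact hfin.subset inter_subset_left

/-- Points of a hyperbolic set have non-critical preimages in any open set meeting `J`. -/
lemma exists_bridge {f : RSphere → RSphere} (hf : Hol f) (hcrit : (critSet f).Finite)
    (hexc : ¬ IsExceptional f ∨ maxExceptional f ∩ juliaSet f = ∅) {L : Set RSphere}
    (hLJ : L ⊆ juliaSet f) (hinv : f '' L = L) (hexp : ExpandingOn f L) {z : RSphere}
    (hz : z ∈ L) {D : Set RSphere} (hD : IsOpen D) (hDJ : (D ∩ juliaSet f).Nonempty) :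
    ∃ w ∈ D, ∃ m : ℕ, f^[m] w = z ∧ sphDeriv f^[m] w ≠ 0 := by
  have hzT : z ∈ backTree f z := ⟨0, rfl, by simp⟩
  have hinf : (backTree f z).Infinite := by
    intro hfin
    have h := backTree_exceptional hf hinv hexp hz hfin
    rcases hexc with hexc | hexc
    · exact hexc ⟨_, hfin, ⟨z, hzT⟩, h⟩
    · have : z ∈ maxExceptional f ∩ juliaSet f := ⟨⟨_, ⟨hfin, ⟨z, hzT⟩, h⟩, hzT⟩, hLJ hz⟩
      rw [hexc] at this
      exact this
  have hbad : (⋃ c ∈ critSet f, range (fun j : ℕ => f^[j] c) ∩ backTree f z).Finite :=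
    hcrit.biUnion fun c _ => finite_orbit_inter_backTree f z c
  classical
  obtain ⟨t, htT, htcard⟩ := (hinf.sdiff hbad).exists_subset_card_eq 3
  obtain ⟨x, y, y', hxy, hxy', hyy', rfl⟩ := Finset.card_eq_three.mp htcard
  obtain ⟨n, w, hwD, hw⟩ := exists_iterate_eq_of_julia hf hxy hyy' hxy' hD hDJ
  have hgood : f^[n] w ∈ backTree f z \
      ⋃ c ∈ critSet f, range (fun j : ℕ => f^[j] c) ∩ backTree f z := by
    apply htT
    simpa using hw
  obtain ⟨m, hm1, hm2⟩ := hgood.1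
  refine ⟨w, hwD, m + n, by rw [Function.iterate_add_apply, hm1], ?_⟩
  rw [hf.sphDeriv_iterate_add]
  refine mul_ne_zero hm2 fun h => hgood.2 ?_
  obtain ⟨k, hk, hc⟩ := exists_critical_of_sphDeriv_iterate_eq_zero hf n w h
  simp only [mem_iUnion]
  refine ⟨f^[k] w, hc, ⟨n - k, ?_⟩, hgood.1⟩
  simp only [← Function.iterate_add_apply]
  congr 2
  omega

/-- A finite system of inverse branches of `f^[N]` on a ball, with uniform logarithmic expansion
in `[A, B]`, uniformly separated images, and at least `exp H` members. -/
def Sys (f : RSphere → RSphere) (b : RSphere) (ρ : ℝ) (N : ℕ) (A B H : ℝ) : Prop :=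
  ∃ (M : ℕ) (w : Fin M → RSphere → RSphere) (κ : ℝ), 0 < M ∧ 0 < κ ∧
    (∀ i, ∀ u ∈ closedBall b ρ, w i u ∈ ball b ρ) ∧
    (∀ i, Branch f (w i) N (closedBall b ρ) A B) ∧
    (∀ i j, i ≠ j → ∀ u ∈ closedBall b ρ, ∀ u' ∈ closedBall b ρ, κ ≤ dist (w i u) (w j u')) ∧
    H ≤ Real.log M

lemma Sys.of_fintype {f : RSphere → RSphere} {b : RSphere} {ρ : ℝ} {N : ℕ} {A B H : ℝ}
    {ι : Type*} [Fintype ι] [Nonempty ι] (w : ι → RSphere → RSphere) {κ : ℝ} (hκ : 0 < κ)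
    (h1 : ∀ i, ∀ u ∈ closedBall b ρ, w i u ∈ ball b ρ)
    (h2 : ∀ i, Branch f (w i) N (closedBall b ρ) A B)
    (h3 : ∀ i j, i ≠ j → ∀ u ∈ closedBall b ρ, ∀ u' ∈ closedBall b ρ, κ ≤ dist (w i u) (w j u'))
    (h4 : H ≤ Real.log (Fintype.card ι)) : Sys f b ρ N A B H := by
  set e := (Fintype.equivFin ι).symm
  exact ⟨Fintype.card ι, w ∘ e, κ, Fintype.card_pos, hκ, fun i => h1 _, fun i => h2 _,
    fun i j hij => h3 _ _ fun h => hij (e.injective h), h4⟩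

lemma Sys.weaken {f : RSphere → RSphere} {b : RSphere} {ρ : ℝ} {N : ℕ} {A B H A' B' H' : ℝ}
    (h : Sys f b ρ N A B H) (hA : A' ≤ A) (hB : B ≤ B') (hH : H' ≤ H) : Sys f b ρ N A' B' H' := by
  obtain ⟨M, w, κ, hM, hκ, h1, h2, h3, h4⟩ := h
  exact ⟨M, w, κ, hM, hκ, h1, fun i => (h2 i).weaken hA hB, h3, hH.trans h4⟩

lemma Sys.mul {f : RSphere → RSphere} {b : RSphere} {ρ : ℝ} {N N' : ℕ} {A B H A' B' H' : ℝ}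
    (h : Sys f b ρ N A B H) (h' : Sys f b ρ N' A' B' H') :
    Sys f b ρ (N + N') (A + A') (B + B') (H + H') := by
  obtain ⟨M, w, κ, hM, hκ, h1, h2, h3, h4⟩ := h
  obtain ⟨M', w', κ', hM', hκ', h1', h2', h3', h4'⟩ := h'
  have hm : ∀ j, MapsTo (w' j) (closedBall b ρ) (closedBall b ρ) := fun j u hu =>
    ball_subset_closedBall (h1' j u hu)
  have : Nonempty (Fin M) := ⟨⟨0, hM⟩⟩
  have : Nonempty (Fin M') := ⟨⟨0, hM'⟩⟩
  refine Sys.of_fintype (ι := Fin M × Fin M') (fun i => w i.1 ∘ w' i.2)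
    (κ := min κ (Real.exp (-B) * κ')) (lt_min hκ (by positivity)) ?_ ?_ ?_ ?_
  · exact fun i u hu => h1 _ _ (hm _ hu)
  · exact fun i => (h2 _).comp (h2' _) (hm _)
  · rintro ⟨i, i'⟩ ⟨j, j'⟩ hij u hu u' hu'
    by_cases hi : i = j
    · subst hi
      have hi' : i' ≠ j' := fun h => hij (by rw [h])
      refine (min_le_right _ _).trans (le_trans ?_ ((h2 i).2 _ (hm i' hu) _ (hm j' hu')).1)
      gcongr
      exact h3' _ _ hi' u hu u' hu'
    · exact (min_le_left _ _).trans (h3 _ _ hi _ (hm _ hu) _ (hm _ hu'))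
  · rw [Fintype.card_prod, Fintype.card_fin, Fintype.card_fin, Nat.cast_mul,
      Real.log_mul (by positivity) (by positivity)]
    exact add_le_add h4 h4'

lemma Sys.pow {f : RSphere → RSphere} {b : RSphere} {ρ : ℝ} {N : ℕ} {A B H : ℝ}
    (h : Sys f b ρ N A B H) (p : ℕ) :
    Sys f b ρ ((p + 1) * N) ((p + 1) * A) ((p + 1) * B) ((p + 1) * H) := by
  induction p with
  | zero => simpa using h
  | succ p ih =>
    have := ih.mul h
    push_cast
    convert this using 1 <;> ring

lemma finite_preimage_iterate {f : RSphere → RSphere} {B : ℕ}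
    (hB : ∀ y, (f ⁻¹' {y}).Finite ∧ (f ⁻¹' {y}).ncard ≤ B) (n : ℕ) (y : RSphere) :
    ∃ s : Finset RSphere, s.card ≤ B ^ n ∧ ∀ x, f^[n] x = y → x ∈ s := by
  classical
  induction n with
  | zero => exact ⟨{y}, by simp, fun x hx => by simpa using hx⟩
  | succ n ih =>
    obtain ⟨s, hs, h⟩ := ih
    refine ⟨s.biUnion fun z => (hB z).1.toFinset, ?_, fun x hx => ?_⟩
    · rw [pow_succ]
      refine Finset.card_biUnion_le.trans ((Finset.sum_le_card_nsmul _ _ B ?_).trans ?_)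
      · intro z _
        rw [← ncard_eq_toFinset_card _ (hB z).1]
        exact (hB z).2
      · rw [smul_eq_mul]; gcongr
    · rw [Finset.mem_biUnion]
      exact ⟨f x, h _ hx, by simp⟩

lemma Sys.le_mul_log {f : RSphere → RSphere} {b : RSphere} {ρ : ℝ} {N : ℕ} {A B H : ℝ}
    (h : Sys f b ρ N A B H) (hρ : 0 ≤ ρ) {d : ℕ}
    (hd : ∀ y, (f ⁻¹' {y}).Finite ∧ (f ⁻¹' {y}).ncard ≤ d) : H ≤ N * Real.log d := by
  obtain ⟨M, w, κ, hM, hκ, h1, h2, h3, h4⟩ := h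
  obtain ⟨s, hs, hms⟩ := finite_preimage_iterate hd N b
  have hb : b ∈ closedBall b ρ := mem_closedBall_self hρ
  have hcard : M ≤ s.card := by
    have := Finset.card_le_card_of_injOn (s := (Finset.univ : Finset (Fin M))) (t := s)
      (fun i => w i b) (fun i _ => hms _ ((h2 i).1 b hb)) (fun i _ j _ hij => by
        by_contra hne
        have := h3 i j hne b hb b hb
        simp only [] at hij
        rw [hij, dist_self] at this
        linarith)
    simpa using this
  refine h4.trans ?_
  rw [← Real.log_pow]
  apply Real.log_le_log (by exact_mod_cast hM)
  exact_mod_cast hcard.trans hs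

lemma exists_entry {f : RSphere → RSphere} (hf : Hol f) (hcrit : (critSet f).Finite)
    (hexc : ¬ IsExceptional f ∨ maxExceptional f ∩ juliaSet f = ∅) {L₀ : Set RSphere}
    (hLJ₀ : L₀ ⊆ juliaSet f) (hinv₀ : f '' L₀ = L₀) (hexp₀ : ExpandingOn f L₀) {b : RSphere}
    (hb : b ∈ L₀) {L : Set RSphere} (hLJ : L ⊆ juliaSet f) (hLc : IsCompact L) {r : ℝ}
    (hr : 0 < r) :
    ∃ ρ > 0, ∃ (Y : Finset RSphere) (m : RSphere → ℕ) (φ : RSphere → RSphere → RSphere) (C : ℝ),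
      (∀ x ∈ L, ∃ y ∈ Y, ∀ u ∈ closedBall b ρ, dist (φ y u) x < r) ∧
      ∀ y ∈ Y, (m y : ℝ) ≤ C ∧ Branch f (φ y) (m y) (closedBall b ρ) (-C) C := by
  have key : ∀ y, ∃ (m : ℕ) (ρ : ℝ) (φ : RSphere → RSphere) (C : ℝ), y ∈ L → 0 < ρ ∧
      (m : ℝ) ≤ C ∧ Branch f φ m (closedBall b ρ) (-C) C ∧
      ∀ u ∈ closedBall b ρ, dist (φ u) y < r / 2 := by
    intro y
    by_cases hy : y ∈ L
    · obtain ⟨w, hw, m, hm, hd⟩ := exists_bridge hf hcrit hexc hLJ₀ hinv₀ hexp₀ hb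
        (isOpen_ball (x := y) (ε := r / 4)) ⟨y, mem_ball_self (by positivity), hLJ hy⟩
      obtain ⟨ρ, hρ, φ, a, c, hB, hφ⟩ := hf.exists_branch hd (τ := r / 4) (by positivity)
      rw [hm] at hB hφ
      refine ⟨m, ρ, φ, max m (max (-a) c), fun _ => ⟨hρ, le_max_left _ _,
        hB.weaken ?_ ?_, fun u hu => ?_⟩⟩
      · rw [neg_le]; exact (le_max_left _ _).trans (le_max_right _ _)
      · exact (le_max_right _ _).trans (le_max_right _ _)
      · have := dist_triangle (φ u) w y
        have := hφ u hu
        have : dist w y < r / 4 := hw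
        linarith
    · exact ⟨0, 0, id, 0, fun h => absurd h hy⟩
  choose m ρ φ C h using key
  obtain ⟨Y, hYL, hY⟩ := hLc.elim_nhds_subcover (fun y => ball y (r / 2))
    (fun y _ => ball_mem_nhds y (half_pos hr))
  obtain ⟨C', hC'⟩ := (Y.image C).exists_le
  have hρ : ∃ ρ' > 0, ∀ y ∈ Y, ρ' ≤ ρ y := by
    have : ∀ᶠ ρ' in 𝓝[>] (0 : ℝ), ∀ y ∈ Y, ρ' ≤ ρ y := by
      rw [Filter.eventually_all_finset]
      intro y hy
      exact mem_nhdsWithin_of_mem_nhds (Iic_mem_nhds (h y (hYL y hy)).1)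
    obtain ⟨ρ', h1, h2⟩ := (this.and self_mem_nhdsWithin).exists
    exact ⟨ρ', h2, h1⟩
  obtain ⟨ρ', hρ', hρY⟩ := hρ
  refine ⟨ρ', hρ', Y, m, φ, C', fun x hx => ?_, fun y hy => ?_⟩
  · obtain ⟨y, hy, hxy⟩ := mem_iUnion₂.mp (hY hx)
    refine ⟨y, hy, fun u hu => ?_⟩
    have h1 := (h y (hYL y hy)).2.2.2 u (closedBall_subset_closedBall (hρY y hy) hu)
    have := dist_triangle_right (φ y u) x y
    have : dist x y < r / 2 := hxy
    linarith
  · have hC := hC' (C y) (Finset.mem_image_of_mem C hy)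
    obtain ⟨-, h1, h2, -⟩ := h y (hYL y hy)
    exact ⟨h1.trans hC, (h2.mono (closedBall_subset_closedBall (hρY y hy))).weaken
      (neg_le_neg hC) hC⟩

lemma exists_exit {f : RSphere → RSphere} (hf : Hol f) (hcrit : (critSet f).Finite)
    (hexc : ¬ IsExceptional f ∨ maxExceptional f ∩ juliaSet f = ∅) {L : Set RSphere}
    (hLJ : L ⊆ juliaSet f) (hLc : IsCompact L) (hinv : f '' L = L) (hexp : ExpandingOn f L)
    {b : RSphere} (hb : b ∈ juliaSet f) {ρ : ℝ} (hρ : 0 < ρ) :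
    ∃ τ > 0, ∃ (Z : Finset RSphere) (m : RSphere → ℕ) (ψ : RSphere → RSphere → RSphere) (C : ℝ),
      (∀ x ∈ L, ∃ z ∈ Z, Branch f (ψ z) (m z) (closedBall x τ) (-C) C ∧
        ∀ u ∈ closedBall x τ, ψ z u ∈ ball b ρ) ∧ ∀ z ∈ Z, (m z : ℝ) ≤ C := by
  have key : ∀ z, ∃ (m : ℕ) (τ : ℝ) (ψ : RSphere → RSphere) (C : ℝ), z ∈ L → 0 < τ ∧
      (m : ℝ) ≤ C ∧ Branch f ψ m (closedBall z τ) (-C) C ∧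
      ∀ u ∈ closedBall z τ, ψ u ∈ ball b ρ := by
    intro z
    by_cases hz : z ∈ L
    · obtain ⟨w, hw, m, hm, hd⟩ := exists_bridge hf hcrit hexc hLJ hinv hexp hz
        (isOpen_ball (x := b) (ε := ρ)) ⟨b, mem_ball_self hρ, hb⟩
      obtain ⟨σ, hσ, hσ'⟩ := Metric.mem_nhds_iff.mp (isOpen_ball.mem_nhds hw)
      obtain ⟨τ, hτ, ψ, a, c, hB, hψ⟩ := hf.exists_branch hd hσ
      rw [hm] at hB hψ
      refine ⟨m, τ, ψ, max m (max (-a) c), fun _ => ⟨hτ, le_max_left _ _,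
        hB.weaken ?_ ?_, fun u hu => hσ' (hψ u hu)⟩⟩
      · rw [neg_le]; exact (le_max_left _ _).trans (le_max_right _ _)
      · exact (le_max_right _ _).trans (le_max_right _ _)
    · exact ⟨0, 0, id, 0, fun h => absurd h hz⟩
  choose m τ ψ C h using key
  obtain ⟨Z, hZL, hZ⟩ := hLc.elim_nhds_subcover (fun z => ball z (τ z / 2))
    (fun z hz => ball_mem_nhds z (half_pos (h z hz).1))
  obtain ⟨C', hC'⟩ := (Z.image C).exists_le
  have hτ : ∃ τ' > 0, ∀ z ∈ Z, τ' ≤ τ z / 2 := by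
    have : ∀ᶠ τ' in 𝓝[>] (0 : ℝ), ∀ z ∈ Z, τ' ≤ τ z / 2 := by
      rw [Filter.eventually_all_finset]
      intro z hz
      exact mem_nhdsWithin_of_mem_nhds (Iic_mem_nhds (half_pos (h z (hZL z hz)).1))
    obtain ⟨τ', h1, h2⟩ := (this.and self_mem_nhdsWithin).exists
    exact ⟨τ', h2, h1⟩
  obtain ⟨τ', hτ', hτZ⟩ := hτ
  refine ⟨τ', hτ', Z, m, ψ, C', fun x hx => ?_, fun z hz => ?_⟩
  · obtain ⟨z, hz, hxz⟩ := mem_iUnion₂.mp (hZ hx)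
    have hsub : closedBall x τ' ⊆ closedBall z (τ z) := by
      apply closedBall_subset_closedBall'
      have := hτZ z hz
      have : dist x z < τ z / 2 := hxz
      linarith
    have hC := hC' (C z) (Finset.mem_image_of_mem C hz)
    obtain ⟨-, h1, h2, h3⟩ := h z (hZL z hz)
    exact ⟨z, hz, (h2.mono hsub).weaken (neg_le_neg hC) hC, fun u hu => h3 u (hsub hu)⟩
  · exact (h z (hZL z hz)).2.1.trans (hC' (C z) (Finset.mem_image_of_mem C hz))

lemma birkhoff_geometric {f : RSphere → RSphere} (hf : Hol f) {L : Set RSphere}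
    (hinv : ∀ x ∈ L, f x ∈ L) (hexp : ExpandingOn f L) (d : ℝ) (m : ℕ) :
    ∀ x ∈ L, birkhoff f (fun x => -d * Real.log (sphDeriv f x)) m x =
      -d * Real.log (sphDeriv f^[m] x) := by
  intro x hx
  unfold birkhoff
  induction m with
  | zero => simp
  | succ m ih =>
    rw [Finset.sum_range_succ, ih, add_comm m 1, hf.sphDeriv_iterate_add,
      Real.log_mul _ (hexp.sphDeriv_iterate_pos hx m).ne']
    · simp only [Function.iterate_one]; ring
    · exact (hexp.sphDeriv_iterate_pos (iterate_mem_of_mapsTo hinv m hx) 1).ne'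

lemma ExpandingOn.abs_log_le {f : RSphere → RSphere} (hf : Hol f) {L : Set RSphere}
    (hexp : ExpandingOn f L) : ∃ C, ∀ x ∈ L, |Real.log (sphDeriv f x)| ≤ C := by
  have hpos := fun x hx => hexp.sphDeriv_iterate_pos (x := x) hx 1
  obtain ⟨c, hc, l, hl, h⟩ := hexp
  obtain ⟨K, hK, -, hKd⟩ := hf.exists_lipschitz
  refine ⟨max (-Real.log (c * l)) (Real.log K), fun x hx => abs_le.mpr ⟨?_, ?_⟩⟩
  · have h1 := h x hx 1 le_rfl
    rw [pow_one, Function.iterate_one] at h1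
    have := Real.log_le_log (by positivity) h1
    have := le_max_left (-Real.log (c * l)) (Real.log K)
    linarith
  · exact (Real.log_le_log (by simpa using hpos x hx) (hKd x)).trans (le_max_right _ _)

lemma exists_sep_of_lt_pressureOn {f : RSphere → RSphere} (hf : Hol f) {L : Set RSphere}
    (hne : L.Nonempty) (hinv : ∀ x ∈ L, f x ∈ L) (hexp : ExpandingOn f L) {d t : ℝ}
    (ht : t < pressureOn f L fun x => -d * Real.log (sphDeriv f x)) :
    ∃ ε > 0, ∃ᶠ m : ℕ in atTop, ∃ E, IsSepSet f L m ε E ∧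
      Real.exp (t * m) < ∑ x ∈ E, Real.exp (-d * Real.log (sphDeriv f^[m] x)) := by
  have : Nonempty {ε : ℝ // 0 < ε} := ⟨⟨1, one_pos⟩⟩
  obtain ⟨⟨ε, hε⟩, ht⟩ := exists_lt_of_lt_ciSup ht
  refine ⟨ε, hε, ?_⟩
  obtain ⟨C, hC⟩ := hexp.abs_log_le hf
  have hC0 : 0 ≤ C := by
    obtain ⟨x, hx⟩ := hne
    exact (abs_nonneg _).trans (hC x hx)
  have hlow : ∀ m x, x ∈ L → -(|d| * C * m) ≤
      birkhoff f (fun x => -d * Real.log (sphDeriv f x)) m x := by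
    intro m x hx
    have : ∑ k ∈ Finset.range m, -(|d| * C) ≤
        birkhoff f (fun x => -d * Real.log (sphDeriv f x)) m x := by
      refine Finset.sum_le_sum fun k _ => ?_
      have h1 := hC _ (iterate_mem_of_mapsTo hinv k hx)
      have h2 := neg_abs_le (-d * Real.log (sphDeriv f (f^[k] x)))
      rw [abs_mul, abs_neg] at h2
      have : |d| * |Real.log (sphDeriv f (f^[k] x))| ≤ |d| * C := by gcongr
      linarith
    refine le_trans (le_of_eq ?_) this
    simp; ring
  have hcob : IsCoboundedUnder (· ≤ ·) atTop (fun m : ℕ =>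
      Real.log (⨆ E : {E : Finset RSphere // IsSepSet f L m ε E},
      ∑ x ∈ E.1, Real.exp (birkhoff f (fun x => -d * Real.log (sphDeriv f x)) m x)) / m) := by
    refine IsBoundedUnder.isCoboundedUnder_le ⟨-(|d| * C), ?_⟩
    rw [eventually_map]
    filter_upwards [eventually_gt_atTop 0] with m hm
    have hm' : (0 : ℝ) < m := by exact_mod_cast hm
    show -(|d| * C) ≤ _
    rw [le_div_iff₀ hm']
    by_cases hbdd : BddAbove (range fun E : {E : Finset RSphere // IsSepSet f L m ε E} =>
        ∑ x ∈ E.1, Real.exp (birkhoff f (fun x => -d * Real.log (sphDeriv f x)) m x))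
    · obtain ⟨x, hx⟩ := hne
      have h1 := le_ciSup hbdd ⟨{x}, by
        refine ⟨by simpa using hx, fun y hy z hz hyz => ?_⟩
        rw [Finset.mem_singleton] at hy hz
        exact absurd (hy.trans hz.symm) hyz⟩
      simp only [Finset.sum_singleton] at h1
      have h2 := Real.log_le_log (Real.exp_pos _) h1
      rw [Real.log_exp] at h2
      have := hlow m x hx
      linarith
    · rw [Real.iSup_of_not_bddAbove hbdd, Real.log_zero]
      have : 0 ≤ |d| * C * m := by positivity
      linarith
  have hfreq := frequently_lt_of_lt_limsup hcob ht
  refine (hfreq.and_eventually (eventually_gt_atTop 0)).mono ?_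
  rintro m ⟨hm, hm0⟩
  have hm' : (0 : ℝ) < m := by exact_mod_cast hm0
  have hsum : ∀ E : Finset RSphere, IsSepSet f L m ε E →
      ∑ x ∈ E, Real.exp (birkhoff f (fun x => -d * Real.log (sphDeriv f x)) m x) =
        ∑ x ∈ E, Real.exp (-d * Real.log (sphDeriv f^[m] x)) := fun E hE =>
    Finset.sum_congr rfl fun x hx => by rw [birkhoff_geometric hf hinv hexp d m x (hE.1 hx)]
  by_contra! hcon
  have hle : ∀ E : {E : Finset RSphere // IsSepSet f L m ε E},
      ∑ x ∈ E.1, Real.exp (birkhoff f (fun x => -d * Real.log (sphDeriv f x)) m x) ≤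
        Real.exp (t * m) := fun E => by rw [hsum _ E.2]; exact hcon _ E.2
  have : Nonempty {E : Finset RSphere // IsSepSet f L m ε E} :=
    ⟨⟨∅, by simp [IsSepSet]⟩⟩
  have hbdd : BddAbove (range fun E : {E : Finset RSphere // IsSepSet f L m ε E} =>
      ∑ x ∈ E.1, Real.exp (birkhoff f (fun x => -d * Real.log (sphDeriv f x)) m x)) :=
    ⟨_, by rintro _ ⟨E, rfl⟩; exact hle E⟩
  have h1 := ciSup_le hle
  have h2 : 0 < ⨆ E : {E : Finset RSphere // IsSepSet f L m ε E},
      ∑ x ∈ E.1, Real.exp (birkhoff f (fun x => -d * Real.log (sphDeriv f x)) m x) := by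
    obtain ⟨x, hx⟩ := hne
    refine lt_of_lt_of_le ?_ (le_ciSup hbdd ⟨{x}, by
        refine ⟨by simpa using hx, fun y hy z hz hyz => ?_⟩
        rw [Finset.mem_singleton] at hy hz
        exact absurd (hy.trans hz.symm) hyz⟩)
    simp only [Finset.sum_singleton]
    exact Real.exp_pos _
  have h3 := Real.log_le_log h2 h1
  rw [Real.log_exp] at h3
  rw [lt_div_iff₀ hm'] at hm
  linarith

/-- Assemble a system from shadowing branches along a separated set, entered and left by fixed
connecting branches. -/
lemma Sys.of_sep {f : RSphere → RSphere} {b : RSphere} {ρ ρ₀ r τ K ε C C' lo hi H : ℝ}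
    (hK : 1 < K) (hKf : ∀ x y, dist (f x) (f y) ≤ K * dist x y) (hε : 0 < ε) (hρ : ρ ≤ ρ₀)
    {n m m' : ℕ} {φ ψ : RSphere → RSphere} {w : RSphere → RSphere → RSphere} {E : Finset RSphere}
    (hE : E.Nonempty)
    (hsep : ∀ x ∈ E, ∀ y ∈ E, x ≠ y → ∃ k < n, ε ≤ dist (f^[k] x) (f^[k] y))
    (hφ : Branch f φ m (closedBall b ρ₀) (-C) C)
    (hφr : ∀ x ∈ E, ∀ u ∈ closedBall b ρ₀, dist (φ u) (f^[n] x) < r)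
    (hw : ∀ x ∈ E, Branch f (w x) n (ball (f^[n] x) r) lo hi)
    (hwε : ∀ x ∈ E, ∀ u ∈ ball (f^[n] x) r, ∀ k < n, dist (f^[k] (w x u)) (f^[k] x) < ε / 3)
    (hwτ : ∀ x ∈ E, ∀ u ∈ ball (f^[n] x) r, dist (w x u) x ≤ τ)
    (hψ : ∀ x ∈ E, Branch f ψ m' (closedBall x τ) (-C') C')
    (hψb : ∀ x ∈ E, ∀ u ∈ closedBall x τ, ψ u ∈ ball b ρ)
    (hH : H ≤ Real.log E.card) :
    Sys f b ρ (m' + (n + m)) (lo - C - C') (hi + C + C') H := by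
  have : Nonempty E := hE.to_subtype
  have hsub : closedBall b ρ ⊆ closedBall b ρ₀ := closedBall_subset_closedBall hρ
  have hm1 : ∀ x ∈ E, MapsTo φ (closedBall b ρ) (ball (f^[n] x) r) := fun x hx u hu =>
    hφr x hx u (hsub hu)
  have hm2 : ∀ x ∈ E, MapsTo (w x ∘ φ) (closedBall b ρ) (closedBall x τ) := fun x hx u hu =>
    hwτ x hx _ (hm1 x hx hu)
  refine Sys.of_fintype (ι := E) (fun x => ψ ∘ (w x ∘ φ)) (κ := ε / 3 / K ^ (m' + n))
    (by positivity) ?_ ?_ ?_ ?_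
  · exact fun x u hu => hψb x x.2 _ (hm2 x x.2 hu)
  · intro x
    refine ((hψ x x.2).comp ((hw x x.2).comp (hφ.mono hsub) (hm1 x x.2)) (hm2 x x.2)).weaken ?_ ?_
      <;> linarith
  · rintro ⟨x, hx⟩ ⟨y, hy⟩ hxy u hu v hv
    obtain ⟨k, hk, hd⟩ := hsep x hx y hy fun h => hxy (by simpa using h)
    have e : ∀ z ∈ E, ∀ u ∈ closedBall b ρ,
        f^[k + m'] (ψ (w z (φ u))) = f^[k] (w z (φ u)) := by
      intro z hz u hu
      rw [Function.iterate_add_apply, (hψ z hz).1 (w z (φ u)) (hm2 z hz hu)]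
    have h1 := Hol.dist_iterate_le hK hKf (k + m') (ψ (w x (φ u))) (ψ (w y (φ v)))
    rw [e x hx u hu, e y hy v hv] at h1
    have h2 := hwε x hx _ (hm1 x hx hu) k hk
    have h3 := hwε y hy _ (hm1 y hy hv) k hk
    have h4 := dist_triangle4 (f^[k] x) (f^[k] (w x (φ u))) (f^[k] (w y (φ v))) (f^[k] y)
    rw [dist_comm (f^[k] x) (f^[k] (w x (φ u)))] at h4
    have h5 : K ^ (k + m') ≤ K ^ (m' + n) := pow_le_pow_right₀ hK.le (by omega)
    rw [div_le_iff₀ (by positivity)]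
    simp only [Function.comp]
    have h6 : ε / 3 ≤ dist (f^[k] (w x (φ u))) (f^[k] (w y (φ v))) := by linarith
    refine h6.trans (h1.trans ?_)
    rw [mul_comm]
    gcongr
  · simpa using hH

lemma sys_numerics {n N χ s t d κ η : ℝ} (hn : 0 < n) (hs : 0 < s)
    (hsη : s * (4 + κ + |d| + |t| + |d| * κ) ≤ η)
    (hN1 : n ≤ N) (hN2 : N ≤ n + s * n) (hχ0 : 0 ≤ χ) (hχ : χ ≤ κ) :
    |(n * χ - 2 * s * n) - N * χ| ≤ η * N ∧ |(n * χ + 3 * s * n) - N * χ| ≤ η * N ∧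
      N * (t + d * χ - η) ≤ n * (t + d * χ - (1 + |d|) * s) := by
  have hκ : 0 ≤ κ := hχ0.trans hχ
  have hd := abs_nonneg d
  have ht := abs_nonneg t
  have hdk : 0 ≤ |d| * κ := by positivity
  have hη : 0 ≤ η := le_trans (by positivity) hsη
  have h1 : s * (4 + κ + |d| + |t| + |d| * κ) * n ≤ η * N := by gcongr
  have h2 : (N - n) * χ ≤ s * n * κ := by
    have : N - n ≤ s * n := by linarith
    gcongr
  have h3 : 0 ≤ (N - n) * χ := mul_nonneg (by linarith) hχ0
  have hsn : 0 < s * n := by positivity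
  have e1 : s * (4 + κ + |d| + |t| + |d| * κ) * n =
      4 * (s * n) + s * n * κ + s * n * |d| + s * n * |t| + s * n * (|d| * κ) := by ring
  have p1 : 0 ≤ s * n * κ := by positivity
  have p2 : 0 ≤ s * n * |d| := by positivity
  have p3 : 0 ≤ s * n * |t| := by positivity
  have p4 : 0 ≤ s * n * (|d| * κ) := by positivity
  refine ⟨abs_le.mpr ⟨by nlinarith, by nlinarith⟩, abs_le.mpr ⟨by nlinarith, by nlinarith⟩, ?_⟩
  have h4 : t + d * χ ≤ |t| + |d| * κ := by
    have : d * χ ≤ |d| * κ := (mul_le_mul_of_nonneg_right (le_abs_self d) hχ0).trans (by gcongr)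
    linarith [le_abs_self t]
  have h5 : (N - n) * (t + d * χ) ≤ s * n * (|t| + |d| * κ) := by
    calc _ ≤ (N - n) * (|t| + |d| * κ) := by
          apply mul_le_mul_of_nonneg_left h4; linarith
      _ ≤ _ := by gcongr; linarith
  nlinarith

lemma exists_fiber_sum {α ι : Type*} [DecidableEq ι] {E : Finset α} {T : Finset ι} {g : α → ι}
    (hg : ∀ x ∈ E, g x ∈ T) {F : α → ℝ} {t s n : ℝ} (hT : (T.card : ℝ) ≤ Real.exp (s * n))
    (hsum : Real.exp (t * n) < ∑ x ∈ E, F x) :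
    ∃ c ∈ T, Real.exp ((t - s) * n) < ∑ x ∈ E with g x = c, F x := by
  refine Finset.exists_lt_sum_fiber_of_maps_to_of_nsmul_lt_sum hg ?_
  refine lt_of_le_of_lt ?_ hsum
  rw [nsmul_eq_mul]
  calc (T.card : ℝ) * Real.exp ((t - s) * n) ≤ Real.exp (s * n) * Real.exp ((t - s) * n) := by
        gcongr
    _ = _ := by rw [← Real.exp_add]; ring_nf

/-- **Katok-type approximation**: the pressure on a hyperbolic set is realised by systems of
inverse branches near any fixed base point lying in a hyperbolic set. -/
lemma exists_sys_of_lt_pressureOn {f : RSphere → RSphere} (hf : Hol f)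
    (hcrit : (critSet f).Finite)
    (hexc : ¬ IsExceptional f ∨ maxExceptional f ∩ juliaSet f = ∅) {L₀ : Set RSphere}
    (hLJ₀ : L₀ ⊆ juliaSet f) (hinv₀ : f '' L₀ = L₀) (hexp₀ : ExpandingOn f L₀) {b : RSphere}
    (hb : b ∈ L₀) {K : ℝ} (hK : 1 < K) (hKf : ∀ x y, dist (f x) (f y) ≤ K * dist x y)
    (hKd : ∀ x, sphDeriv f x ≤ K) {L : Set RSphere} (hne : L.Nonempty)
    (hLJ : L ⊆ juliaSet f) (hLc : IsCompact L) (hinv : f '' L = L) (hexp : ExpandingOn f L)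
    {d t η : ℝ} (ht : t < pressureOn f L fun x => -d * Real.log (sphDeriv f x)) (hη : 0 < η) :
    ∃ ρ₀ > 0, ∀ ρ, 0 < ρ → ρ ≤ ρ₀ → ∃ (N : ℕ) (A B χ H : ℝ), 0 < N ∧ Sys f b ρ N A B H ∧
      |A - N * χ| ≤ η * N ∧ |B - N * χ| ≤ η * N ∧ N * (t + d * χ - η) ≤ H ∧ 0 < A ∧
      0 ≤ χ ∧ χ ≤ Real.log K := by
  classical
  have hmaps : ∀ x ∈ L, f x ∈ L := fun x hx => hinv ▸ mem_image_of_mem f hx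
  obtain ⟨ε, hε, hfreq⟩ := exists_sep_of_lt_pressureOn hf hne hmaps hexp ht
  have hpos := fun x hx n => hexp.sphDeriv_iterate_pos (x := x) hx n
  have hexp' := hexp
  obtain ⟨c, hc, l, hl, hcl⟩ := hexp'
  have hlogl : 0 < Real.log l := Real.log_pos hl
  set κ := Real.log K with hκ
  have hκ0 : 0 < κ := Real.log_pos hK
  set P := 4 + κ + |d| + |t| + |d| * κ with hP
  have hP0 : 0 < P := by positivity
  set s := min (Real.log l / 4) (η / P) with hs
  have hs0 : 0 < s := lt_min (by positivity) (by positivity)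
  have hsl : s ≤ Real.log l / 4 := min_le_left _ _
  have hsP : s * P ≤ η := by
    rw [← le_div_iff₀ hP0]; exact min_le_right _ _
  obtain ⟨r, hr, hshadow⟩ := exists_shadow hf hLc hmaps hexp hs0 (δ₀ := ε / 3) (by positivity)
  obtain ⟨ρ₀, hρ₀, Y, m, φ, C, hY, hφ⟩ := exists_entry hf hcrit hexc hLJ₀ hinv₀ hexp₀ hb hLJ hLc
    (half_pos hr)
  refine ⟨ρ₀, hρ₀, fun ρ hρ hρle => ?_⟩
  obtain ⟨τ, hτ, Z, m', ψ, C', hZ, hψ⟩ := exists_exit hf hcrit hexc hLJ hLc hinv hexp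
    (hLJ₀ hb) hρ
  -- largeness of `n`
  have hcast : Tendsto (fun n : ℕ => (n : ℝ)) atTop atTop := tendsto_natCast_atTop_atTop
  set bins := Finset.range (⌊κ / s⌋₊ + 1) with hbins
  have ev1 : ∀ᶠ n : ℕ in atTop, |C| + |C'| ≤ s * n :=
    (hcast.const_mul_atTop hs0).eventually_ge_atTop _
  have ev2 : ∀ᶠ n : ℕ in atTop, ((Y ×ˢ (Z ×ˢ bins)).card : ℝ) ≤ Real.exp (s * n) :=
    (Real.tendsto_exp_atTop.comp (hcast.const_mul_atTop hs0)).eventually_ge_atTop _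
  have ev3 : ∀ᶠ n : ℕ in atTop, -Real.log c < Real.log l / 4 * n :=
    (hcast.const_mul_atTop (by positivity : 0 < Real.log l / 4)).eventually_gt_atTop _
  have ev4 : ∀ᶠ n : ℕ in atTop, Real.exp (-(Real.log l / 4 * n)) * r ≤ τ := by
    have h1 : Tendsto (fun n : ℕ => Real.exp (-(Real.log l / 4 * n)) * r) atTop (𝓝 (0 * r)) :=
      (Real.tendsto_exp_atBot.comp (tendsto_neg_atTop_atBot.comp
        (hcast.const_mul_atTop (by positivity : 0 < Real.log l / 4)))).mul_const r
    rw [zero_mul] at h1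
    exact h1.eventually_le_const hτ
  obtain ⟨n, ⟨E, hE, hsum⟩, ⟨h1, h2, h3, h4⟩, hn⟩ := (hfreq.and_eventually
    ((ev1.and (ev2.and (ev3.and ev4))).and (eventually_gt_atTop 0))).exists
  have hn' : (0 : ℝ) < n := by exact_mod_cast hn
  have hlow : ∀ x ∈ L, Real.log l * (3 / 4) * n < Real.log (sphDeriv f^[n] x) := by
    intro x hx
    have := Real.log_le_log (by positivity) (hcl x hx n hn)
    rw [Real.log_mul hc.ne' (by positivity), Real.log_pow] at this
    linarith
  have hup : ∀ x ∈ L, Real.log (sphDeriv f^[n] x) ≤ n * κ := by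
    intro x hx
    rw [hκ, ← Real.log_pow]
    exact Real.log_le_log (hpos x hx n) (hf.sphDeriv_iterate_le hKd n x)
  choose! w hw1 hw2 hw3 using fun x (hx : x ∈ L) => hshadow x hx n
  choose! y hy1 hy2 using hY
  choose! z hz1 hz2 hz3 using hZ
  set g : RSphere → RSphere × (RSphere × ℕ) := fun x =>
    (y (f^[n] x), (z x, ⌊Real.log (sphDeriv f^[n] x) / (s * n)⌋₊)) with hg
  have hEL : ∀ x ∈ E, x ∈ L := fun x hx => hE.1 hx
  have hgT : ∀ x ∈ E, g x ∈ Y ×ˢ (Z ×ˢ bins) := by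
    intro x hx
    have hxL := hEL x hx
    simp only [hg, Finset.mem_product]
    refine ⟨hy1 _ (iterate_mem_of_mapsTo hmaps n hxL), hz1 _ hxL, ?_⟩
    rw [hbins, Finset.mem_range, Nat.lt_succ_iff]
    apply Nat.floor_mono
    rw [div_le_div_iff₀ (by positivity) hs0]
    have := hup x hxL
    nlinarith
  obtain ⟨⟨y₀, z₀, i⟩, hcT, hsum'⟩ := exists_fiber_sum hgT h2 hsum
  set E' := E.filter fun x => g x = (y₀, z₀, i) with hE'
  have hmem : ∀ x ∈ E', x ∈ E ∧ y (f^[n] x) = y₀ ∧ z x = z₀ ∧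
      s * n * i ≤ Real.log (sphDeriv f^[n] x) ∧
      Real.log (sphDeriv f^[n] x) ≤ s * n * i + s * n := by
    intro x hx
    rw [hE', Finset.mem_filter] at hx
    obtain ⟨hx, hgx⟩ := hx
    simp only [hg, Prod.mk.injEq] at hgx
    obtain ⟨e1, e2, e3⟩ := hgx
    have hsn : 0 < s * n := by positivity
    have hnn : 0 ≤ Real.log (sphDeriv f^[n] x) / (s * n) := by
      have := hlow x (hEL x hx)
      have : 0 < Real.log (sphDeriv f^[n] x) := lt_trans (by positivity) this
      positivity
    refine ⟨hx, e1, e2, ?_, ?_⟩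
    · have := Nat.floor_le hnn
      rw [e3, le_div_iff₀ hsn] at this
      linarith
    · have := Nat.lt_floor_add_one (Real.log (sphDeriv f^[n] x) / (s * n))
      rw [e3, div_lt_iff₀ hsn] at this
      linarith
  have hE'ne : E'.Nonempty := by
    rw [Finset.nonempty_iff_ne_empty]
    intro h0
    rw [h0, Finset.sum_empty] at hsum'
    exact absurd hsum' (not_lt.mpr (Real.exp_pos _).le)
  set χ := s * i with hχ
  have hχ0 : 0 ≤ χ := by positivity
  obtain ⟨x₀, hx₀⟩ := hE'ne
  have hχκ : χ ≤ κ := by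
    obtain ⟨q1, -, -, q2, -⟩ := hmem x₀ hx₀
    have := hup x₀ (hEL x₀ q1)
    have : n * χ ≤ n * κ := by rw [hχ]; linarith
    exact le_of_mul_le_mul_left this hn'
  have hy₀ : y₀ ∈ Y := (Finset.mem_product.mp hcT).1
  have hz₀ : z₀ ∈ Z := (Finset.mem_product.mp (Finset.mem_product.mp hcT).2).1
  have hC : (m y₀ : ℝ) + m' z₀ ≤ s * n := by
    have := (hφ y₀ hy₀).1
    have := hψ z₀ hz₀
    have := le_abs_self C
    have := le_abs_self C'
    linarith
  set N := m' z₀ + (n + m y₀) with hN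
  have hNr : (N : ℝ) = m' z₀ + (n + m y₀) := by rw [hN]; push_cast; ring
  have hmn : (0 : ℝ) ≤ m y₀ := Nat.cast_nonneg _
  have hmn' : (0 : ℝ) ≤ m' z₀ := Nat.cast_nonneg _
  obtain ⟨n1, n2, n3⟩ := sys_numerics (N := N) (χ := χ) (t := t) (d := d) hn' hs0 hsP
    (by linarith) (by linarith) hχ0 hχκ
  have hcard : n * (t + d * χ - (1 + |d|) * s) ≤ Real.log E'.card := by
    have hle : ∑ x ∈ E', Real.exp (-d * Real.log (sphDeriv f^[n] x)) ≤
        E'.card * Real.exp (-d * (n * χ) + |d| * (s * n)) := by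
      rw [← nsmul_eq_mul]
      refine Finset.sum_le_card_nsmul _ _ _ fun x hx => ?_
      obtain ⟨-, -, -, q1, q2⟩ := hmem x hx
      rw [Real.exp_le_exp]
      have e : -d * Real.log (sphDeriv f^[n] x) =
          -d * (n * χ) + -d * (Real.log (sphDeriv f^[n] x) - n * χ) := by ring
      rw [e]
      have hb : 0 ≤ Real.log (sphDeriv f^[n] x) - n * χ := by rw [hχ]; linarith
      have hb' : Real.log (sphDeriv f^[n] x) - n * χ ≤ s * n := by rw [hχ]; linarith
      have : -d * (Real.log (sphDeriv f^[n] x) - n * χ) ≤ |d| * (s * n) :=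
        (mul_le_mul_of_nonneg_right (neg_le_abs d) hb).trans (by gcongr)
      linarith
    have hcpos : (0 : ℝ) < E'.card := by exact_mod_cast Finset.card_pos.mpr ⟨x₀, hx₀⟩
    have := Real.log_le_log (Real.exp_pos _) (hsum'.le.trans hle)
    rw [Real.log_exp, Real.log_mul hcpos.ne' (Real.exp_pos _).ne', Real.log_exp] at this
    linarith
  refine ⟨N, n * χ - 2 * s * n, n * χ + 3 * s * n, χ, n * (t + d * χ - (1 + |d|) * s), by omega,
    ?_, n1, n2, n3, ?_, hχ0, hχκ⟩
  · have hsys := Sys.of_sep (f := f) (b := b) (ρ := ρ) (ρ₀ := ρ₀) (r := r) (τ := τ) (K := K)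
      (ε := ε) (C := C) (C' := C') (lo := n * χ - s * n) (hi := n * χ + 2 * s * n)
      (H := n * (t + d * χ - (1 + |d|) * s)) (n := n) (m := m y₀) (m' := m' z₀)
      (φ := φ y₀) (ψ := ψ z₀) (w := w) (E := E') hK hKf hε hρle ⟨x₀, hx₀⟩
      (fun x hx x' hx' hxx' => hE.2 x (hmem x hx).1 x' (hmem x' hx').1 hxx') (hφ y₀ hy₀).2
      ?_ ?_ ?_ ?_ ?_ ?_ hcard
    · have := le_abs_self C
      have := le_abs_self C'
      exact hsys.weaken (by linarith) (by linarith) le_rfl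
    · intro x hx u hu
      obtain ⟨q1, q2, q3, -, -⟩ := hmem x hx
      have := hy2 (f^[n] x) (iterate_mem_of_mapsTo hmaps n (hEL x q1)) u hu
      rw [q2] at this
      linarith
    · intro x hx
      obtain ⟨q1, q2, q3, q4, q5⟩ := hmem x hx
      refine (hw1 x (hEL x q1)).weaken ?_ ?_
      · rw [hχ]; linarith
      · rw [hχ]; linarith
    · exact fun x hx => hw2 x (hEL x (hmem x hx).1)
    · intro x hx u hu
      have hxL := hEL x (hmem x hx).1
      refine (hw3 x hxL u hu).trans (le_trans ?_ h4)
      gcongr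
      have := hlow x hxL
      have : s * n ≤ Real.log l / 4 * n := by gcongr
      linarith
    · intro x hx
      obtain ⟨q1, q2, q3, -, -⟩ := hmem x hx
      have := hz2 x (hEL x q1)
      rwa [q3] at this
    · intro x hx
      obtain ⟨q1, q2, q3, -, -⟩ := hmem x hx
      have := hz3 x (hEL x q1)
      rwa [q3] at this
  · obtain ⟨q1, q2, q3, q4, q5⟩ := hmem x₀ hx₀
    have h5 := hlow x₀ (hEL x₀ q1)
    have : s * n ≤ Real.log l / 4 * n := by gcongr
    have : n * χ = s * n * i := by rw [hχ]; ring
    have : Real.log (sphDeriv f^[n] x₀) ≤ n * χ + s * n := by linarith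
    have : 0 < s * n := by positivity
    linarith

/-- There is a system near `b` with expansion rate `χ` up to `η` and entropy rate at least `h`. -/
def HasRate (f : RSphere → RSphere) (b : RSphere) (ρ η χ h : ℝ) : Prop :=
  ∃ (N : ℕ) (A B H : ℝ), 0 < N ∧ Sys f b ρ N A B H ∧
    |A - N * χ| ≤ η * N ∧ |B - N * χ| ≤ η * N ∧ N * h ≤ H ∧ 0 < A

lemma HasRate.le_log {f : RSphere → RSphere} {b : RSphere} {ρ η χ h : ℝ}
    (H : HasRate f b ρ η χ h) (hρ : 0 ≤ ρ) {D : ℕ}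
    (hD : ∀ y, (f ⁻¹' {y}).Finite ∧ (f ⁻¹' {y}).ncard ≤ D) : h ≤ Real.log D := by
  obtain ⟨N, A, B, H, hN, hs, -, -, h4, -⟩ := H
  have hN' : (0 : ℝ) < N := by exact_mod_cast hN
  exact le_of_mul_le_mul_left (h4.trans (hs.le_mul_log hρ hD)) hN'

lemma HasRate.mono {f : RSphere → RSphere} {b : RSphere} {ρ η χ h η' χ' h' : ℝ}
    (H : HasRate f b ρ η χ h) (h1 : η + |χ - χ'| ≤ η') (h2 : h' ≤ h) :
    HasRate f b ρ η' χ' h' := by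
  obtain ⟨N, A, B, H, hN, hs, hA, hB, h4, h5⟩ := H
  have hN' : (0 : ℝ) < N := by exact_mod_cast hN
  have key : ∀ X : ℝ, |X - N * χ| ≤ η * N → |X - N * χ'| ≤ η' * N := by
    intro X hX
    have e : X - N * χ' = (X - N * χ) + N * (χ - χ') := by ring
    rw [e]
    refine (abs_add_le _ _).trans ?_
    rw [abs_mul, abs_of_pos hN']
    nlinarith
  exact ⟨N, A, B, H, hN, hs, key A hA, key B hB,
    (mul_le_mul_of_nonneg_left h2 hN'.le).trans h4, h5⟩

/-- Interpolation between two rates. -/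
lemma HasRate.mix {f : RSphere → RSphere} {b : RSphere} {ρ η h₁ h₂ α x y ε : ℝ}
    (H₁ : HasRate f b ρ η (α + x) h₁) (H₂ : HasRate f b ρ η (α - y) h₂) (hx : 0 < x)
    (hy : 0 ≤ y) (hε : 0 < ε) :
    HasRate f b ρ (η + ε) α ((y * h₁ + x * h₂) / (x + y) - ε) := by
  obtain ⟨N₁, A₁, B₁, H₁, hN₁, hs₁, hA₁, hB₁, hh₁, hp₁⟩ := H₁
  obtain ⟨N₂, A₂, B₂, H₂, hN₂, hs₂, hA₂, hB₂, hh₂, hp₂⟩ := H₂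
  have hN₁' : (0 : ℝ) < N₁ := by exact_mod_cast hN₁
  have hN₂' : (0 : ℝ) < N₂ := by exact_mod_cast hN₂
  set m := (y * h₁ + x * h₂) / (x + y) with hm
  have hxy : 0 < x + y := by linarith
  set C := N₁ * x + N₂ * y + (N₁ * |h₁| + N₂ * |h₂| + (N₁ + N₂) * |m|) with hC
  have hC1 : 0 ≤ N₁ * |h₁| + N₂ * |h₂| + (N₁ + N₂) * |m| := by positivity
  have hC2 : 0 ≤ N₁ * x + N₂ * y := by positivity
  set T := C / (ε * x) with hT
  have hT0 : 0 ≤ T := by positivity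
  have hTC : ε * (T * x) = C := by rw [hT]; field_simp
  set p := ⌊T * y / N₁⌋₊ with hp
  set q := ⌊T * x / N₂⌋₊ with hq
  have p1 : p * N₁ ≤ T * y := by
    have := Nat.floor_le (show 0 ≤ T * y / N₁ by positivity)
    rwa [le_div_iff₀ hN₁'] at this
  have p2 : T * y ≤ (p + 1) * N₁ := by
    have := (Nat.lt_floor_add_one (T * y / N₁)).le
    rwa [div_le_iff₀ hN₁'] at this
  have q1 : q * N₂ ≤ T * x := by
    have := Nat.floor_le (show 0 ≤ T * x / N₂ by positivity)
    rwa [le_div_iff₀ hN₂'] at this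
  have q2 : T * x ≤ (q + 1) * N₂ := by
    have := (Nat.lt_floor_add_one (T * x / N₂)).le
    rwa [div_le_iff₀ hN₂'] at this
  obtain ⟨e₁, he₁⟩ : ∃ e, e = (p + 1) * N₁ - T * y := ⟨_, rfl⟩
  obtain ⟨e₂, he₂⟩ : ∃ e, e = (q + 1) * N₂ - T * x := ⟨_, rfl⟩
  have e10 : 0 ≤ e₁ := by linarith
  have e1N : e₁ ≤ N₁ := by linarith
  have e20 : 0 ≤ e₂ := by linarith
  have e2N : e₂ ≤ N₂ := by linarith
  have hNN : (((p + 1) * N₁ + (q + 1) * N₂ : ℕ) : ℝ) = T * y + T * x + (e₁ + e₂) := by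
    push_cast; linarith
  have hNT : T * x ≤ (((p + 1) * N₁ + (q + 1) * N₂ : ℕ) : ℝ) := by
    rw [hNN]; have : 0 ≤ T * y := by positivity
    linarith
  have hCN : C ≤ ε * (((p + 1) * N₁ + (q + 1) * N₂ : ℕ) : ℝ) := by
    rw [← hTC]; gcongr
  have key : ∀ X₁ X₂ : ℝ, |X₁ - N₁ * (α + x)| ≤ η * N₁ → |X₂ - N₂ * (α - y)| ≤ η * N₂ →
      |((p + 1) * X₁ + (q + 1) * X₂) - (((p + 1) * N₁ + (q + 1) * N₂ : ℕ) : ℝ) * α| ≤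
        (η + ε) * (((p + 1) * N₁ + (q + 1) * N₂ : ℕ) : ℝ) := by
    intro X₁ X₂ hX₁ hX₂
    have e : ((p + 1) * X₁ + (q + 1) * X₂) - (((p + 1) * N₁ + (q + 1) * N₂ : ℕ) : ℝ) * α =
        ((p + 1) * (X₁ - N₁ * (α + x)) + (q + 1) * (X₂ - N₂ * (α - y))) + (e₁ * x - e₂ * y) := by
      rw [he₁, he₂]; push_cast; ring
    rw [e]
    have b1 : |e₁ * x - e₂ * y| ≤ C := by
      have : 0 ≤ e₁ * x := by positivity
      have : 0 ≤ e₂ * y := by positivity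
      have : e₁ * x ≤ N₁ * x := by gcongr
      have : e₂ * y ≤ N₂ * y := by gcongr
      exact abs_le.mpr ⟨by linarith, by linarith⟩
    have b2 : |(p + 1) * (X₁ - N₁ * (α + x)) + (q + 1) * (X₂ - N₂ * (α - y))| ≤
        η * (((p + 1) * N₁ + (q + 1) * N₂ : ℕ) : ℝ) := by
      refine (abs_add_le _ _).trans ?_
      rw [abs_mul, abs_mul, abs_of_nonneg (by positivity : (0 : ℝ) ≤ p + 1),
        abs_of_nonneg (by positivity : (0 : ℝ) ≤ q + 1)]
      push_cast
      have : ((p : ℝ) + 1) * |X₁ - N₁ * (α + x)| ≤ (p + 1) * (η * N₁) := by gcongr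
      have : ((q : ℝ) + 1) * |X₂ - N₂ * (α - y)| ≤ (q + 1) * (η * N₂) := by gcongr
      linarith
    refine (abs_add_le _ _).trans ?_
    rw [add_mul η ε]
    linarith
  refine ⟨(p + 1) * N₁ + (q + 1) * N₂, (p + 1) * A₁ + (q + 1) * A₂,
    (p + 1) * B₁ + (q + 1) * B₂, (p + 1) * H₁ + (q + 1) * H₂, by positivity,
    (hs₁.pow p).mul (hs₂.pow q), key _ _ hA₁ hA₂, key _ _ hB₁ hB₂, ?_, by positivity⟩
  have hmm : (x + y) * m = y * h₁ + x * h₂ := by rw [hm]; field_simp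
  have i1 : (p + 1) * (N₁ * h₁) ≤ (p + 1) * H₁ := by gcongr
  have i2 : (q + 1) * (N₂ * h₂) ≤ (q + 1) * H₂ := by gcongr
  have j1 : (p + 1) * (N₁ * h₁) = (T * y + e₁) * h₁ := by rw [he₁]; ring
  have j2 : (q + 1) * (N₂ * h₂) = (T * x + e₂) * h₂ := by rw [he₂]; ring
  have k1 : -(N₁ * |h₁|) ≤ e₁ * h₁ := by
    have : e₁ * |h₁| ≤ N₁ * |h₁| := by gcongr
    have : e₁ * -|h₁| ≤ e₁ * h₁ := mul_le_mul_of_nonneg_left (neg_abs_le _) e10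
    linarith
  have k2 : -(N₂ * |h₂|) ≤ e₂ * h₂ := by
    have : e₂ * |h₂| ≤ N₂ * |h₂| := by gcongr
    have : e₂ * -|h₂| ≤ e₂ * h₂ := mul_le_mul_of_nonneg_left (neg_abs_le _) e20
    linarith
  have k3 : (e₁ + e₂) * m ≤ (N₁ + N₂) * |m| := by
    have : (e₁ + e₂) * |m| ≤ (N₁ + N₂) * |m| := by gcongr
    have : (e₁ + e₂) * m ≤ (e₁ + e₂) * |m| := by gcongr; exact le_abs_self _
    linarith
  have e : (((p + 1) * N₁ + (q + 1) * N₂ : ℕ) : ℝ) * m =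
      T * (y * h₁ + x * h₂) + (e₁ + e₂) * m := by
    rw [hNN, ← hmm]; ring
  have l1 : (((p + 1) * N₁ + (q + 1) * N₂ : ℕ) : ℝ) * (m - ε) =
      T * (y * h₁ + x * h₂) + (e₁ + e₂) * m - ε * (((p + 1) * N₁ + (q + 1) * N₂ : ℕ) : ℝ) := by
    rw [mul_sub, e]; ring
  rw [l1]
  linarith

/-- **Convex duality** for rates: if for every slope `d` there is a rate `χ` with
entropy at least `c + d (χ - α)`, then the rate `α` itself is attained with entropy `c`,
up to arbitrarily small errors. -/
lemma exists_hasRate {f : RSphere → RSphere} {b : RSphere} {D : ℕ}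
    (hD : ∀ y, (f ⁻¹' {y}).Finite ∧ (f ⁻¹' {y}).ncard ≤ D) {α c κ : ℝ}
    (h : ∀ d η : ℝ, 0 < η → ∃ ρ₀ > 0, ∀ ρ, 0 < ρ → ρ ≤ ρ₀ → ∃ χ, 0 ≤ χ ∧ χ ≤ κ ∧
      HasRate f b ρ η χ (c + d * (χ - α) - η)) {η : ℝ} (hη : 0 < η) :
    ∃ ρ₀ > 0, ∀ ρ, 0 < ρ → ρ ≤ ρ₀ → HasRate f b ρ η α (c - η) := by
  have hη4 : 0 < η / 4 := by positivity
  -- the extreme slope and the mesh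
  set E := |Real.log D| + |c| + η with hE
  have hE0 : 0 < E := by positivity
  set R := E / (η / 4) with hR
  have hR0 : 0 < R := by positivity
  have hRE : R * (η / 4) = E := by rw [hR]; field_simp
  obtain ⟨n, hn⟩ := exists_nat_gt (2 * R * (|α| + 1) / (η / 4))
  have hn0 : (0 : ℝ) < n := lt_of_le_of_lt (by positivity) hn
  set g := 2 * R / n with hg
  have hg0 : 0 < g := by positivity
  have hgα : g * (|α| + 1) ≤ η / 4 := by
    rw [hg, div_mul_eq_mul_div, div_le_iff₀ hn0]
    rw [div_lt_iff₀ hη4] at hn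
    linarith
  set d : ℕ → ℝ := fun i => -R + i * g with hd
  have hd0 : d 0 = -R := by simp [hd]
  have hdn : d n = R := by
    simp only [hd, hg]; field_simp; ring
  choose ρ₀ hρ₀ hρ using fun i : ℕ => h (d i) (η / 4) hη4
  obtain ⟨r, hr0, hr⟩ : ∃ r > 0, ∀ i ∈ Finset.range (n + 1), r ≤ ρ₀ i := by
    exact ⟨(Finset.range (n + 1)).inf' Finset.nonempty_range_add_one ρ₀,
      (Finset.lt_inf'_iff _).mpr fun i _ => hρ₀ i, fun i hi => Finset.inf'_le _ hi⟩
  refine ⟨r, hr0, fun ρ hρ0 hρr => ?_⟩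
  have H : ∀ i : ℕ, i ≤ n → ∃ χ, 0 ≤ χ ∧ χ ≤ κ ∧
      HasRate f b ρ (η / 4) χ (c + d i * (χ - α) - η / 4) := fun i hi =>
    hρ i ρ hρ0 (hρr.trans (hr i (by simpa [Nat.lt_succ_iff] using hi)))
  choose! χ hχ0 hχκ hχ using H
  have alone : ∀ i, i ≤ n → 0 ≤ d i * (χ i - α) → |d i| = R → HasRate f b ρ η α (c - η) := by
    intro i hi hs hdi
    have h1 := (hχ i hi).le_log hρ0.le hD
    refine (hχ i hi).mono ?_ (by linarith)
    have h2 : R * |χ i - α| ≤ R * (η / 4) := by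
      rw [hRE, ← hdi, ← abs_mul, abs_of_nonneg hs]
      have := le_abs_self (Real.log D)
      have := neg_abs_le c
      linarith
    have := le_of_mul_le_mul_left h2 hR0
    linarith
  by_cases P0 : α < χ 0
  swap
  · rw [not_lt] at P0
    refine alone 0 (Nat.zero_le _) ?_ (by rw [hd0, abs_neg, abs_of_pos hR0])
    rw [hd0]
    nlinarith
  by_cases Pn : α < χ n
  · refine alone n le_rfl ?_ (by rw [hdn, abs_of_pos hR0])
    rw [hdn]
    nlinarith
  have hex : ∃ i, ¬ α < χ i := ⟨n, Pn⟩
  classical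
  have hspec := Nat.find_spec hex
  set j := Nat.find hex with hj
  have hjn : j ≤ n := Nat.find_min' hex Pn
  obtain ⟨i, hi⟩ : ∃ i, j = i + 1 := by
    refine Nat.exists_eq_succ_of_ne_zero fun h0 => ?_
    rw [h0] at hspec
    exact hspec P0
  have hij : α < χ i := by
    by_contra hcon
    have := Nat.find_min' hex hcon
    omega
  rw [hi, not_lt] at hspec
  have hin : i ≤ n := by omega
  have hin' : i + 1 ≤ n := by omega
  have m1 := hχ i hin
  have m2 := hχ (i + 1) hin'
  obtain ⟨x, hx⟩ : ∃ x, x = χ i - α := ⟨_, rfl⟩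
  obtain ⟨y, hy⟩ : ∃ y, y = α - χ (i + 1) := ⟨_, rfl⟩
  have hx0 : 0 < x := by linarith
  have hy0 : 0 ≤ y := by linarith
  rw [show χ i = α + x by linarith] at m1
  rw [show χ (i + 1) = α - y by linarith] at m2
  refine (m1.mix m2 hx0 hy0 hη4).mono (by rw [sub_self, abs_zero]; linarith) ?_
  have hdi : d (i + 1) = d i + g := by simp only [hd]; push_cast; ring
  have e : (y * (c + d i * (α + x - α) - η / 4) + x * (c + d (i + 1) * (α - y - α) - η / 4)) /
      (x + y) = c - η / 4 - g * (x * y / (x + y)) := by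
    rw [hdi]; field_simp; ring
  rw [e]
  have hyα : y ≤ |α| + 1 := by
    have := hχ0 (i + 1) hin'
    have := le_abs_self α
    linarith
  have hq : x * y / (x + y) ≤ y := by
    rw [div_le_iff₀ (by linarith)]; nlinarith
  have : g * (x * y / (x + y)) ≤ g * (|α| + 1) := by gcongr; exact hq.trans hyα
  linarith

/-- There is a system near `b` with expansion rate `α` up to `η` and dimension at least `s`. -/
def Good (f : RSphere → RSphere) (b : RSphere) (ρ η α s : ℝ) : Prop :=
  ∃ (N : ℕ) (A B H : ℝ), 0 < N ∧ Sys f b ρ N A B H ∧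
    |A - N * α| ≤ η * N ∧ |B - N * α| ≤ η * N ∧ s * B ≤ H ∧ 0 < A

lemma HasRate.good {f : RSphere → RSphere} {b : RSphere} {ρ η α s h : ℝ}
    (H : HasRate f b ρ η α h) (hs : 0 ≤ s) (hh : s * (α + η) ≤ h) : Good f b ρ η α s := by
  obtain ⟨N, A, B, H, hN, h1, hA, hB, h4, h5⟩ := H
  refine ⟨N, A, B, H, hN, h1, hA, hB, le_trans ?_ h4, h5⟩
  have : B ≤ N * (α + η) := by have := (abs_le.mp hB).2; linarith
  calc s * B ≤ s * (N * (α + η)) := by gcongr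
    _ = N * (s * (α + η)) := by ring
    _ ≤ N * h := by gcongr

/-- The hyperbolic subsets of the Julia set. -/
abbrev HypSet (f : RSphere → RSphere) :=
  {L : Set RSphere // L.Nonempty ∧ L ⊆ juliaSet f ∧ IsCompact L ∧ f '' L = L ∧ ExpandingOn f L}

lemma nonempty_hypSet {f : RSphere → RSphere} (hlt : alphaMinus f < alphaPlus f) :
    Nonempty (HypSet f) := by
  by_contra hne
  rw [not_nonempty_iff] at hne
  have h0 : pressFamily f = fun _ => 0 := by
    funext d
    exact Real.iSup_of_isEmpty (ι := HypSet f) _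
  refine hlt.ne ?_
  rw [alphaMinus, alphaPlus, alphaMinusOf, alphaPlusOf, h0]
  simp [limsup_const]

/-- Rates realised near a common base point in the Julia set. -/
lemma exists_base_hasRate {f : RSphere → RSphere} {p q : Polynomial ℂ}
    (hf : IsRationalMap f p q) (hdeg : 2 ≤ ratDeg p q)
    (hexc : ¬ IsExceptional f ∨ maxExceptional f ∩ juliaSet f = ∅)
    (hlt : alphaMinus f < alphaPlus f) :
    ∃ b ∈ juliaSet f, ∃ κ, ∀ d t η : ℝ, t < pressFamily f d → 0 < η →
      ∃ ρ₀ > 0, ∀ ρ, 0 < ρ → ρ ≤ ρ₀ → ∃ χ, 0 ≤ χ ∧ χ ≤ κ ∧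
        HasRate f b ρ η χ (t + d * χ - η) := by
  obtain ⟨L₀, ⟨b, hb⟩, hLJ₀, hLc₀, hinv₀, hexp₀⟩ := nonempty_hypSet hlt
  have : Nonempty (HypSet f) := ⟨L₀, ⟨b, hb⟩, hLJ₀, hLc₀, hinv₀, hexp₀⟩
  have hH := hf.hol hdeg
  obtain ⟨K, hK, hKf, hKd⟩ := hH.exists_lipschitz
  refine ⟨b, hLJ₀ hb, Real.log K, fun d t η ht hη => ?_⟩
  obtain ⟨⟨L, hne, hLJ, hLc, hinv, hexp⟩, hL⟩ := exists_lt_of_lt_ciSup (ι := HypSet f) ht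
  obtain ⟨ρ₀, hρ₀, h⟩ := exists_sys_of_lt_pressureOn hH (hf.finite_critSet hdeg) hexc hLJ₀ hinv₀
    hexp₀ hb hK hKf hKd hne hLJ hLc hinv hexp hL hη
  refine ⟨ρ₀, hρ₀, fun ρ h1 h2 => ?_⟩
  obtain ⟨N, A, B, χ, H, hN, hs, hA, hB, hh, hA0, hχ, hχκ⟩ := h ρ h1 h2
  exact ⟨χ, hχ, hχκ, N, A, B, H, hN, hs, hA, hB, hh, hA0⟩

lemma pressFamily_le {f : RSphere → RSphere} {p q : Polynomial ℂ}
    (hf : IsRationalMap f p q) (hdeg : 2 ≤ ratDeg p q)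
    (hexc : ¬ IsExceptional f ∨ maxExceptional f ∩ juliaSet f = ∅)
    (hlt : alphaMinus f < alphaPlus f) {d : ℝ} (hd : 0 ≤ d) :
    pressFamily f d ≤ Real.log (ratDeg p q + 1 : ℕ) := by
  obtain ⟨b, hb, κ, h⟩ := exists_base_hasRate hf hdeg hexc hlt
  refine le_of_forall_lt_imp_le_of_dense fun t ht => ?_
  obtain ⟨t', ht1, ht2⟩ := exists_between ht
  obtain ⟨ρ₀, hρ₀, h⟩ := h d t' (t' - t) ht2 (by linarith)
  obtain ⟨χ, hχ, -, hr⟩ := h ρ₀ hρ₀ le_rfl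
  have := hr.le_log hρ₀.le (hf.fiber hdeg)
  have : 0 ≤ d * χ := by positivity
  linarith

lemma alphaMinus_nonneg {f : RSphere → RSphere} {p q : Polynomial ℂ}
    (hf : IsRationalMap f p q) (hdeg : 2 ≤ ratDeg p q)
    (hexc : ¬ IsExceptional f ∨ maxExceptional f ∩ juliaSet f = ∅)
    (hlt : alphaMinus f < alphaPlus f) : 0 ≤ alphaMinus f := by
  set D := Real.log (ratDeg p q + 1 : ℕ)
  rw [alphaMinus, alphaMinusOf, limsup_eq]
  refine Real.sInf_nonneg fun a ha => ?_
  have h1 : Tendsto (fun d : ℝ => -D / d) atTop (𝓝 0) := tendsto_const_nhds.div_atTop tendsto_id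
  refine le_of_tendsto h1 ?_
  filter_upwards [ha, eventually_gt_atTop 0] with d hd hd0
  refine le_trans ?_ hd
  have := pressFamily_le hf hdeg hexc hlt hd0.le
  gcongr

lemma exists_base_good {f : RSphere → RSphere} {p q : Polynomial ℂ}
    (hf : IsRationalMap f p q) (hdeg : 2 ≤ ratDeg p q)
    (hexc : ¬ IsExceptional f ∨ maxExceptional f ∩ juliaSet f = ∅)
    (hlt : alphaMinus f < alphaPlus f) :
    ∃ b ∈ juliaSet f, ∀ α s δ η : ℝ, 0 ≤ s → 0 < δ → 0 < η →
      (∀ d, s * α + δ ≤ pressFamily f d + d * α) →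
      ∃ ρ₀ > 0, ∀ ρ, 0 < ρ → ρ ≤ ρ₀ → Good f b ρ η α s := by
  obtain ⟨b, hb, κ, h⟩ := exists_base_hasRate hf hdeg hexc hlt
  refine ⟨b, hb, fun α s δ η hs hδ hη hQ => ?_⟩
  set η' := min η (δ / (2 * (s + 1))) with hη'
  have h0 : 0 < η' := lt_min hη (by positivity)
  have h1 : η' ≤ η := min_le_left _ _
  have h2 : η' * (2 * (s + 1)) ≤ δ := by
    rw [← le_div_iff₀ (by positivity)]; exact min_le_right _ _
  obtain ⟨ρ₀, hρ₀, H⟩ := exists_hasRate (f := f) (b := b) (hf.fiber hdeg) (α := α)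
    (c := s * α + δ / 2) (κ := κ) (fun d e he => by
      obtain ⟨ρ₀, hρ₀, H⟩ := h d (s * α + δ / 2 - d * α) e (by linarith [hQ d]) he
      refine ⟨ρ₀, hρ₀, fun ρ h1 h2 => ?_⟩
      obtain ⟨χ, hχ0, hχκ, hr⟩ := H ρ h1 h2
      refine ⟨χ, hχ0, hχκ, ?_⟩
      convert hr using 1
      ring) h0
  refine ⟨ρ₀, hρ₀, fun ρ h1 h2 => ?_⟩
  obtain ⟨N, A, B, H, hN, q1, hA, hB, h4, h5⟩ := (H ρ h1 h2).good hs (by linarith)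
  have hN' : (0 : ℝ) ≤ N := Nat.cast_nonneg _
  exact ⟨N, A, B, H, hN, q1, hA.trans (by gcongr), hB.trans (by gcongr), h4, h5⟩

/-- The Bernoulli measure of equidistributed digits. -/
lemma exists_bernoulli {M : ℕ → ℕ} (hM : ∀ k, 0 < M k) :
    ∃ P : Measure (∀ k, Fin (M k)), IsProbabilityMeasure P ∧ ∀ (ω : ∀ k, Fin (M k)) (k : ℕ),
      P {ω' | ∀ i < k, ω' i = ω i} =
        ENNReal.ofReal (Real.exp (-∑ i ∈ Finset.range k, Real.log (M i))) := by
  have : ∀ k, NeZero (M k) := fun k => ⟨(hM k).ne'⟩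
  set μ : ∀ k, Measure (Fin (M k)) := fun k => (PMF.uniformOfFintype (Fin (M k))).toMeasure
  refine ⟨Measure.infinitePi μ, inferInstance, fun ω k => ?_⟩
  have e : {ω' : ∀ k, Fin (M k) | ∀ i < k, ω' i = ω i} =
      Set.pi (Finset.range k : Set ℕ) fun i => {ω i} := by
    ext ω'; simp
  rw [e, Measure.infinitePi_pi _ fun i _ => measurableSet_singleton _, ← Finset.sum_neg_distrib,
    Real.exp_sum, ENNReal.ofReal_prod_of_nonneg fun i _ => (Real.exp_pos _).le]
  refine Finset.prod_congr rfl fun i _ => ?_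
  have hi : (0 : ℝ) < M i := by exact_mod_cast hM i
  rw [Real.exp_neg, Real.exp_log hi, ENNReal.ofReal_inv_of_pos hi, ENNReal.ofReal_natCast]
  simp [μ]

/-- A mass distribution principle for outer measures. -/
lemma le_dimH_of_outerMeasure {X : Type*} [MetricSpace X] (μ : OuterMeasure X) {S : Set X}
    (hS : μ S ≠ 0) {t : ℝ≥0} {r : ℝ≥0∞} (hr : 0 < r)
    (h : ∀ s : Set X, ediam s ≤ r → μ s ≤ ediam s ^ (t : ℝ)) : (t : ℝ≥0∞) ≤ dimH S := by
  borelize X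
  refine le_dimH_of_hausdorffMeasure_ne_zero (ne_of_gt ?_)
  refine lt_of_lt_of_le (pos_iff_ne_zero.mpr hS) ?_
  have := OuterMeasure.le_mkMetric (fun x => x ^ (t : ℝ)) μ r hr h
  refine (this S).trans ?_
  rw [OuterMeasure.coe_mkMetric]
  rfl

/-- **Lower bound for the dimension of a Moran-type set.** -/
lemma le_dimH_range_of_separated {X : Type*} [MetricSpace X] {M : ℕ → ℕ} (hM : ∀ k, 0 < M k)
    {x : (∀ k, Fin (M k)) → X} {B κ : ℕ → ℝ} {s : ℝ}
    (hsep : ∀ k ω ω', (∀ i < k, ω i = ω' i) → ω k ≠ ω' k →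
      κ k * Real.exp (-B k) ≤ dist (x ω) (x ω'))
    (hH : ∀ k, s * B k ≤ ∑ i ∈ Finset.range k, Real.log (M i))
    (hB : Tendsto B atTop atTop) (hBm : Monotone B)
    (hκ : ∀ e > 0, ∃ c > 0, ∀ k, c * Real.exp (-e * B k) ≤ κ k) :
    ENNReal.ofReal s ≤ dimH (range x) := by
  refine le_of_forall_lt_imp_le_of_dense fun t' ht' => ?_
  obtain ⟨t, rfl⟩ := ENNReal.lt_iff_exists_coe.mp ht' |>.imp fun _ h => h.1
  rw [ENNReal.lt_ofReal_iff_toReal_lt ENNReal.coe_ne_top, ENNReal.coe_toReal] at ht'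
  rcases eq_or_lt_of_le (zero_le (a := t)) with rfl | ht
  · simp
  have ht0 : (0 : ℝ) < t := by exact_mod_cast ht
  obtain ⟨P, hP, hcyl⟩ := exists_bernoulli hM
  obtain ⟨c, hc, hcκ⟩ := hκ (s / t - 1) (by rw [gt_iff_lt, sub_pos, one_lt_div ht0]; exact ht')
  set r : ℕ → ℝ := fun k => c * Real.exp (-(s / t) * B k) with hr
  have hs0 : 0 < s := ht0.trans ht'
  have hr0 : ∀ k, 0 < r k := fun k => by positivity
  have hranti : Antitone r := by
    intro i j hij
    simp only [hr]
    have := hBm hij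
    gcongr c * Real.exp ?_
    have : 0 < s / t := by positivity
    nlinarith
  have hrlim : Tendsto r atTop (𝓝 0) := by
    rw [show (0 : ℝ) = c * 0 by simp]
    refine (Real.tendsto_exp_atBot.comp ?_).const_mul c
    exact hB.const_mul_atTop_of_neg (by rw [neg_lt_zero]; positivity)
  have hrsep : ∀ k ω ω', (∀ i < k, ω i = ω' i) → ω k ≠ ω' k → r k ≤ dist (x ω) (x ω') := by
    intro k ω ω' h1 h2
    refine le_trans ?_ (hsep k ω ω' h1 h2)
    calc r k = c * Real.exp (-(s / t - 1) * B k) * Real.exp (-B k) := by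
          rw [hr, mul_assoc, ← Real.exp_add]; ring_nf
      _ ≤ _ := by gcongr; exact hcκ k
  -- the basic estimate
  have key : ∀ (S : Set X) (δ : ℝ), (∀ y ∈ S, ∀ z ∈ S, dist y z ≤ δ) → ∀ k, (∀ j < k, δ < r j) →
      P (x ⁻¹' S) ≤ ENNReal.ofReal (Real.exp (-s * B k)) := by
    intro S δ hδ k hk
    rcases (x ⁻¹' S).eq_empty_or_nonempty with h0 | ⟨ω, hω⟩
    · simp [h0]
    have hsub : x ⁻¹' S ⊆ {ω' | ∀ i < k, ω' i = ω i} := by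
      intro ω' hω'
      by_contra hcon
      simp only [Set.mem_ofPred_eq, not_forall] at hcon
      classical
      obtain ⟨hjk, hj⟩ := Nat.find_spec hcon
      set j := Nat.find hcon with hjdef
      have hlt : ∀ i < j, ω i = ω' i := by
        intro i hi
        have := Nat.find_min hcon hi
        simp only [not_exists, not_not] at this
        exact (this (hi.trans hjk)).symm
      have h1 := hrsep j ω ω' hlt (fun h => hj h.symm)
      exact absurd (h1.trans (hδ _ hω _ hω')) (not_le.mpr (hk j hjk))
    refine (measure_mono hsub).trans ?_
    rw [hcyl]
    gcongr
    have := hH k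
    linarith
  have hct : (0 : ℝ) < c ^ (t : ℝ) := by positivity
  set ν : OuterMeasure X := ENNReal.ofReal (c ^ (t : ℝ)) • OuterMeasure.map x P.toOuterMeasure
    with hν
  have hνS : ∀ S, ν S = ENNReal.ofReal (c ^ (t : ℝ)) * P (x ⁻¹' S) := fun S => rfl
  refine le_dimH_of_outerMeasure ν (r := ENNReal.ofReal (r 0 / 2)) ?_
    (by have := hr0 0; simpa using this) ?_
  · rw [hνS, preimage_range, measure_univ, mul_one]
    simpa using hct
  · intro S hS
    have hfin : ediam S ≠ ∞ := ne_top_of_le_ne_top ENNReal.ofReal_ne_top hS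
    obtain ⟨δ, hδ0, hδ⟩ : ∃ δ : ℝ, 0 ≤ δ ∧ ediam S = ENNReal.ofReal δ :=
      ⟨(ediam S).toReal, ENNReal.toReal_nonneg, (ENNReal.ofReal_toReal hfin).symm⟩
    have hdist : ∀ y ∈ S, ∀ z ∈ S, dist y z ≤ δ := by
      intro y hy z hz
      have := edist_le_ediam_of_mem hy hz
      rwa [hδ, edist_dist, ENNReal.ofReal_le_ofReal_iff hδ0] at this
    have hδr : δ < r 0 := by
      have := hr0 0
      rw [hδ, ENNReal.ofReal_le_ofReal_iff (by positivity)] at hS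
      linarith
    rcases hδ0.eq_or_lt with h0 | hδpos
    · have hzero : P (x ⁻¹' S) = 0 := by
        refine le_antisymm ?_ zero_le
        have hl : Tendsto (fun k => ENNReal.ofReal (Real.exp (-s * B k))) atTop (𝓝 0) := by
          rw [← ENNReal.ofReal_zero]
          refine ENNReal.tendsto_ofReal (Real.tendsto_exp_atBot.comp ?_)
          exact hB.const_mul_atTop_of_neg (by linarith)
        exact ge_of_tendsto' hl fun k => key S δ hdist k fun j _ => h0 ▸ hr0 j
      rw [hνS, hzero, mul_zero]
      exact zero_le
    have hex : ∃ k, r k ≤ δ := ((hrlim.eventually_lt_const hδpos).exists).imp fun _ h => h.le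
    classical
    set k := Nat.find hex with hk
    have h1 : r k ≤ δ := Nat.find_spec hex
    have h2 : ∀ j < k, δ < r j := fun j hj => not_le.mp (Nat.find_min hex hj)
    rw [hνS, hδ, ENNReal.ofReal_rpow_of_pos hδpos]
    refine (mul_le_mul_right (key S δ hdist k h2) _).trans ?_
    rw [← ENNReal.ofReal_mul hct.le]
    refine ENNReal.ofReal_le_ofReal (le_trans (le_of_eq ?_)
      (Real.rpow_le_rpow (hr0 k).le h1 ht0.le))
    rw [hr, Real.mul_rpow hc.le (Real.exp_pos _).le, ← Real.exp_mul]
    congr 2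
    field_simp

lemma liminf_coe_eq {v : ℕ → ℝ} {α : ℝ} (h1 : ∀ ε > 0, ∀ᶠ n in atTop, α - ε ≤ v n)
    (h2 : ∀ ε > 0, ∃ᶠ n in atTop, v n ≤ α + ε) :
    liminf (fun n => (v n : EReal)) atTop = (α : EReal) := by
  refine le_antisymm ?_ ?_
  · refine EReal.le_of_forall_lt_iff_le.mp fun z hz => ?_
    rw [EReal.coe_lt_coe_iff] at hz
    refine liminf_le_of_frequently_le ((h2 (z - α) (by linarith)).mono fun n hn => ?_)
    rw [EReal.coe_le_coe_iff]; linarith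
  · refine EReal.ge_of_forall_gt_iff_ge.mp fun z hz => ?_
    rw [EReal.coe_lt_coe_iff] at hz
    refine le_liminf_of_le (by isBoundedDefault) ((h1 (α - z) (by linarith)).mono fun n hn => ?_)
    rw [EReal.coe_le_coe_iff]; linarith

lemma limsup_coe_eq {v : ℕ → ℝ} {β : ℝ} (h1 : ∀ ε > 0, ∀ᶠ n in atTop, v n ≤ β + ε)
    (h2 : ∀ ε > 0, ∃ᶠ n in atTop, β - ε ≤ v n) :
    limsup (fun n => (v n : EReal)) atTop = (β : EReal) := by
  refine le_antisymm ?_ ?_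
  · refine EReal.le_of_forall_lt_iff_le.mp fun z hz => ?_
    rw [EReal.coe_lt_coe_iff] at hz
    refine limsup_le_of_le (by isBoundedDefault) ((h1 (z - β) (by linarith)).mono fun n hn => ?_)
    rw [EReal.coe_le_coe_iff]; linarith
  · refine EReal.ge_of_forall_gt_iff_ge.mp fun z hz => ?_
    rw [EReal.coe_lt_coe_iff] at hz
    refine le_limsup_of_frequently_le ((h2 (β - z) (by linarith)).mono fun n hn => ?_)
    rw [EReal.coe_le_coe_iff]; linarith

/-- A sequence with bounded increments, controlled along times with relatively small gaps, is
controlled everywhere. -/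
lemma eventually_of_blocks {u : ℕ → ℝ} {T : ℕ → ℕ} {κ α β : ℝ}
    (hu : ∀ n m : ℕ, u (n + m) ≤ u n + m * κ) (hT : StrictMono T)
    (hgap : ∀ ε > 0, ∀ᶠ k in atTop, (T (k + 1) : ℝ) - T k ≤ ε * T k)
    (hlo : ∀ ε > 0, ∀ᶠ k in atTop, (α - ε) * T k ≤ u (T k))
    (hhi : ∀ ε > 0, ∀ᶠ k in atTop, u (T k) ≤ (β + ε) * T k) :
    (∀ ε > 0, ∀ᶠ n : ℕ in atTop, α - ε ≤ u n / n) ∧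
      ∀ ε > 0, ∀ᶠ n : ℕ in atTop, u n / n ≤ β + ε := by
  have main : ∀ ε > 0, ∀ᶠ n : ℕ in atTop, α - ε ≤ u n / n ∧ u n / n ≤ β + ε := by
    intro ε hε
    have hε2 : 0 < ε / 2 := by positivity
    set G := |α| + |β| + ε + |κ| with hG
    have hG0 : 0 < G := by positivity
    set δ := ε / 2 / G with hδ
    have hδ0 : 0 < δ := by positivity
    have hδG : δ * G = ε / 2 := by rw [hδ]; field_simp
    obtain ⟨k₀, hk₀⟩ := eventually_atTop.mp
      ((hgap δ hδ0).and ((hlo (ε / 2) hε2).and (hhi (ε / 2) hε2)))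
    filter_upwards [eventually_ge_atTop (T k₀), eventually_gt_atTop 0] with n hn hn0
    have hn0' : (0 : ℝ) < n := by exact_mod_cast hn0
    have hex : ∃ k, n < T k := ⟨n + 1, lt_of_lt_of_le (Nat.lt_succ_self n) (hT.id_le _)⟩
    classical
    have hlt := Nat.find_spec hex
    set k' := Nat.find hex with hk'
    obtain ⟨k, hk⟩ : ∃ k, k' = k + 1 := by
      refine Nat.exists_eq_succ_of_ne_zero fun h0 => ?_
      rw [h0] at hlt
      exact absurd (hn.trans_lt hlt) (not_lt.mpr (hT.monotone (Nat.zero_le _)))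
    have hle : T k ≤ n := not_lt.mp (Nat.find_min hex (by omega))
    rw [hk] at hlt
    have hkk : k₀ ≤ k := by
      by_contra hcon
      exact absurd (hlt.trans_le (hT.monotone (show k + 1 ≤ k₀ by omega))) (not_lt.mpr hn)
    obtain ⟨g1, -, g3⟩ := hk₀ k hkk
    obtain ⟨-, g2, -⟩ := hk₀ (k + 1) (by omega)
    have hTn : (T k : ℝ) ≤ n := by exact_mod_cast hle
    have hnT : (n : ℝ) ≤ T (k + 1) := by exact_mod_cast hlt.le
    have hgn : (T (k + 1) : ℝ) - T k ≤ δ * n := g1.trans (by gcongr)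
    have u1 : u n ≤ u (T k) + (n - T k) * κ := by
      have := hu (T k) (n - T k)
      rwa [Nat.add_sub_cancel' hle, Nat.cast_sub hle] at this
    have u2 : u (T (k + 1)) ≤ u n + (T (k + 1) - n) * κ := by
      have := hu n (T (k + 1) - n)
      rwa [Nat.add_sub_cancel' hlt.le, Nat.cast_sub hlt.le] at this
    have small : ∀ y z : ℝ, 0 ≤ y → y ≤ δ * n → |z| ≤ G → |y * z| ≤ ε / 2 * n := by
      intro y z hy0 hy hz
      rw [abs_mul, abs_of_nonneg hy0, ← hδG]
      calc y * |z| ≤ δ * n * G := by gcongr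
        _ = _ := by ring
    constructor
    · rw [le_div_iff₀ hn0']
      have hz : |α - ε / 2 - κ| ≤ G := by
        have h1 := abs_sub (α - ε / 2) κ
        have h2 := abs_sub α (ε / 2)
        rw [abs_of_pos hε2] at h2
        have := abs_nonneg β
        linarith
      have := (abs_le.mp (small (T (k + 1) - n) _ (by linarith) (by linarith) hz)).1
      nlinarith
    · rw [div_le_iff₀ hn0']
      have hz : |κ - (β + ε / 2)| ≤ G := by
        have h1 := abs_sub κ (β + ε / 2)
        have h2 := abs_add_le β (ε / 2)
        rw [abs_of_pos hε2] at h2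
        have := abs_nonneg α
        linarith
      have := (abs_le.mp (small (n - T k) _ (by linarith) (by linarith) hz)).2
      nlinarith
  exact ⟨fun ε hε => (main ε hε).mono fun n h => h.1, fun ε hε => (main ε hε).mono fun n h => h.2⟩

lemma liminf_limsup_of_blocks {u : ℕ → ℝ} {T : ℕ → ℕ} {κ α β : ℝ}
    (hu : ∀ n m : ℕ, u (n + m) ≤ u n + m * κ) (hT : StrictMono T)
    (hgap : ∀ ε > 0, ∀ᶠ k in atTop, (T (k + 1) : ℝ) - T k ≤ ε * T k)
    (hlo : ∀ ε > 0, ∀ᶠ k in atTop, (α - ε) * T k ≤ u (T k))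
    (hhi : ∀ ε > 0, ∀ᶠ k in atTop, u (T k) ≤ (β + ε) * T k)
    (hflo : ∀ ε > 0, ∃ᶠ k in atTop, u (T k) ≤ (α + ε) * T k)
    (hfhi : ∀ ε > 0, ∃ᶠ k in atTop, (β - ε) * T k ≤ u (T k)) :
    liminf (fun n : ℕ => ((u n / n : ℝ) : EReal)) atTop = (α : EReal) ∧
      limsup (fun n : ℕ => ((u n / n : ℝ) : EReal)) atTop = (β : EReal) := by
  obtain ⟨h1, h2⟩ := eventually_of_blocks hu hT hgap hlo hhi
  have hTpos : ∀ᶠ k in atTop, (0 : ℝ) < T k := by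
    filter_upwards [eventually_gt_atTop 0] with k hk
    exact_mod_cast hk.trans_le (hT.id_le k)
  refine ⟨liminf_coe_eq h1 fun ε hε => ?_, limsup_coe_eq h2 fun ε hε => ?_⟩
  · refine hT.tendsto_atTop.frequently (((hflo ε hε).and_eventually hTpos).mono fun k hk => ?_)
    rw [div_le_iff₀ hk.2]; exact hk.1
  · refine hT.tendsto_atTop.frequently (((hfhi ε hε).and_eventually hTpos).mono fun k hk => ?_)
    rw [le_div_iff₀ hk.2]; exact hk.1

/-- A schedule running through stages `0, 1, 2, …`, staying in each stage until the accumulated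
sums dominate the data of the next stage and reflect the averages of the present stage. -/
lemma exists_schedule {N : ℕ → ℕ} {A B a η L : ℕ → ℝ} (hN : ∀ j, 0 < N j) (hA : ∀ j, 0 < A j)
    (hη : ∀ j, 0 < η j) (hAe : ∀ j, |A j - N j * a j| ≤ η j * N j)
    (hBe : ∀ j, |B j - N j * a j| ≤ η j * N j) :
    ∃ J : ℕ → ℕ, Monotone J ∧ Tendsto J atTop atTop ∧
      (∀ k, (J k : ℝ) * N (J k) ≤ ∑ i ∈ Finset.range k, (N (J i) : ℝ)) ∧
      (∀ k, (J k : ℝ) * L (J k) ≤ ∑ i ∈ Finset.range k, A (J i)) ∧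
      ∀ m, ∃ k, J k = m ∧
        |∑ i ∈ Finset.range (k + 1), A (J i) - (∑ i ∈ Finset.range (k + 1), (N (J i) : ℝ)) * a m| ≤
          2 * η m * ∑ i ∈ Finset.range (k + 1), (N (J i) : ℝ) ∧
        |∑ i ∈ Finset.range (k + 1), B (J i) - (∑ i ∈ Finset.range (k + 1), (N (J i) : ℝ)) * a m| ≤
          2 * η m * ∑ i ∈ Finset.range (k + 1), (N (J i) : ℝ) := by
  classical
  set P : ℕ → ℝ → ℝ → ℝ → Prop := fun j n x y =>
    ((j + 1 : ℕ) : ℝ) * N (j + 1) ≤ n ∧ ((j + 1 : ℕ) : ℝ) * L (j + 1) ≤ x ∧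
      |x - n * a j| ≤ 2 * η j * n ∧ |y - n * a j| ≤ 2 * η j * n with hP
  obtain ⟨J, hJ0, hJ⟩ : ∃ J : ℕ → ℕ, J 0 = 0 ∧ ∀ k, J (k + 1) =
      if P (J k) (∑ i ∈ Finset.range (k + 1), (N (J i) : ℝ))
        (∑ i ∈ Finset.range (k + 1), A (J i)) (∑ i ∈ Finset.range (k + 1), B (J i))
      then J k + 1 else J k := by
    set step : ℕ × ℝ × ℝ × ℝ → ℕ × ℝ × ℝ × ℝ := fun z =>
      (if P z.1 (z.2.1 + N z.1) (z.2.2.1 + A z.1) (z.2.2.2 + B z.1) then z.1 + 1 else z.1,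
        z.2.1 + N z.1, z.2.2.1 + A z.1, z.2.2.2 + B z.1) with hstep
    set st : ℕ → ℕ × ℝ × ℝ × ℝ := fun k => step^[k] (0, 0, 0, 0) with hst
    have hs : ∀ k, st (k + 1) = step (st k) := fun k => Function.iterate_succ_apply' _ _ _
    have hsum : ∀ k, (st k).2 = (∑ i ∈ Finset.range k, (N (st i).1 : ℝ),
        ∑ i ∈ Finset.range k, A (st i).1, ∑ i ∈ Finset.range k, B (st i).1) := by
      intro k
      induction k with
      | zero => simp [hst]
      | succ k ih =>
        rw [hs, Finset.sum_range_succ, Finset.sum_range_succ, Finset.sum_range_succ]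
        simp only [hstep, ih]
    refine ⟨fun k => (st k).1, rfl, fun k => ?_⟩
    rw [Finset.sum_range_succ, Finset.sum_range_succ, Finset.sum_range_succ]
    simp only [hs k]
    simp only [hstep, hsum k]
  have hle : ∀ k, J k ≤ J (k + 1) := by
    intro k; rw [hJ]; split_ifs <;> omega
  have hmono : Monotone J := monotone_nat_of_le_succ hle
  have hstage : ∀ m k, J k = m → ∃ k', J k' = m ∧
      P m (∑ i ∈ Finset.range (k' + 1), (N (J i) : ℝ))
        (∑ i ∈ Finset.range (k' + 1), A (J i)) (∑ i ∈ Finset.range (k' + 1), B (J i)) := by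
    intro m k hk
    by_contra hcon
    push Not at hcon
    have hconst : ∀ i, J (k + i) = m := by
      intro i
      induction i with
      | zero => exact hk
      | succ i ih =>
        rw [← add_assoc, hJ, ih, if_neg (hcon _ ih)]
    have hsum : ∀ (F : ℕ → ℝ) (i : ℕ), ∑ l ∈ Finset.range (k + i), F (J l) =
        ∑ l ∈ Finset.range k, F (J l) + i * F m := by
      intro F i
      induction i with
      | zero => simp
      | succ i ih =>
        rw [← add_assoc, Finset.sum_range_succ, ih, hconst]
        push_cast; ring
    have hcast : Tendsto (fun n : ℕ => (n : ℝ)) atTop atTop := tendsto_natCast_atTop_atTop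
    have lin : ∀ (s x y : ℝ), 0 < s → ∀ᶠ i : ℕ in atTop, x ≤ y + i * s := fun s x y hs =>
      ((tendsto_atTop_add_const_left _ y (hcast.atTop_mul_const hs)).eventually_ge_atTop x)
    set S := ∑ l ∈ Finset.range k, (N (J l) : ℝ) with hS
    have hS0 : 0 ≤ S := Finset.sum_nonneg fun _ _ => Nat.cast_nonneg _
    have hNm : (0 : ℝ) < N m := by exact_mod_cast hN m
    have err : ∀ (F : ℕ → ℝ), |F m - N m * a m| ≤ η m * N m → ∀ᶠ i : ℕ in atTop,
        |(∑ l ∈ Finset.range k, F (J l) + i * F m) - (S + i * N m) * a m| ≤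
          2 * η m * (S + i * N m) := by
      intro F hF
      filter_upwards [lin (η m * N m) |∑ l ∈ Finset.range k, F (J l) - S * a m| 0
        (mul_pos (hη m) hNm)] with i hi
      have e : (∑ l ∈ Finset.range k, F (J l) + i * F m) - (S + i * N m) * a m =
          (∑ l ∈ Finset.range k, F (J l) - S * a m) + i * (F m - N m * a m) := by ring
      rw [e]
      refine (abs_add_le _ _).trans ?_
      rw [abs_mul, Nat.abs_cast]
      have h1 : (i : ℝ) * |F m - N m * a m| ≤ i * (η m * N m) := by gcongr
      have h2 : 0 ≤ η m * S := mul_nonneg (hη m).le hS0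
      linarith
    obtain ⟨i, ⟨⟨⟨h1, h2⟩, h3⟩, h4⟩, h5⟩ :=
      ((((lin (N m) (((m + 1 : ℕ) : ℝ) * N (m + 1)) S hNm).and
      (lin (A m) (((m + 1 : ℕ) : ℝ) * L (m + 1)) (∑ l ∈ Finset.range k, A (J l)) (hA m))).and
      (err A (hAe m))).and (err B (hBe m)) |>.and (eventually_gt_atTop 0)).exists
    obtain ⟨i', rfl⟩ : ∃ i', i = i' + 1 := ⟨i - 1, by omega⟩
    refine hcon (k + i') (hconst i') ?_
    rw [add_assoc, hsum (fun j => (N j : ℝ)), hsum A, hsum B]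
    exact ⟨h1, h2, h3, h4⟩
  have hreach : ∀ m, ∃ k, J k = m := by
    intro m
    induction m with
    | zero => exact ⟨0, hJ0⟩
    | succ m ih =>
      obtain ⟨k, hk⟩ := ih
      obtain ⟨k', hk', hPk⟩ := hstage m k hk
      refine ⟨k' + 1, ?_⟩
      rw [hJ, hk', if_pos hPk]
  refine ⟨J, hmono, tendsto_atTop_atTop_of_monotone hmono fun m => ?_, ?_, ?_, ?_⟩
  · obtain ⟨k, hk⟩ := hreach m
    exact ⟨k, hk.ge⟩
  · intro k
    induction k with
    | zero => simp [hJ0]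
    | succ k ih =>
      by_cases h : P (J k) (∑ i ∈ Finset.range (k + 1), (N (J i) : ℝ))
        (∑ i ∈ Finset.range (k + 1), A (J i)) (∑ i ∈ Finset.range (k + 1), B (J i))
      · rw [hJ k, if_pos h]; exact h.1
      · rw [hJ k, if_neg h, Finset.sum_range_succ]
        have : (0 : ℝ) ≤ N (J k) := Nat.cast_nonneg _
        linarith
  · intro k
    induction k with
    | zero => simp [hJ0]
    | succ k ih =>
      by_cases h : P (J k) (∑ i ∈ Finset.range (k + 1), (N (J i) : ℝ))
        (∑ i ∈ Finset.range (k + 1), A (J i)) (∑ i ∈ Finset.range (k + 1), B (J i))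
      · rw [hJ k, if_pos h]; exact h.2.1
      · rw [hJ k, if_neg h, Finset.sum_range_succ]
        have := hA (J k)
        linarith
  · intro m
    obtain ⟨k, hk⟩ := hreach m
    obtain ⟨k', hk', hPk⟩ := hstage m k hk
    exact ⟨k', hk', hPk.2.2.1, hPk.2.2.2⟩

lemma isClosed_juliaSet (f : RSphere → RSphere) : IsClosed (juliaSet f) := by
  refine isOpen_compl_iff.mp (isOpen_iff_forall_mem_open.mpr fun x hx => ?_)
  rw [juliaSet, compl_compl] at hx ⊢
  obtain ⟨U, hU, hxU, h⟩ := hx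
  exact ⟨U, fun y hy => ⟨U, hU, hy, h⟩, hU, hxU⟩

lemma mem_juliaSet_of_iterate {f : RSphere → RSphere} (hf : Hol f) {n : ℕ} {x : RSphere}
    (hx : f^[n] x ∈ juliaSet f) (hd : sphDeriv f^[n] x ≠ 0) : x ∈ juliaSet f := by
  induction n generalizing x with
  | zero => exact hx
  | succ n ih =>
    rw [hf.sphDeriv_iterate_succ] at hd
    exact mem_juliaSet_of_sphDeriv_ne_zero hf (ih hx (left_ne_zero_of_mul hd))
      (right_ne_zero_of_mul hd)

/-- The composition of the first `k` maps selected by the code `ω`. -/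
def codeMap {X : Type*} {M : ℕ → ℕ} (w : ∀ k, Fin (M k) → X → X) (ω : ∀ k, Fin (M k)) : ℕ → X → X
  | 0 => id
  | k + 1 => codeMap w ω k ∘ w k (ω k)

lemma codeMap_congr {X : Type*} {M : ℕ → ℕ} {w : ∀ k, Fin (M k) → X → X} {ω ω' : ∀ k, Fin (M k)}
    {k : ℕ} (h : ∀ i < k, ω i = ω' i) : codeMap w ω k = codeMap w ω' k := by
  induction k with
  | zero => rfl
  | succ k ih =>
    rw [codeMap, codeMap, ih fun i hi => h i (hi.trans (Nat.lt_succ_self k)),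
      h k (Nat.lt_succ_self k)]

/-- Points coded by a sequence of systems of inverse branches near `b`. -/
lemma exists_coding {f : RSphere → RSphere} (hf : Hol f) {b : RSphere} (hb : b ∈ juliaSet f)
    {ρ : ℕ → ℝ} (hρ : ∀ k, 0 < ρ k) (hρa : Antitone ρ) {N M : ℕ → ℕ} {A B κ : ℕ → ℝ}
    {w : ∀ k, Fin (M k) → RSphere → RSphere}
    (hw : ∀ k i, ∀ u ∈ closedBall b (ρ k), w k i u ∈ ball b (ρ k))
    (hbr : ∀ k i, Branch f (w k i) (N k) (closedBall b (ρ k)) (A k) (B k))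
    (hsep : ∀ k i j, i ≠ j → ∀ u ∈ closedBall b (ρ k), ∀ u' ∈ closedBall b (ρ k),
      κ k ≤ dist (w k i u) (w k j u'))
    (hA : Tendsto (fun k => ∑ i ∈ Finset.range k, A i) atTop atTop) :
    ∃ x : (∀ k, Fin (M k)) → RSphere,
      (∀ ω, x ω ∈ juliaSet f ∧ ∀ k,
        Real.exp (∑ i ∈ Finset.range k, A i) ≤
          sphDeriv f^[∑ i ∈ Finset.range k, N i] (x ω) ∧
        sphDeriv f^[∑ i ∈ Finset.range k, N i] (x ω) ≤
          Real.exp (∑ i ∈ Finset.range k, B i)) ∧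
      ∀ k ω ω', (∀ i < k, ω i = ω' i) → ω k ≠ ω' k →
        κ k * Real.exp (-∑ i ∈ Finset.range k, B i) ≤ dist (x ω) (x ω') := by
  have hsub : ∀ k, closedBall b (ρ (k + 1)) ⊆ closedBall b (ρ k) := fun k =>
    closedBall_subset_closedBall (hρa (Nat.le_succ k))
  have hW : ∀ ω k, Branch f (codeMap w ω k) (∑ i ∈ Finset.range k, N i) (closedBall b (ρ k))
      (∑ i ∈ Finset.range k, A i) (∑ i ∈ Finset.range k, B i) := by
    intro ω k
    induction k with
    | zero => exact ⟨fun u _ => rfl, fun u _ u' _ => by simp [codeMap]⟩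
    | succ k ih =>
      rw [Finset.sum_range_succ, Finset.sum_range_succ, Finset.sum_range_succ]
      exact (ih.comp (hbr k (ω k)) fun u hu => ball_subset_closedBall (hw k _ u hu)).mono (hsub k)
  have hcont : ∀ ω k, ContinuousOn (codeMap w ω k) (closedBall b (ρ k)) := by
    intro ω k
    have : LipschitzOnWith (Real.toNNReal (Real.exp (-∑ i ∈ Finset.range k, A i)))
        (codeMap w ω k) (closedBall b (ρ k)) := by
      refine LipschitzOnWith.of_dist_le_mul fun u hu u' hu' => ?_
      rw [Real.coe_toNNReal _ (Real.exp_pos _).le]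
      exact ((hW ω k).2 u hu u' hu').2
    exact this.continuousOn
  have hstep : ∀ ω k, codeMap w ω (k + 1) '' closedBall b (ρ (k + 1)) ⊆
      codeMap w ω k '' closedBall b (ρ k) := by
    rintro ω k _ ⟨u, hu, rfl⟩
    exact ⟨w k (ω k) u, ball_subset_closedBall (hw k _ u (hsub k hu)), rfl⟩
  have hcpt : ∀ ω k, IsCompact (codeMap w ω k '' closedBall b (ρ k)) := fun ω k =>
    (isClosed_closedBall.isCompact).image_of_continuousOn (hcont ω k)
  have hne : ∀ ω, (⋂ k, codeMap w ω k '' closedBall b (ρ k)).Nonempty := fun ω =>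
    IsCompact.nonempty_iInter_of_sequence_nonempty_isCompact_isClosed _ (hstep ω)
      (fun k => ⟨_, mem_image_of_mem _ (mem_closedBall_self (hρ k).le)⟩) (hcpt ω 0)
      fun k => (hcpt ω k).isClosed
  choose x hx using hne
  have hx' : ∀ ω k, ∃ z ∈ closedBall b (ρ k), codeMap w ω k z = x ω := fun ω k =>
    mem_iInter.mp (hx ω) k
  refine ⟨x, fun ω => ⟨?_, fun k => ?_⟩, ?_⟩
  · have hmem : ∀ k, codeMap w ω k b ∈ juliaSet f := by
      intro k
      have h1 := (hW ω k).sphDeriv_mem hf (closedBall_mem_nhds b (hρ k))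
      refine mem_juliaSet_of_iterate hf (n := ∑ i ∈ Finset.range k, N i) ?_
        ((Real.exp_pos _).trans_le h1.1).ne'
      rw [(hW ω k).1 b (mem_closedBall_self (hρ k).le)]
      exact hb
    have hlim : Tendsto (fun k => codeMap w ω k b) atTop (𝓝 (x ω)) := by
      rw [tendsto_iff_dist_tendsto_zero]
      have h0 : Tendsto (fun k => Real.exp (-∑ i ∈ Finset.range k, A i) * ρ 0) atTop (𝓝 0) := by
        rw [show (0 : ℝ) = 0 * ρ 0 by simp]
        exact (Real.tendsto_exp_atBot.comp (tendsto_neg_atTop_atBot.comp hA)).mul_const _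
      refine squeeze_zero (fun _ => dist_nonneg) (fun k => ?_) h0
      obtain ⟨z, hz, e⟩ := hx' ω k
      rw [← e]
      refine ((hW ω k).2 b (mem_closedBall_self (hρ k).le) z hz).2.trans ?_
      gcongr
      exact (mem_closedBall'.mp hz).trans (hρa (Nat.zero_le k))
    exact (isClosed_juliaSet f).mem_of_tendsto hlim (Eventually.of_forall hmem)
  · obtain ⟨z, hz, e⟩ := hx' ω (k + 1)
    have h1 := (hW ω k).sphDeriv_mem hf (u := w k (ω k) z)
      (mem_of_superset (isOpen_ball.mem_nhds (hw k _ z (hsub k hz))) ball_subset_closedBall)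
    rwa [show codeMap w ω k (w k (ω k) z) = x ω from e] at h1
  · intro k ω ω' h1 h2
    obtain ⟨z, hz, e⟩ := hx' ω (k + 1)
    obtain ⟨z', hz', e'⟩ := hx' ω' (k + 1)
    have e1 : codeMap w ω k (w k (ω k) z) = x ω := e
    have e2 : codeMap w ω k (w k (ω' k) z') = x ω' := by rw [codeMap_congr h1]; exact e'
    have h3 := ((hW ω k).2 _ (ball_subset_closedBall (hw k (ω k) z (hsub k hz))) _
      (ball_subset_closedBall (hw k (ω' k) z' (hsub k hz')))).1
    rw [e1, e2] at h3
    refine le_trans ?_ h3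
    rw [mul_comm]
    gcongr
    exact hsep k _ _ h2 z (hsub k hz) z' (hsub k hz')

lemma eventually_le_sum_of_eventually_le {c n : ℕ → ℝ} {α : ℝ}
    (hT : Tendsto (fun k => ∑ i ∈ Finset.range k, n i) atTop atTop)
    (h : ∀ ε > 0, ∀ᶠ i in atTop, (α - ε) * n i ≤ c i) {ε : ℝ} (hε : 0 < ε) :
    ∀ᶠ k in atTop, (α - ε) * ∑ i ∈ Finset.range k, n i ≤ ∑ i ∈ Finset.range k, c i := by
  obtain ⟨k₀, hk₀⟩ := eventually_atTop.mp (h (ε / 2) (half_pos hε))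
  set D := ∑ i ∈ Finset.range k₀, (c i - (α - ε / 2) * n i) with hD
  filter_upwards [eventually_ge_atTop k₀, hT.eventually_ge_atTop (-D / (ε / 2))] with k h1 h2
  have h3 : D ≤ ∑ i ∈ Finset.range k, (c i - (α - ε / 2) * n i) := by
    refine Finset.sum_le_sum_of_subset_of_nonneg (Finset.range_mono h1) fun i _ hi => ?_
    have := hk₀ i (by simpa using hi)
    linarith
  rw [Finset.sum_sub_distrib, ← Finset.mul_sum] at h3
  rw [div_le_iff₀ (half_pos hε)] at h2
  linarith

lemma exists_pos_le_of_finite {κ : ℕ → ℝ} (hκ : ∀ k, 0 < κ k) (n : ℕ) :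
    ∃ c > 0, c ≤ 1 ∧ ∀ k < n, c ≤ κ k := by
  induction n with
  | zero => exact ⟨1, one_pos, le_rfl, fun k hk => absurd hk (Nat.not_lt_zero k)⟩
  | succ n ih =>
    obtain ⟨c, hc, hc1, h⟩ := ih
    refine ⟨min c (κ n), lt_min hc (hκ n), (min_le_left _ _).trans hc1, fun k hk => ?_⟩
    rcases Nat.lt_succ_iff_lt_or_eq.mp hk with h1 | rfl
    · exact (min_le_left _ _).trans (h k h1)
    · exact min_le_right _ _

/-- Concatenating good systems of inverse branches with prescribed exponents. -/
lemma le_dimH_levelSet_of_good {f : RSphere → RSphere} (hf : Hol f) {b : RSphere}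
    (hb : b ∈ juliaSet f) {s α β : ℝ} {a η : ℕ → ℝ} (hη : ∀ j, 0 < η j)
    (hη0 : Tendsto η atTop (𝓝 0))
    (hlo : ∀ ε > 0, ∀ᶠ j in atTop, α - ε ≤ a j) (hhi : ∀ ε > 0, ∀ᶠ j in atTop, a j ≤ β + ε)
    (hflo : ∀ ε > 0, ∃ᶠ j in atTop, a j ≤ α + ε) (hfhi : ∀ ε > 0, ∃ᶠ j in atTop, β - ε ≤ a j)
    (hgood : ∀ j, ∃ ρ₀ > 0, ∀ ρ, 0 < ρ → ρ ≤ ρ₀ → Good f b ρ (η j) (a j) s) :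
    ENNReal.ofReal s ≤ dimH (levelSet f (α : EReal) (β : EReal)) := by
  choose ρ₀ hρ₀ hgood using hgood
  have hne : ∀ j, (Finset.range (j + 1)).Nonempty := fun j => Finset.nonempty_range_add_one
  set ρ : ℕ → ℝ := fun j => (Finset.range (j + 1)).inf' (hne j) ρ₀ with hρdef
  have hρ : ∀ j, 0 < ρ j := fun j => (Finset.lt_inf'_iff _).mpr fun i _ => hρ₀ i
  have hρa : Antitone ρ := fun i j hij =>
    Finset.inf'_mono _ (Finset.range_mono (Nat.succ_le_succ hij)) (hne i)
  have hρle : ∀ j, ρ j ≤ ρ₀ j := fun j => Finset.inf'_le _ (Finset.self_mem_range_succ j)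
  choose N A B H hN hsys hAe hBe hsB hA using fun j => hgood j (ρ j) (hρ j) (hρle j)
  choose M w κ hM hκ hw hbr hsep hH using hsys
  have hAB : ∀ j, A j ≤ B j := fun j => by
    have := (hbr j ⟨0, hM j⟩).sphDeriv_mem hf (closedBall_mem_nhds b (hρ j))
    exact Real.exp_le_exp.mp (this.1.trans this.2)
  obtain ⟨J, hJm, hJ, hJN, hJL, hend⟩ := exists_schedule (L := fun j => |Real.log (κ j)| + 1)
    hN hA hη hAe hBe
  have hJr : Tendsto (fun k => (J k : ℝ)) atTop atTop := tendsto_natCast_atTop_atTop.comp hJ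
  have hAt : Tendsto (fun k => ∑ i ∈ Finset.range k, A (J i)) atTop atTop := by
    refine tendsto_atTop_mono (fun k => le_trans ?_ (hJL k)) hJr
    have h1 : (0 : ℝ) ≤ J k := Nat.cast_nonneg _
    nlinarith [abs_nonneg (Real.log (κ (J k)))]
  have hABs : ∀ k, ∑ i ∈ Finset.range k, A (J i) ≤ ∑ i ∈ Finset.range k, B (J i) := fun k =>
    Finset.sum_le_sum fun i _ => hAB _
  have hA0 : ∀ k, 0 ≤ ∑ i ∈ Finset.range k, A (J i) := fun k =>
    Finset.sum_nonneg fun i _ => (hA _).le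
  have hTt : Tendsto (fun k => ∑ i ∈ Finset.range k, (N (J i) : ℝ)) atTop atTop := by
    refine tendsto_atTop_mono (fun k => le_trans ?_ (hJN k)) hJr
    have h1 : (0 : ℝ) ≤ J k := Nat.cast_nonneg _
    have h2 : (1 : ℝ) ≤ N (J k) := by exact_mod_cast hN (J k)
    nlinarith
  obtain ⟨x, hx, hxsep⟩ := exists_coding hf hb (ρ := fun k => ρ (J k)) (M := fun k => M (J k))
    (N := fun k => N (J k)) (A := fun k => A (J k)) (B := fun k => B (J k))
    (κ := fun k => κ (J k)) (w := fun k => w (J k)) (fun k => hρ _)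
    (hρa.comp_monotone hJm) (fun k => hw _) (fun k => hbr _) (fun k => hsep _) hAt
  have hdim : ENNReal.ofReal s ≤ dimH (range x) := by
    refine le_dimH_range_of_separated (fun k => hM (J k)) hxsep (fun k => ?_)
      (tendsto_atTop_mono hABs hAt) ?_ ?_
    · rw [Finset.mul_sum]
      exact Finset.sum_le_sum fun i _ => (hsB _).trans (hH _)
    · exact monotone_nat_of_le_succ fun k => by
        rw [Finset.sum_range_succ]
        linarith [hA (J k), hAB (J k)]
    · intro e he
      obtain ⟨k₀, hk₀⟩ := eventually_atTop.mp (hJr.eventually_ge_atTop (1 / e))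
      obtain ⟨c, hc, hc1, hck⟩ := exists_pos_le_of_finite (fun k => hκ (J k)) k₀
      refine ⟨c, hc, fun k => ?_⟩
      rcases lt_or_ge k k₀ with hk | hk
      · refine le_trans ?_ (hck k hk)
        refine mul_le_of_le_one_right hc.le (Real.exp_le_one_iff.mpr ?_)
        have := (hA0 k).trans (hABs k)
        nlinarith
      · refine (mul_le_of_le_one_left (Real.exp_pos _).le hc1).trans ?_
        rw [← Real.le_log_iff_exp_le (hκ _)]
        have h1 := hk₀ k hk
        rw [div_le_iff₀ he] at h1
        have h2 := (hJL k).trans (hABs k)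
        have h3 := neg_abs_le (Real.log (κ (J k)))
        have h4 : e * (J k * (|Real.log (κ (J k))| + 1)) ≤ e * ∑ i ∈ Finset.range k, B (J i) := by
          gcongr
        nlinarith [abs_nonneg (Real.log (κ (J k)))]
  refine hdim.trans (dimH_mono ?_)
  rintro _ ⟨ω, rfl⟩
  obtain ⟨hxJ, hxd⟩ := hx ω
  set T : ℕ → ℕ := fun k => ∑ i ∈ Finset.range k, N (J i) with hTdef
  have hTc : ∀ k, (T k : ℝ) = ∑ i ∈ Finset.range k, (N (J i) : ℝ) := fun k => by
    simp [hTdef]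
  have hTm : StrictMono T := strictMono_nat_of_lt_succ fun k => by
    simp only [hTdef, Finset.sum_range_succ]
    exact Nat.lt_add_of_pos_right (hN _)
  have hpos : ∀ n, 0 < sphDeriv f^[n] (x ω) := by
    intro n
    refine lt_of_le_of_ne ((hf.iterate n).sphDeriv_nonneg _) fun h0 => ?_
    have h1 := (Real.exp_pos _).trans_le (hxd n).1
    have h2 : n ≤ T n := hTm.le_apply
    obtain ⟨m, hm⟩ := Nat.exists_eq_add_of_le h2
    change 0 < sphDeriv f^[T n] (x ω) at h1
    rw [hm, add_comm, hf.sphDeriv_iterate_add, ← h0, mul_zero] at h1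
    exact lt_irrefl _ h1
  set u : ℕ → ℝ := fun n => Real.log (sphDeriv f^[n] (x ω)) with hu
  have huA : ∀ k, ∑ i ∈ Finset.range k, A (J i) ≤ u (T k) := fun k =>
    (Real.le_log_iff_exp_le (hpos _)).mpr (hxd k).1
  have huB : ∀ k, u (T k) ≤ ∑ i ∈ Finset.range k, B (J i) := fun k =>
    (Real.log_le_iff_le_exp (hpos _)).mpr (hxd k).2
  have hη' : ∀ ε > 0, ∀ᶠ j in atTop, η j ≤ ε := fun ε hε => hη0.eventually_le_const hε
  have hfreq : ∀ {p : ℕ → Prop}, (∃ᶠ j in atTop, p j) → ∃ᶠ k in atTop, ∃ l, k = l + 1 ∧ p (J l) ∧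
      |∑ i ∈ Finset.range k, A (J i) - T k * a (J l)| ≤ 2 * η (J l) * T k ∧
      |∑ i ∈ Finset.range k, B (J i) - T k * a (J l)| ≤ 2 * η (J l) * T k := by
    intro p hp
    refine frequently_atTop.mpr fun K => ?_
    obtain ⟨m, hm, hpm⟩ := frequently_atTop.mp hp (J K + 1)
    obtain ⟨k, rfl, h1, h2⟩ := hend m
    have hKk : K ≤ k + 1 := by
      by_contra hlt
      have := hJm (show k ≤ K by omega)
      omega
    refine ⟨k + 1, hKk, k, rfl, hpm, ?_, ?_⟩
    · rw [hTc]; exact h1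
    · rw [hTc]; exact h2
  obtain ⟨K, hK1, -, hK⟩ := hf.exists_lipschitz
  have hT0 : ∀ k, (0 : ℝ) ≤ T k := fun k => Nat.cast_nonneg _
  have hmain := liminf_limsup_of_blocks (u := u) (T := T) (κ := Real.log K) (α := α) (β := β)
    ?_ hTm ?_ ?_ ?_ ?_ ?_
  · exact ⟨hxJ, hmain.1, hmain.2⟩
  · intro n m
    simp only [hu]
    rw [add_comm n m, hf.sphDeriv_iterate_add]
    have h1 : 0 < sphDeriv f^[m] (f^[n] (x ω)) := by
      have := hpos (m + n)
      rw [hf.sphDeriv_iterate_add] at this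
      exact pos_of_mul_pos_left this (hpos n).le
    rw [Real.log_mul h1.ne' (hpos n).ne', add_comm, ← Real.log_pow]
    gcongr
    exact hf.sphDeriv_iterate_le hK m _
  · intro ε hε
    filter_upwards [hJr.eventually_ge_atTop (1 / ε)] with k hk
    rw [div_le_iff₀ hε] at hk
    have h1 := hJN k
    rw [← hTc] at h1
    have h2 : (T (k + 1) : ℝ) = T k + N (J k) := by
      rw [hTc, hTc, Finset.sum_range_succ]
    have h3 : (0 : ℝ) ≤ N (J k) := Nat.cast_nonneg _
    rw [h2, add_sub_cancel_left]
    nlinarith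
  · intro ε hε
    have := eventually_le_sum_of_eventually_le (c := fun i => A (J i)) (α := α)
      hTt ?_ hε
    · filter_upwards [this] with k hk
      rw [hTc]
      exact hk.trans (huA k)
    · intro ε hε
      filter_upwards [hJ.eventually (hlo _ (half_pos hε)),
        hJ.eventually (hη' _ (half_pos hε))] with i h1 h2
      have h3 := (abs_le.mp (hAe (J i))).1
      have h4 : (0 : ℝ) ≤ N (J i) := Nat.cast_nonneg _
      nlinarith
  · intro ε hε
    have := eventually_le_sum_of_eventually_le (c := fun i => -B (J i)) (α := -β)
      hTt ?_ hε
    · filter_upwards [this] with k hk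
      rw [Finset.sum_neg_distrib, ← hTc] at hk
      linarith [huB k]
    · intro ε hε
      filter_upwards [hJ.eventually (hhi _ (half_pos hε)),
        hJ.eventually (hη' _ (half_pos hε))] with i h1 h2
      have h3 := (abs_le.mp (hBe (J i))).2
      have h4 : (0 : ℝ) ≤ N (J i) := Nat.cast_nonneg _
      nlinarith
  · intro ε hε
    refine (hfreq ((hflo (ε / 2) (half_pos hε)).and_eventually
      (hη' (ε / 4) (by positivity)))).mono ?_
    rintro k ⟨l, -, ⟨h1, h2⟩, -, h3⟩
    have h4 := (abs_le.mp h3).2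
    nlinarith [huB k, hT0 k]
  · intro ε hε
    refine (hfreq ((hfhi (ε / 2) (half_pos hε)).and_eventually
      (hη' (ε / 4) (by positivity)))).mono ?_
    rintro k ⟨l, -, ⟨h1, h2⟩, h3, -⟩
    have h4 := (abs_le.mp h3).1
    nlinarith [huA k, hT0 k]

lemma exists_gap_of_lt_specF {Q : ℝ → ℝ} {γ s : ℝ} (hγ : 0 < γ) (h : (s : EReal) < specF Q γ) :
    ∃ δ > 0, ∀ d, s * γ + δ ≤ Q d + d * γ := by
  have h1 : ((s * γ : ℝ) : EReal) < ⨅ d : ℝ, ((Q d + d * γ : ℝ) : EReal) := by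
    by_contra! hle
    refine absurd h (not_lt.mpr ?_)
    have h2 : (0 : EReal) ≤ ((γ⁻¹ : ℝ) : EReal) := by exact_mod_cast (inv_pos.mpr hγ).le
    refine (mul_le_mul_of_nonneg_left hle h2).trans (le_of_eq ?_)
    rw [← EReal.coe_mul]
    congr 1
    field_simp
  obtain ⟨t, ht, ht'⟩ := EReal.lt_iff_exists_real_btwn.mp h1
  refine ⟨t - s * γ, sub_pos.mpr (by exact_mod_cast ht), fun d => ?_⟩
  have : (t : EReal) ≤ ((Q d + d * γ : ℝ) : EReal) := ht'.le.trans (iInf_le _ d)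
  have : t ≤ Q d + d * γ := by exact_mod_cast this
  linarith

lemma exists_gap_of_lt_specFext {Q : ℝ → ℝ} {γ s e : ℝ} (hγ : 0 ≤ γ)
    (h : (s : EReal) < specFext Q γ) (he : 0 < e) :
    ∃ γ', |γ' - γ| ≤ e ∧ ∃ δ > 0, ∀ d, s * γ' + δ ≤ Q d + d * γ' := by
  rcases hγ.eq_or_lt with rfl | hγ
  · rw [specFext, if_pos rfl, specF0] at h
    have h1 := frequently_lt_of_lt_limsup (by isBoundedDefault) h
    have h2 : ∀ᶠ x : ℝ in 𝓝[>] (0 : ℝ), x ∈ Ioo 0 e := Ioo_mem_nhdsGT he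
    obtain ⟨x, hx, hx1, hx2⟩ := (h1.and_eventually h2).exists
    refine ⟨x, ?_, exists_gap_of_lt_specF hx1 hx⟩
    rw [sub_zero, abs_of_pos hx1]
    exact hx2.le
  · rw [specFext, if_neg hγ.ne'] at h
    exact ⟨γ, by simpa using he.le, exists_gap_of_lt_specF hγ h⟩

/-- **Proposition (lower bound for the level sets including the boundary).**
Assume `f` is non-exceptional, or exceptional with `Σ ∩ J = ∅`, and `α⁻ < α⁺`.
For `α⁻ ≤ α ≤ β ≤ α⁺` we have `dim_H 𝓛(α,β) ≥ min {F(α), F(β)}`. -/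
theorem lower_bound_levelSet (f : RSphere → RSphere) (p q : Polynomial ℂ)
    (hf : IsRationalMap f p q) (hdeg : 2 ≤ ratDeg p q)
    (hexc : ¬ IsExceptional f ∨ maxExceptional f ∩ juliaSet f = ∅)
    (hlt : alphaMinus f < alphaPlus f) :
    ∀ α β : ℝ, alphaMinus f ≤ α → α ≤ β → β ≤ alphaPlus f →
      min (Ffun f α) (Ffun f β) ≤ (dimH (levelSet f (α : EReal) (β : EReal)) : EReal) := by
  intro α β hα hαβ _
  have hα0 : 0 ≤ α := (alphaMinus_nonneg hf hdeg hexc hlt).trans hα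
  refine EReal.ge_of_forall_gt_iff_ge.mp fun s hs => ?_
  rcases lt_or_ge s 0 with hs0 | hs0
  · exact le_trans (by exact_mod_cast hs0.le) (EReal.coe_ennreal_nonneg _)
  obtain ⟨hsα, hsβ⟩ := lt_min_iff.mp hs
  obtain ⟨b, hb, hgood⟩ := exists_base_good hf hdeg hexc hlt
  have he : ∀ j : ℕ, (0 : ℝ) < 1 / ((j : ℝ) + 1) := fun j => by positivity
  have htend : Tendsto (fun j : ℕ => 1 / ((j : ℝ) + 1)) atTop (𝓝 0) :=
    tendsto_one_div_add_atTop_nhds_zero_nat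
  choose aα hα1 δα hδα hα2 using fun j => exists_gap_of_lt_specFext hα0 hsα (he j)
  choose aβ hβ1 δβ hδβ hβ2 using fun j => exists_gap_of_lt_specFext (hα0.trans hαβ) hsβ (he j)
  have hsmall : ∀ ε > 0, ∀ᶠ j : ℕ in atTop, 1 / ((j : ℝ) + 1) ≤ ε := fun ε hε =>
    htend.eventually_le_const hε
  suffices ENNReal.ofReal s ≤ dimH (levelSet f (α : EReal) (β : EReal)) by
    have h1 : ((ENNReal.ofReal s : ℝ≥0∞) : EReal) = (s : EReal) := by
      rw [EReal.coe_ennreal_ofReal, max_eq_left hs0]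
    rw [← h1]
    exact_mod_cast this
  have heven : ∃ᶠ j : ℕ in atTop, Even j :=
    frequently_atTop.mpr fun n => ⟨2 * n, by omega, even_two_mul n⟩
  have hodd : ∃ᶠ j : ℕ in atTop, ¬ Even j :=
    frequently_atTop.mpr fun n => ⟨2 * n + 1, by omega, by simp⟩
  refine le_dimH_levelSet_of_good (hf.hol hdeg) hb (η := fun j => 1 / ((j : ℝ) + 1))
    (a := fun j => if Even j then aα j else aβ j) he htend (fun ε hε => ?_) (fun ε hε => ?_)
    (fun ε hε => ?_) (fun ε hε => ?_) fun j => ?_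
  · filter_upwards [hsmall ε hε] with j hj
    have h1 := (abs_le.mp (hα1 j)).1
    have h2 := (abs_le.mp (hβ1 j)).1
    split_ifs <;> linarith
  · filter_upwards [hsmall ε hε] with j hj
    have h1 := (abs_le.mp (hα1 j)).2
    have h2 := (abs_le.mp (hβ1 j)).2
    split_ifs <;> linarith
  · refine (heven.and_eventually (hsmall ε hε)).mono fun j ⟨h, hj⟩ => ?_
    have h1 := (abs_le.mp (hα1 j)).2
    rw [if_pos h]
    linarith
  · refine (hodd.and_eventually (hsmall ε hε)).mono fun j ⟨h, hj⟩ => ?_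
    have h1 := (abs_le.mp (hβ1 j)).1
    rw [if_neg h]
    linarith
  · by_cases h : Even j
    · simp only [if_pos h]
      exact hgood _ _ _ _ hs0 (hδα j) (he j) (hα2 j)
    · simp only [if_neg h]
      exact hgood _ _ _ _ hs0 (hδβ j) (he j) (hβ2 j)
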